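/- arXiv:1806.02250 — 2 statements merged into one kernel-verified Lean document; each statement's English description precedes it below -/
import Mathlib

section
/- Let A be a primitive set and let q be a Mertens prime, i.e., a prime satisfying e^γ·∏_{p prime, p<q}(1 − 1/p) ≤ 1/log q. Then f(A'_q) ≤ f(q) = 1/(q·log q), where A'_q = {a ∈ A : the least prime factor of a equals q}. Consequently, if A'_q ⊆ {q} for every prime q that is not Mertens, then f(A) ≤ ∑_{p prime} 1/(p·log p). -/
open scoped BigOperators

/-- A set of positive integers is *primitive* if every element exceeds 1 and
no element divides another element. -/
def IsPrimitive (A : Set ℕ) : Prop :=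
  (∀ a ∈ A, 1 < a) ∧ ∀ a ∈ A, ∀ b ∈ A, a ≠ b → ¬ a ∣ b

/-- `f A = ∑_{a ∈ A} 1/(a log a)`. -/
noncomputable def f (A : Set ℕ) : ℝ :=
  ∑' a : A, 1 / ((a : ℕ) * Real.log (a : ℕ))

/-- A prime `q` is *Mertens* if `e^γ ∏_{p < q} (1 - 1/p) ≤ 1/log q`. -/
def IsMertens (q : ℕ) : Prop :=
  Real.exp Real.eulerMascheroniConstant * ∏ p ∈ q.primesBelow, (1 - 1 / (p : ℝ)) ≤
    1 / Real.log q

/-- The product `∏_{p < x} (1 - 1/p)` over primes. -/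
noncomputable def mertensProd (x : ℕ) : ℝ := ∏ p ∈ x.primesBelow, (1 - 1 / (p : ℝ))

lemma mertensProd_succ_of_prime {n : ℕ} (hn : n.Prime) :
    mertensProd (n + 1) = mertensProd n * (1 - 1 / (n : ℝ)) := by
  unfold mertensProd
  rw [Nat.primesBelow_succ, if_pos hn, Finset.prod_insert (Nat.notMem_primesBelow n), mul_comm]

lemma mertensProd_succ_of_not_prime {n : ℕ} (hn : ¬ n.Prime) :
    mertensProd (n + 1) = mertensProd n := by
  unfold mertensProd
  rw [Nat.primesBelow_succ, if_neg hn]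

lemma one_sub_one_div_prime_pos {p : ℕ} (hp : p.Prime) : (0 : ℝ) < 1 - 1 / (p : ℝ) := by
  have h : (1 : ℝ) < p := by exact_mod_cast hp.one_lt
  rw [sub_pos, div_lt_one (by linarith)]
  exact h

lemma mertensProd_pos (x : ℕ) : 0 < mertensProd x :=
  Finset.prod_pos fun _ hp => one_sub_one_div_prime_pos (Nat.prime_of_mem_primesBelow hp)

lemma mertensProd_antitone : Antitone mertensProd := by
  refine antitone_nat_of_succ_le fun n => ?_
  by_cases hn : n.Prime
  · rw [mertensProd_succ_of_prime hn]
    have h : (0 : ℝ) ≤ 1 / (n : ℝ) := by positivity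
    nlinarith [mertensProd_pos n]
  · rw [mertensProd_succ_of_not_prime hn]

lemma sum_mertensProd_div_prime {x N : ℕ} (h : x ≤ N) :
    ∑ p ∈ (Finset.Ico x N).filter Nat.Prime, mertensProd p / p
      = mertensProd x - mertensProd N := by
  induction N, h using Nat.le_induction with
  | base => simp
  | succ n hn ih =>
    rw [← Finset.insert_Ico_right_eq_Ico_add_one hn, Finset.filter_insert]
    by_cases hp : n.Prime
    · rw [if_pos hp, Finset.sum_insert (by simp), ih, mertensProd_succ_of_prime hp]
      ring
    · rw [if_neg hp, ih, mertensProd_succ_of_not_prime hp]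

/-- The larger of `x` and the greatest prime factor of `b`. -/
def maxPrimeFac (x b : ℕ) : ℕ := max x (b.primeFactors.sup id)

lemma maxPrimeFac_one (x : ℕ) : maxPrimeFac x 1 = x := by simp [maxPrimeFac]

lemma maxPrimeFac_prime_mul {x p c : ℕ} (hp : p.Prime) (hx : x ≤ p) (hc : c ≠ 0) :
    maxPrimeFac x (p * c) = maxPrimeFac p c := by
  unfold maxPrimeFac
  rw [Nat.primeFactors_mul hp.ne_zero hc, hp.primeFactors, Finset.sup_union,
    Finset.sup_singleton]
  exact max_eq_right (hx.trans (le_max_left _ _))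

/-- The sets of multiples `b * c` with all primes of `c` at least the largest prime of `b` are
disjoint for `b` in an antichain of `x`-rough numbers; this is the resulting density bound. -/
lemma sum_mertensProd_maxPrimeFac_le (N : ℕ) : ∀ (x : ℕ) (F : Finset ℕ),
    (∀ b ∈ F, 0 < b ∧ b < N ∧ ∀ p : ℕ, p.Prime → p ∣ b → x ≤ p) →
    (∀ a ∈ F, ∀ b ∈ F, a ∣ b → a = b) →
    ∑ b ∈ F, mertensProd (maxPrimeFac x b) / b ≤ mertensProd x := by
  induction N with
  | zero =>
    intro x F hF _
    rw [Finset.eq_empty_of_forall_notMem (s := F) fun b hb => by simpa using (hF b hb).2.1]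
    simpa using (mertensProd_pos x).le
  | succ N ih =>
    intro x F hF hA
    by_cases h1 : 1 ∈ F
    · have : F = {1} := Finset.eq_singleton_iff_unique_mem.2
        ⟨h1, fun b hb => (hA 1 h1 b hb (one_dvd b)).symm⟩
      simp [this, maxPrimeFac_one]
    have hne : ∀ b ∈ F, b ≠ 1 := fun b hb hb1 => h1 (hb1 ▸ hb)
    have hmaps : ∀ b ∈ F, b.minFac ∈ (Finset.Ico x (x + N + 1)).filter Nat.Prime := by
      intro b hb
      have hp := Nat.minFac_prime (hne b hb)
      obtain ⟨h0, h2, h3⟩ := hF b hb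
      have := Nat.minFac_le h0
      have := h3 _ hp (Nat.minFac_dvd b)
      simp only [Finset.mem_filter, Finset.mem_Ico]
      exact ⟨⟨this, by omega⟩, hp⟩
    rw [← Finset.sum_fiberwise_of_maps_to hmaps]
    calc _ ≤ ∑ p ∈ (Finset.Ico x (x + N + 1)).filter Nat.Prime, mertensProd p / p := by
          refine Finset.sum_le_sum fun p hp => ?_
          simp only [Finset.mem_filter, Finset.mem_Ico] at hp
          obtain ⟨⟨hxp, -⟩, hp⟩ := hp
          have hp0 : (0 : ℝ) < p := by exact_mod_cast hp.pos
          have hdec : ∀ b ∈ F.filter (fun b => b.minFac = p), b = p * (b / p) := by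
            intro b hb
            rw [Finset.mem_filter] at hb
            exact (Nat.mul_div_cancel' (hb.2 ▸ Nat.minFac_dvd b)).symm
          have hinj : Set.InjOn (fun b => b / p) (F.filter (fun b => b.minFac = p)) := by
            intro a ha b hb hab
            rw [hdec a ha, hdec b hb]
            exact congrArg (p * ·) hab
          have key := ih p ((F.filter (fun b => b.minFac = p)).image (fun b => b / p)) ?_ ?_
          · rw [Finset.sum_image hinj] at key
            calc _ = (∑ b ∈ F.filter (fun b => b.minFac = p),
                  mertensProd (maxPrimeFac p (b / p)) / ((b / p : ℕ) : ℝ)) / p := by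
                  rw [Finset.sum_div]
                  refine Finset.sum_congr rfl fun b hb => ?_
                  have hb' := hdec b hb
                  have hb0 := (hF b (Finset.mem_filter.1 hb).1).1
                  have hc : b / p ≠ 0 := fun h => by rw [h] at hb'; omega
                  conv_lhs => rw [hb']
                  rw [maxPrimeFac_prime_mul hp hxp hc, div_div]
                  push_cast
                  rw [mul_comm]
              _ ≤ _ := by gcongr
          · intro c hc
            obtain ⟨b, hb, rfl⟩ := Finset.mem_image.1 hc
            have hb' := hdec b hb
            rw [Finset.mem_filter] at hb
            obtain ⟨h0, h2, h3⟩ := hF b hb.1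
            refine ⟨Nat.pos_of_ne_zero fun h => by rw [h] at hb'; omega, ?_, ?_⟩
            · have := Nat.div_lt_self h0 hp.one_lt
              omega
            · intro r hr hrb
              rw [← hb.2]
              exact Nat.minFac_le_of_dvd hr.two_le (hb' ▸ Dvd.dvd.mul_left hrb p)
          · intro c hc d hd hcd
            obtain ⟨a, ha, rfl⟩ := Finset.mem_image.1 hc
            obtain ⟨b, hb, rfl⟩ := Finset.mem_image.1 hd
            have hab : a ∣ b := by
              rw [hdec a ha, hdec b hb]
              exact mul_dvd_mul_left p hcd
            rw [hA a (Finset.mem_filter.1 ha).1 b (Finset.mem_filter.1 hb).1 hab]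
      _ = mertensProd x - mertensProd (x + N + 1) := sum_mertensProd_div_prime (by omega)
      _ ≤ mertensProd x := by linarith [mertensProd_pos (x + N + 1)]

open Filter Topology in
/-- Real form of the Euler product for the zeta function. -/
lemma tendsto_prod_primesBelow_zeta {s : ℝ} (hs : 0 < s) :
    Tendsto (fun n : ℕ => ∏ p ∈ n.primesBelow, (1 - (p : ℝ) ^ (-(1 + s)))⁻¹) atTop
      (𝓝 (riemannZeta (1 + s)).re) := by
  have h := riemannZeta_eulerProduct (s := 1 + (s : ℂ)) (by simpa using hs)
  refine ((Complex.continuous_re.tendsto _).comp h).congr fun n => ?_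
  have : ∏ p ∈ n.primesBelow, (1 - (p : ℂ) ^ (-(1 + (s : ℂ))))⁻¹
      = ((∏ p ∈ n.primesBelow, (1 - (p : ℝ) ^ (-(1 + s)))⁻¹ : ℝ) : ℂ) := by
    push_cast
    refine Finset.prod_congr rfl fun p _ => ?_
    rw [Complex.ofReal_cpow (Nat.cast_nonneg p)]
    push_cast
    rfl
  rw [Function.comp_apply, this, Complex.ofReal_re]

open Filter Topology in
lemma tendsto_mul_zeta_one_add :
    Tendsto (fun s : ℝ => s * (riemannZeta (1 + s)).re) (𝓝[>] 0) (𝓝 1) := by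
  have h1 : Tendsto (fun s : ℝ => 1 + (s : ℂ)) (𝓝[>] 0) (𝓝[≠] 1) := by
    refine tendsto_nhdsWithin_iff.2 ⟨?_, ?_⟩
    · have : Continuous fun s : ℝ => 1 + (s : ℂ) := by fun_prop
      simpa using (this.tendsto 0).mono_left nhdsWithin_le_nhds
    · filter_upwards [self_mem_nhdsWithin] with s hs
      have hs' : s ≠ 0 := ne_of_gt hs
      simpa using hs'
  have h := (Complex.continuous_re.tendsto _).comp (riemannZeta_residue_one.comp h1)
  refine (h.congr fun s => ?_)
  simp

/-- Abel summation: if the partial sums of `c` are nonnegative, so are those of `c * g` for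
antitone nonnegative `g`. -/
lemma sum_range_mul_nonneg_of_antitone {c g : ℕ → ℝ}
    (hc : ∀ n, 0 ≤ ∑ i ∈ Finset.range n, c i) (hg : Antitone g) (hg0 : ∀ n, 0 ≤ g n) (n : ℕ) :
    0 ≤ ∑ i ∈ Finset.range n, c i * g i := by
  suffices h : (∑ i ∈ Finset.range n, c i) * g n ≤ ∑ i ∈ Finset.range n, c i * g i from
    (mul_nonneg (hc n) (hg0 n)).trans h
  induction n with
  | zero => simp
  | succ n ih =>
    have h := mul_le_mul_of_nonneg_left (hg n.le_succ) (hc (n + 1))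
    rw [Finset.sum_range_succ] at h ⊢
    rw [Finset.sum_range_succ]
    linarith

lemma sum_range_le_sum_prime_rpow {x : ℕ} {s : ℝ} (hs : 0 < s) (n : ℕ) :
    ∑ i ∈ Finset.range n,
      (∑ p ∈ Finset.Ico (⌊Real.exp ((i : ℝ) - 1)⌋₊ + 1) (⌊Real.exp i⌋₊ + 1),
        (if p.Prime ∧ x ≤ p then (1 : ℝ) / p else 0)) * Real.exp (-(s * i))
      ≤ ∑ p ∈ Finset.range (⌊Real.exp ((n : ℝ) - 1)⌋₊ + 1),
        (if p.Prime ∧ x ≤ p then (p : ℝ) ^ (-(1 + s)) else 0) := by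
  induction n with
  | zero => exact Finset.sum_nonneg fun p _ => by split_ifs <;> positivity
  | succ n ih =>
    have hmn : ⌊Real.exp ((n : ℝ) - 1)⌋₊ + 1 ≤ ⌊Real.exp n⌋₊ + 1 :=
      Nat.succ_le_succ (Nat.floor_le_floor (Real.exp_le_exp.2 (by linarith)))
    have hcast : ((n + 1 : ℕ) : ℝ) - 1 = n := by push_cast; ring
    rw [Finset.sum_range_succ, hcast, ← Finset.sum_range_add_sum_Ico _ hmn]
    refine add_le_add ih ?_
    rw [Finset.sum_mul]
    refine Finset.sum_le_sum fun p hp => ?_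
    split_ifs with h
    · have hp0 : (0 : ℝ) < p := by exact_mod_cast h.1.pos
      rw [Finset.mem_Ico, Nat.lt_succ_iff, Nat.le_floor_iff (Real.exp_pos _).le] at hp
      rw [neg_add, Real.rpow_add hp0, Real.rpow_neg_one, one_div]
      refine mul_le_mul_of_nonneg_left ?_ (by positivity)
      rw [Real.rpow_def_of_pos hp0]
      have := (Real.log_le_iff_le_exp hp0).2 hp.2
      exact Real.exp_le_exp.2 (by nlinarith)
    · simp

lemma hasSum_exp_neg_div {s : ℝ} (hs : 0 < s) :
    HasSum (fun n : ℕ => Real.exp (-(s * (n + 1 : ℕ))) / (n + 1 : ℕ))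
      (-Real.log (1 - Real.exp (-s))) := by
  have h := Real.hasSum_pow_div_log_of_abs_lt_one (x := Real.exp (-s))
    (by rw [abs_of_pos (Real.exp_pos _)]; simpa using hs)
  refine h.congr_fun fun n => ?_
  rw [← Real.exp_nat_mul]
  push_cast
  ring_nf

lemma prod_mul_exp_sum_le_prod {x m : ℕ} {s : ℝ} (hs : 0 < s) (h : x ≤ m) :
    (∏ p ∈ x.primesBelow, (1 - (p : ℝ) ^ (-(1 + s)))⁻¹) *
      Real.exp (∑ p ∈ Finset.range m,
        (if p.Prime ∧ x ≤ p then (p : ℝ) ^ (-(1 + s)) else 0))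
      ≤ ∏ p ∈ m.primesBelow, (1 - (p : ℝ) ^ (-(1 + s)))⁻¹ := by
  have hlt : ∀ p : ℕ, p.Prime → (p : ℝ) ^ (-(1 + s)) < 1 := fun p hp =>
    Real.rpow_lt_one_of_one_lt_of_neg (by exact_mod_cast hp.one_lt) (by linarith)
  induction m, h using Nat.le_induction with
  | base =>
    rw [Finset.sum_eq_zero, Real.exp_zero, mul_one]
    intro p hp
    rw [if_neg]
    rintro ⟨-, h⟩
    exact absurd (Finset.mem_range.1 hp) (not_lt.2 h)
  | succ n hn ih =>
    rw [Finset.sum_range_succ, Nat.primesBelow_succ, Real.exp_add, ← mul_assoc]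
    by_cases hp : n.Prime
    · rw [if_pos hp, if_pos ⟨hp, hn⟩, Finset.prod_insert (Nat.notMem_primesBelow n), mul_comm]
      have h1 := hlt n hp
      refine mul_le_mul ?_ ih ?_ ?_
      · rw [le_inv_comm₀ (Real.exp_pos _) (by linarith), ← Real.exp_neg]
        linarith [Real.add_one_le_exp (-(n : ℝ) ^ (-(1 + s)))]
      · refine mul_nonneg (Finset.prod_nonneg fun p hp => ?_) (Real.exp_pos _).le
        exact inv_nonneg.2 (by linarith [hlt p (Nat.prime_of_mem_primesBelow hp)])
      · exact inv_nonneg.2 (by linarith)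
    · rw [if_neg hp, if_neg fun h => hp h.1, Real.exp_zero, mul_one]
      exact ih

/-- The weights `c` at `N`, then `1 / i` for `i > N`. -/
noncomputable def harmonicTail (N : ℕ) (c : ℝ) (i : ℕ) : ℝ :=
  if i < N then 0 else if i = N then c else 1 / i

lemma sum_range_harmonicTail_mul (N : ℕ) (c : ℝ) (w : ℕ → ℝ) (k : ℕ) :
    ∑ i ∈ Finset.range (N + k + 1), harmonicTail N c i * w i
      = c * w N + ((∑ j ∈ Finset.range (N + k), w (j + 1) / (j + 1 : ℕ))
        - ∑ j ∈ Finset.range N, w (j + 1) / (j + 1 : ℕ)) := by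
  induction k with
  | zero =>
    rw [add_zero, Finset.sum_range_succ, Finset.sum_eq_zero]
    · simp [harmonicTail]
    · intro i hi
      simp [harmonicTail, Finset.mem_range.1 hi]
  | succ k ih =>
    rw [← add_assoc, Finset.sum_range_succ, ih, Finset.sum_range_succ _ (N + k)]
    have h1 : ¬ N + k + 1 < N := by omega
    have h2 : ¬ N + k + 1 = N := by omega
    simp only [harmonicTail, if_neg h1, if_neg h2]
    ring

lemma sum_range_harmonicTail_eq_zero {N n : ℕ} (c : ℝ) (h : n ≤ N) :
    ∑ i ∈ Finset.range n, harmonicTail N c i = 0 :=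
  Finset.sum_eq_zero fun i hi => by
    simp [harmonicTail, (Finset.mem_range.1 hi).trans_le h]

lemma harmonic_sub_log_le {N n : ℕ} (hN : 0 < N) (h : N ≤ n) :
    (harmonic n : ℝ) - Real.log n ≤ harmonic N - Real.log N := by
  have := Real.strictAnti_eulerMascheroniSeq'.antitone h
  simpa [Real.eulerMascheroniSeq', hN.ne', (hN.trans_le h).ne'] using this

lemma harmonic_cast_eq (n : ℕ) :
    (harmonic n : ℝ) = ∑ j ∈ Finset.range n, (1 : ℝ) / (j + 1 : ℕ) := by
  simp [harmonic]

lemma harmonicTail_mul_exp_le {x N : ℕ} {X s : ℝ} (hs : 0 < s) (hN : 0 < N)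
    (hXN : X ≤ Real.exp N)
    (h : ∀ v : ℕ, X ≤ v → Real.log (Real.log v) - Real.log (Real.log X)
      ≤ ∑ p ∈ Finset.range v, (if p.Prime ∧ x ≤ p then (1 : ℝ) / p else 0)) (n : ℕ) :
    ∑ i ∈ Finset.range n, harmonicTail N (Real.log N - Real.log (Real.log X)) i *
        Real.exp (-(s * i))
      ≤ ∑ p ∈ Finset.range (⌊Real.exp ((n : ℝ) - 1)⌋₊ + 1),
        (if p.Prime ∧ x ≤ p then (p : ℝ) ^ (-(1 + s)) else 0) := by
  refine le_trans ?_ (sum_range_le_sum_prime_rpow hs n)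
  rw [← sub_nonneg, ← Finset.sum_sub_distrib]
  simp only [← sub_mul]
  refine sum_range_mul_nonneg_of_antitone (g := fun i : ℕ => Real.exp (-(s * i))) ?_ ?_
    (fun _ => (Real.exp_pos _).le) n
  · intro n
    have hS : ∑ i ∈ Finset.range n,
        ∑ p ∈ Finset.Ico (⌊Real.exp ((i : ℝ) - 1)⌋₊ + 1) (⌊Real.exp i⌋₊ + 1),
          (if p.Prime ∧ x ≤ p then (1 : ℝ) / p else 0)
        = ∑ p ∈ Finset.range (⌊Real.exp ((n : ℝ) - 1)⌋₊ + 1),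
          (if p.Prime ∧ x ≤ p then (1 : ℝ) / p else 0) := by
      induction n with
      | zero =>
        have : ⌊Real.exp (-1)⌋₊ = 0 := Nat.floor_eq_zero.2 (by simp)
        simp [this]
      | succ n ih =>
        have hmn : ⌊Real.exp ((n : ℝ) - 1)⌋₊ + 1 ≤ ⌊Real.exp n⌋₊ + 1 :=
          Nat.succ_le_succ (Nat.floor_le_floor (Real.exp_le_exp.2 (by linarith)))
        have hcast : ((n + 1 : ℕ) : ℝ) - 1 = n := by push_cast; ring
        rw [Finset.sum_range_succ, ih, hcast, Finset.sum_range_add_sum_Ico _ hmn]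
    rw [Finset.sum_sub_distrib, hS, sub_nonneg]
    rcases le_or_gt n N with hn | hn
    · rw [sum_range_harmonicTail_eq_zero _ hn]
      exact Finset.sum_nonneg fun p _ => by split_ifs <;> positivity
    · obtain ⟨k, rfl⟩ : ∃ k, n = N + k + 1 := ⟨n - N - 1, by omega⟩
      have hb := sum_range_harmonicTail_mul N (Real.log N - Real.log (Real.log X))
        (fun _ => 1) k
      simp only [mul_one] at hb
      rw [hb, ← harmonic_cast_eq, ← harmonic_cast_eq]
      have hcast : ((N + k + 1 : ℕ) : ℝ) - 1 = (N + k : ℕ) := by push_cast; ring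
      rw [hcast]
      have hlt := Nat.lt_floor_add_one (Real.exp ((N + k : ℕ) : ℝ))
      have hNk : (0 : ℝ) < (N + k : ℕ) := by exact_mod_cast (by omega)
      have hle : Real.exp N ≤ Real.exp ((N + k : ℕ) : ℝ) :=
        Real.exp_le_exp.2 (by push_cast; linarith [(Nat.cast_nonneg k : (0 : ℝ) ≤ k)])
      refine le_trans ?_ (h _ (by rw [Nat.cast_add_one]; linarith))
      have h1 : Real.log (N + k : ℕ) ≤
          Real.log (Real.log ((⌊Real.exp ((N + k : ℕ) : ℝ)⌋₊ + 1 : ℕ) : ℝ)) := by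
        refine Real.log_le_log hNk ?_
        rw [Real.le_log_iff_exp_le (by positivity)]
        push_cast at hlt ⊢
        exact hlt.le
      have h2 := harmonic_sub_log_le hN (Nat.le_add_right N k)
      linarith
  · intro i j hij
    have : (i : ℝ) ≤ j := by exact_mod_cast hij
    exact Real.exp_le_exp.2 (by nlinarith)

open Filter Topology in
lemma exp_mul_inv_mul_prod_le_zeta {x N : ℕ} {X s : ℝ} (hs : 0 < s) (hN : 0 < N)
    (hXN : X ≤ Real.exp N)
    (h : ∀ v : ℕ, X ≤ v → Real.log (Real.log v) - Real.log (Real.log X)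
      ≤ ∑ p ∈ Finset.range v, (if p.Prime ∧ x ≤ p then (1 : ℝ) / p else 0)) :
    (∏ p ∈ x.primesBelow, (1 - (p : ℝ) ^ (-(1 + s)))⁻¹) *
      Real.exp ((Real.log N - Real.log (Real.log X)) * Real.exp (-(s * N))
        + (-Real.log (1 - Real.exp (-s))
          - ∑ j ∈ Finset.range N, Real.exp (-(s * (j + 1 : ℕ))) / (j + 1 : ℕ)))
      ≤ (riemannZeta (1 + s)).re := by
  have hm : Tendsto (fun k : ℕ => ⌊Real.exp (((N + k + 1 : ℕ) : ℝ) - 1)⌋₊ + 1) atTop atTop := by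
    refine tendsto_atTop_mono (fun k => ?_) tendsto_id
    have h1 : (k : ℝ) ≤ Real.exp (((N + k + 1 : ℕ) : ℝ) - 1) := by
      refine le_trans ?_ (Real.add_one_le_exp _)
      push_cast
      linarith [(Nat.cast_nonneg N : (0 : ℝ) ≤ N)]
    exact (Nat.le_floor h1).trans (Nat.le_succ _)
  have hl := (tendsto_prod_primesBelow_zeta hs).comp hm
  have hsum := (hasSum_exp_neg_div hs).tendsto_sum_nat.comp (tendsto_add_atTop_nat N)
  refine le_of_tendsto_of_tendsto (f := fun k : ℕ =>
    (∏ p ∈ x.primesBelow, (1 - (p : ℝ) ^ (-(1 + s)))⁻¹) *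
      Real.exp ((Real.log N - Real.log (Real.log X)) * Real.exp (-(s * N))
        + ((∑ j ∈ Finset.range (k + N), Real.exp (-(s * (j + 1 : ℕ))) / (j + 1 : ℕ))
          - ∑ j ∈ Finset.range N, Real.exp (-(s * (j + 1 : ℕ))) / (j + 1 : ℕ))))
    ?_ hl ?_
  · exact (((hsum.sub_const _).const_add _).rexp).const_mul _
  · filter_upwards [hm.eventually_ge_atTop x] with k hk
    refine le_trans ?_ (prod_mul_exp_sum_le_prod hs hk)
    refine mul_le_mul_of_nonneg_left (Real.exp_le_exp.2 ?_) ?_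
    · have h1 := harmonicTail_mul_exp_le hs hN hXN h (N + k + 1)
      rw [sum_range_harmonicTail_mul N _ (fun i : ℕ => Real.exp (-(s * i)))] at h1
      rw [add_comm k N]
      exact h1
    · refine Finset.prod_nonneg fun p hp => inv_nonneg.2 (sub_nonneg.2 ?_)
      have := (Nat.prime_of_mem_primesBelow hp).one_lt
      exact (Real.rpow_lt_one_of_one_lt_of_neg (by exact_mod_cast this) (by linarith)).le

open Filter Topology in
lemma tendsto_one_sub_exp_neg_div :
    Tendsto (fun s : ℝ => s / (1 - Real.exp (-s))) (𝓝[>] 0) (𝓝 1) := by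
  have h : HasDerivAt (fun s : ℝ => 1 - Real.exp (-s)) 1 0 := by
    simpa using ((hasDerivAt_neg (0 : ℝ)).exp).const_sub 1
  have h2 := (h.tendsto_slope_zero_right).inv₀ one_ne_zero
  simpa [div_eq_mul_inv, mul_comm] using h2

open Filter Topology in
/-- A lower bound for `∏_{p < x} (1 - 1/p)` from a lower bound for the partial sums of
`∑_{p ≥ x} 1/p`. -/
lemma one_le_exp_eulerMascheroni_mul_mertensProd_mul_log {x : ℕ} {X : ℝ} (hX : 1 < X)
    (h : ∀ v : ℕ, X ≤ v → Real.log (Real.log v) - Real.log (Real.log X)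
      ≤ ∑ p ∈ Finset.range v, (if p.Prime ∧ x ≤ p then (1 : ℝ) / p else 0)) :
    1 ≤ Real.exp Real.eulerMascheroniConstant * mertensProd x * Real.log X := by
  have hlogX : 0 < Real.log X := Real.log_pos hX
  have hprod : Tendsto (fun s : ℝ => ∏ p ∈ x.primesBelow, (1 - (p : ℝ) ^ (-(1 + s)))⁻¹)
      (𝓝[>] 0) (𝓝 (mertensProd x)⁻¹) := by
    rw [mertensProd, ← Finset.prod_inv_distrib]
    refine tendsto_finsetProd _ fun p hp => ?_
    have hpr := Nat.prime_of_mem_primesBelow hp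
    have hp0 : (p : ℝ) ≠ 0 := by exact_mod_cast hpr.ne_zero
    have hc : ContinuousAt (fun s : ℝ => (p : ℝ) ^ (-(1 + s))) 0 :=
      (Real.continuousAt_const_rpow hp0).comp (f := fun s : ℝ => -(1 + s)) (by fun_prop)
    have h1 : Tendsto (fun s : ℝ => (p : ℝ) ^ (-(1 + s))) (𝓝[>] 0) (𝓝 (1 / (p : ℝ))) := by
      have := hc.tendsto.mono_left (nhdsWithin_le_nhds (s := Set.Ioi 0))
      simpa [Real.rpow_neg_one] using this
    exact (h1.const_sub 1).inv₀ (one_sub_one_div_prime_pos hpr).ne'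
  have hbound : ∀ᶠ N : ℕ in atTop,
      1 ≤ mertensProd x * Real.log X * Real.exp ((harmonic N : ℝ) - Real.log N) := by
    filter_upwards [eventually_gt_atTop 0,
      (Real.tendsto_exp_atTop.comp tendsto_natCast_atTop_atTop).eventually_ge_atTop X]
      with N hN hXN
    have hl : Tendsto (fun s : ℝ => (∏ p ∈ x.primesBelow, (1 - (p : ℝ) ^ (-(1 + s)))⁻¹) *
        (Real.exp ((Real.log N - Real.log (Real.log X)) * Real.exp (-(s * N))
          - ∑ j ∈ Finset.range N, Real.exp (-(s * (j + 1 : ℕ))) / (j + 1 : ℕ)) *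
          (s / (1 - Real.exp (-s))))) (𝓝[>] 0)
        (𝓝 ((mertensProd x)⁻¹ *
          (Real.exp ((Real.log N - Real.log (Real.log X)) - harmonic N) * 1))) := by
      refine hprod.mul (Tendsto.mul ?_ tendsto_one_sub_exp_neg_div)
      have hc : Continuous fun s : ℝ =>
          Real.exp ((Real.log N - Real.log (Real.log X)) * Real.exp (-(s * N))
          - ∑ j ∈ Finset.range N, Real.exp (-(s * (j + 1 : ℕ))) / (j + 1 : ℕ)) := by fun_prop
      have := (hc.tendsto 0).mono_left (nhdsWithin_le_nhds (s := Set.Ioi 0))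
      rw [harmonic_cast_eq]
      simpa using this
    have hle := le_of_tendsto_of_tendsto hl tendsto_mul_zeta_one_add ?_
    · rw [mul_one, inv_mul_le_iff₀ (mertensProd_pos x), mul_one, sub_right_comm,
        Real.exp_sub, Real.exp_log hlogX, div_le_iff₀ hlogX] at hle
      calc (1 : ℝ) = Real.exp (Real.log N - harmonic N) *
            Real.exp (harmonic N - Real.log N) := by
            rw [← Real.exp_add]
            simp
        _ ≤ _ := by gcongr
    · filter_upwards [self_mem_nhdsWithin] with s hs
      have hs : 0 < s := hs
      have h0 : 0 < 1 - Real.exp (-s) := by simpa using hs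
      have h1 := mul_le_mul_of_nonneg_left (exp_mul_inv_mul_prod_le_zeta hs hN hXN h) hs.le
      refine le_trans (le_of_eq ?_) h1
      rw [show ∀ a b c : ℝ, a + (-b - c) = (a - c) - b by intros; ring, Real.exp_sub _ (Real.log _),
        Real.exp_log h0]
      ring
  have hlim : Tendsto (fun N : ℕ =>
      mertensProd x * Real.log X * Real.exp ((harmonic N : ℝ) - Real.log N)) atTop
      (𝓝 (mertensProd x * Real.log X * Real.exp Real.eulerMascheroniConstant)) :=
    (Real.tendsto_harmonic_sub_log.rexp).const_mul _
  have := ge_of_tendsto hlim hbound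
  linarith

lemma log_log_sub_le_sum_of_log_sub_le {x : ℕ} {X : ℝ} (hX : 2 ≤ X)
    (h : ∀ n : ℕ, X ≤ n → Real.log n - Real.log X
      ≤ ∑ p ∈ Finset.range n, (if p.Prime ∧ x ≤ p then Real.log p / p else 0))
    (v : ℕ) (hv : X ≤ v) :
    Real.log (Real.log v) - Real.log (Real.log X)
      ≤ ∑ p ∈ Finset.range v, (if p.Prime ∧ x ≤ p then (1 : ℝ) / p else 0) := by
  have hlogX : 0 < Real.log X := Real.log_pos (by linarith)
  set l : ℕ → ℝ := fun i => max (Real.log i) (Real.log X) with hl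
  have hlpos : ∀ i, 0 < l i := fun i => hlogX.trans_le (le_max_right _ _)
  have hlmono : Monotone l := by
    intro i j hij
    refine max_le_max ?_ le_rfl
    rcases Nat.eq_zero_or_pos i with rfl | hi
    · simpa using Real.log_natCast_nonneg j
    · exact Real.log_le_log (by exact_mod_cast hi) (by exact_mod_cast hij)
  set g : ℕ → ℝ := fun i => 1 / Real.log (max i 2 : ℕ) with hg
  have hgpos : ∀ i, 0 < Real.log (max i 2 : ℕ) := fun i =>
    Real.log_pos (by exact_mod_cast (le_max_right i 2))
  have hganti : Antitone g := by
    intro i j hij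
    refine one_div_le_one_div_of_le (hgpos i) (Real.log_le_log ?_ ?_)
    · exact_mod_cast (by omega)
    · exact_mod_cast max_le_max hij le_rfl
  have hsumb : ∀ n, ∑ i ∈ Finset.range n, (l (i + 1) - l i) = l n - Real.log X := by
    intro n
    rw [Finset.sum_range_sub]
    simp [hl, hlogX.le]
  have key := sum_range_mul_nonneg_of_antitone
    (c := fun i => (if i.Prime ∧ x ≤ i then Real.log i / i else 0) - (l (i + 1) - l i)) (g := g)
    ?_ hganti (fun i => (one_div_pos.2 (hgpos i)).le) v
  · have key' : ∑ i ∈ Finset.range v, (l (i + 1) - l i) * g i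
        ≤ ∑ i ∈ Finset.range v, (if i.Prime ∧ x ≤ i then Real.log i / i else 0) * g i := by
      rw [← sub_nonneg, ← Finset.sum_sub_distrib]
      convert key using 2
      ring
    calc _ = ∑ i ∈ Finset.range v, (Real.log (l (i + 1)) - Real.log (l i)) := by
          rw [Finset.sum_range_sub (fun i => Real.log (l i))]
          have : Real.log X ≤ Real.log v := Real.log_le_log (by linarith) hv
          simp [hl, hlogX.le, this]
      _ ≤ ∑ i ∈ Finset.range v, (l (i + 1) - l i) * g i := by
          refine Finset.sum_le_sum fun i _ => ?_
          have h1 : Real.log (l (i + 1)) - Real.log (l i) ≤ (l (i + 1) - l i) / l i := by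
            rw [← Real.log_div (hlpos _).ne' (hlpos _).ne', sub_div, div_self (hlpos i).ne']
            exact Real.log_le_sub_one_of_pos (div_pos (hlpos _) (hlpos _))
          refine h1.trans ?_
          rw [div_eq_mul_one_div]
          refine mul_le_mul_of_nonneg_left (one_div_le_one_div_of_le (hgpos i) ?_)
            (sub_nonneg.2 (hlmono i.le_succ))
          rcases le_total i 2 with hi | hi
          · rw [max_eq_right hi]
            exact le_max_of_le_right (Real.log_le_log (by norm_num) (by exact_mod_cast hX))
          · rw [max_eq_left hi]
            exact le_max_left _ _
      _ ≤ ∑ i ∈ Finset.range v, (if i.Prime ∧ x ≤ i then Real.log i / i else 0) * g i := key'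
      _ = _ := by
          refine Finset.sum_congr rfl fun p _ => ?_
          split_ifs with hp
          · have h2 := hp.1.two_le
            have : Real.log p ≠ 0 := (Real.log_pos (by exact_mod_cast hp.1.one_lt)).ne'
            simp only [hg, max_eq_left h2]
            field_simp
          · simp
  · intro n
    rw [Finset.sum_sub_distrib, hsumb, sub_nonneg]
    rcases le_or_gt X n with hn | hn
    · have : Real.log X ≤ Real.log n := Real.log_le_log (by linarith) hn
      simp only [hl, max_eq_left this]
      exact h n hn
    · have : Real.log n ≤ Real.log X := by
        rcases Nat.eq_zero_or_pos n with rfl | h0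
        · simpa using hlogX.le
        · exact Real.log_le_log (by exact_mod_cast h0) hn.le
      simp only [hl, max_eq_right this, sub_self]
      exact Finset.sum_nonneg fun p _ => by
        split_ifs
        · exact div_nonneg (Real.log_natCast_nonneg p) (Nat.cast_nonneg p)
        · exact le_rfl

lemma mul_log_add_one_sub_le_log_factorial (n : ℕ) :
    n * Real.log (n + 1 : ℕ) - n ≤ Real.log n.factorial := by
  induction n with
  | zero => simp
  | succ n ih =>
    have h0 : (0 : ℝ) < (n + 1 : ℕ) := by positivity
    have h1 : (0 : ℝ) < (n + 1 + 1 : ℕ) := by positivity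
    rw [Nat.factorial_succ, Nat.cast_mul, Real.log_mul h0.ne' (by positivity)]
    have h2 : Real.log (n + 1 + 1 : ℕ) - Real.log (n + 1 : ℕ) ≤ 1 / (n + 1 : ℕ) := by
      rw [← Real.log_div h1.ne' h0.ne']
      refine (Real.log_le_sub_one_of_pos (div_pos h1 h0)).trans (le_of_eq ?_)
      rw [div_sub_one h0.ne']
      push_cast
      ring
    have h3 := mul_le_mul_of_nonneg_left h2 h0.le
    rw [mul_one_div_cancel h0.ne'] at h3
    push_cast at *
    linarith

lemma log_factorial_le {n : ℕ} (hn : 1 ≤ n) :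
    Real.log n.factorial ≤ n * Real.log n - n + Real.log n + 1 := by
  induction n, hn using Nat.le_induction with
  | base => simp
  | succ n hn ih =>
    have h0 : (0 : ℝ) < n := by exact_mod_cast hn
    have h1 : (0 : ℝ) < (n + 1 : ℕ) := by positivity
    rw [Nat.factorial_succ, Nat.cast_mul, Real.log_mul h1.ne' (by positivity)]
    have h2 : Real.log n - Real.log (n + 1 : ℕ) ≤ -(1 / (n + 1 : ℕ)) := by
      rw [← Real.log_div h0.ne' h1.ne']
      refine (Real.log_le_sub_one_of_pos (div_pos h0 h1)).trans (le_of_eq ?_)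
      rw [div_sub_one h1.ne']
      push_cast
      ring
    have h3 := mul_le_mul_of_nonneg_left h2 h1.le
    rw [mul_neg, mul_one_div_cancel h1.ne'] at h3
    push_cast at *
    linarith

lemma log_factorial_eq_sum (n : ℕ) :
    Real.log n.factorial
      = ∑ p ∈ (n + 1).primesBelow, (n.factorial.factorization p : ℝ) * Real.log p := by
  rw [Real.log_nat_eq_sum_factorization]
  refine Finsupp.sum_of_support_subset _ ?_ _ (by simp)
  intro p hp
  rw [Nat.support_factorization, Nat.mem_primeFactors] at hp
  rw [Nat.mem_primesBelow]
  exact ⟨Nat.lt_succ_of_le ((hp.1.dvd_factorial).1 hp.2.1), hp.1⟩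

/-- The defect `n / (p - 1) - v_p(n!)` weighted by `log p`. -/
noncomputable def legendreDefect (n p : ℕ) : ℝ :=
  Real.log p * (n / ((p : ℝ) - 1) - n.factorial.factorization p)

lemma legendreDefect_eq {p : ℕ} (hp : p.Prime) (n : ℕ) :
    legendreDefect n p = Real.log p * ((p.digits n).sum / ((p : ℝ) - 1)) := by
  have := Fact.mk hp
  have h := sub_one_mul_padicValNat_factorial (p := p) n
  have hle : (p.digits n).sum ≤ n := Nat.digit_sum_le p n
  have hp1 : (0 : ℝ) < (p : ℝ) - 1 := by
    have : (1 : ℝ) < p := by exact_mod_cast hp.one_lt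
    linarith
  have h2 : ((p : ℝ) - 1) * (n.factorial.factorization p : ℝ) = n - (p.digits n).sum := by
    rw [Nat.factorization_def _ hp]
    have := congrArg (Nat.cast : ℕ → ℝ) h
    rw [Nat.cast_mul, Nat.cast_sub hle, Nat.cast_sub hp.one_le, Nat.cast_one] at this
    exact this
  unfold legendreDefect
  congr 1
  field_simp
  linarith

lemma legendreDefect_nonneg {p : ℕ} (hp : p.Prime) (n : ℕ) : 0 ≤ legendreDefect n p := by
  rw [legendreDefect_eq hp]
  have : (1 : ℝ) < p := by exact_mod_cast hp.one_lt
  exact mul_nonneg (Real.log_natCast_nonneg p) (div_nonneg (Nat.cast_nonneg _) (by linarith))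

lemma legendreDefect_le_log_add_log {p n : ℕ} (hp : p.Prime) (hn : n ≠ 0) :
    legendreDefect n p ≤ Real.log n + Real.log p := by
  have h1 : (1 : ℝ) < p := by exact_mod_cast hp.one_lt
  have hlogp := Real.log_pos h1
  have hdig : (p.digits n).sum ≤ (Nat.log p n + 1) * (p - 1) := by
    rw [← Nat.length_digits p n hp.one_lt hn, ← smul_eq_mul]
    exact List.sum_le_card_nsmul _ _ fun d hd =>
      Nat.le_sub_one_of_lt (Nat.digits_lt_base hp.one_lt hd)
  have hdig' : ((p.digits n).sum : ℝ) / ((p : ℝ) - 1) ≤ Nat.log p n + 1 := by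
    rw [div_le_iff₀ (by linarith)]
    have := (Nat.cast_le (α := ℝ)).2 hdig
    rw [Nat.cast_mul, Nat.cast_sub hp.one_le, Nat.cast_add, Nat.cast_one] at this
    exact this
  have hlog : (Nat.log p n : ℝ) * Real.log p ≤ Real.log n := by
    rw [← Real.log_pow]
    refine Real.log_le_log (by positivity) ?_
    exact_mod_cast Nat.pow_log_le_self p hn
  rw [legendreDefect_eq hp]
  have := mul_le_mul_of_nonneg_left hdig' hlogp.le
  linarith

lemma legendreDefect_le_fract {p : ℕ} (hp : p.Prime) (n : ℕ) :
    legendreDefect n p ≤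
      Real.log p * Int.fract ((n : ℝ) / p) + n * (Real.log p / (p * ((p : ℝ) - 1))) := by
  have := Fact.mk hp
  have h1 : (1 : ℝ) < p := by exact_mod_cast hp.one_lt
  have hle : n / p ≤ n.factorial.factorization p := by
    rw [Nat.factorization_def _ hp]
    calc n / p ≤ padicValNat p (p * (n / p)).factorial := by
          rw [padicValNat_factorial_mul]
          exact Nat.le_add_left _ _
      _ ≤ _ := padicValNat_dvd_iff_le (Nat.factorial_ne_zero n) |>.1
          (pow_padicValNat_dvd.trans (Nat.factorial_dvd_factorial (Nat.mul_div_le n p)))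
  have hfr : Int.fract ((n : ℝ) / p) = (n : ℝ) / p - (n / p : ℕ) := by
    rw [Int.fract, ← natCast_floor_eq_intCast_floor (by positivity), Nat.floor_div_natCast,
      Nat.floor_natCast]
  have hle' : ((n / p : ℕ) : ℝ) ≤ n.factorial.factorization p := by exact_mod_cast hle
  have hid : (n : ℝ) / ((p : ℝ) - 1) = n / p + n * (1 / (p * ((p : ℝ) - 1))) := by
    have : (p : ℝ) - 1 ≠ 0 := by linarith
    field_simp
    ring
  have hlogp := Real.log_pos h1
  unfold legendreDefect
  rw [hfr, hid]
  have := mul_le_mul_of_nonneg_left hle' hlogp.le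
  have e : (n : ℝ) * (Real.log p / (p * ((p : ℝ) - 1)))
    = Real.log p * (n * (1 / (p * ((p : ℝ) - 1)))) := by ring
  rw [e]
  linarith

lemma sum_log_div_mul_sub_one_le {y m : ℕ} (hy : 1 ≤ y) (h : y ≤ m) :
    ∑ p ∈ Finset.Ioc y m, Real.log p / (p * ((p : ℝ) - 1)) ≤ (Real.log y + 2) / y := by
  suffices H : ∑ p ∈ Finset.Ioc y m, Real.log p / (p * ((p : ℝ) - 1))
      ≤ (Real.log y + 2) / y - (Real.log m + 2) / m by
    have : 0 ≤ (Real.log m + 2) / m := by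
      have := Real.log_natCast_nonneg m
      positivity
    linarith
  induction m, h using Nat.le_induction with
  | base => simp
  | succ n hn ih =>
    rw [Finset.sum_Ioc_succ_top (by omega)]
    have h0 : (0 : ℝ) < n := by exact_mod_cast (by omega : 0 < n)
    have h2 : Real.log (n + 1 : ℕ) - Real.log n ≤ 1 / n := by
      rw [← Real.log_div (by positivity) h0.ne']
      refine (Real.log_le_sub_one_of_pos (by positivity)).trans (le_of_eq ?_)
      push_cast
      field_simp
      ring
    have h1n : (1 : ℝ) ≤ n := by exact_mod_cast (by omega : 1 ≤ n)
    have h3 : ((n : ℝ) + 1) * (Real.log (n + 1 : ℕ) - Real.log n) ≤ 2 := by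
      calc _ ≤ ((n : ℝ) + 1) * (1 / n) := by gcongr
        _ ≤ 2 := by
          rw [mul_one_div, div_le_iff₀ h0]
          linarith
    have key : Real.log (n + 1 : ℕ) / ((n + 1 : ℕ) * (((n + 1 : ℕ) : ℝ) - 1))
        ≤ (Real.log n + 2) / n - (Real.log (n + 1 : ℕ) + 2) / (n + 1 : ℕ) := by
      push_cast at h3 ⊢
      rw [div_sub_div _ _ h0.ne' (by positivity), add_sub_cancel_right, mul_comm (n : ℝ) ((n : ℝ) + 1)]
      gcongr
      linarith
    linarith


lemma fract_le_sum_div {K : ℕ} (hK : 0 < K) {z : ℝ} (hz : 1 ≤ z) :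
    Int.fract z ≤ ∑ j ∈ Finset.range K, (if 1 + (j : ℝ) / K ≤ z then 1 / (K : ℝ) else 0) := by
  have hK' : (0 : ℝ) < K := by exact_mod_cast hK
  have hf : 0 ≤ K * Int.fract z := mul_nonneg hK'.le (Int.fract_nonneg z)
  have hlt : ⌊K * Int.fract z⌋₊ < K := by
    rw [Nat.floor_lt hf]
    nlinarith [Int.fract_lt_one z]
  have hz1 : 1 + Int.fract z ≤ z := by
    have : (1 : ℤ) ≤ ⌊z⌋ := Int.le_floor.2 (by simpa using hz)
    have h2 : (1 : ℝ) ≤ (⌊z⌋ : ℝ) := by exact_mod_cast this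
    linarith [Int.floor_add_fract z]
  calc Int.fract z ≤ ∑ j ∈ Finset.range (⌊K * Int.fract z⌋₊ + 1), 1 / (K : ℝ) := by
        rw [Finset.sum_const, Finset.card_range, nsmul_eq_mul, mul_one_div, le_div_iff₀ hK',
          mul_comm]
        exact_mod_cast (Nat.lt_floor_add_one _).le
    _ = ∑ j ∈ Finset.range (⌊K * Int.fract z⌋₊ + 1),
          (if 1 + (j : ℝ) / K ≤ z then 1 / (K : ℝ) else 0) := by
        refine Finset.sum_congr rfl fun j hj => ?_
        rw [if_pos]
        have : (j : ℝ) ≤ K * Int.fract z :=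
          (Nat.le_floor_iff hf).1 (Nat.lt_succ_iff.1 (Finset.mem_range.1 hj))
        have h3 : (j : ℝ) / K ≤ Int.fract z := by
          rw [div_le_iff₀ hK']
          linarith
        linarith
    _ ≤ _ := by
        refine Finset.sum_le_sum_of_subset_of_nonneg (Finset.range_subset_range.2 hlt)
          fun j _ _ => ?_
        split_ifs <;> positivity

lemma sum_log_mul_fract_le {K : ℕ} (hK : 0 < K) (y : ℕ) :
    ∑ p ∈ (Finset.Ioc 0 y).filter Nat.Prime, Real.log p * Int.fract ((y : ℝ) / p)
      ≤ Real.log 4 * (∑ j ∈ Finset.range K, 1 / ((K : ℝ) + j)) * y := by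
  have hK' : (0 : ℝ) < K := by exact_mod_cast hK
  calc _ ≤ ∑ p ∈ (Finset.Ioc 0 y).filter Nat.Prime, ∑ j ∈ Finset.range K,
        (if 1 + (j : ℝ) / K ≤ (y : ℝ) / p then Real.log p * (1 / K) else 0) := by
        refine Finset.sum_le_sum fun p hp => ?_
        rw [Finset.mem_filter, Finset.mem_Ioc] at hp
        have hp0 : (0 : ℝ) < p := by exact_mod_cast hp.1.1
        have hz : (1 : ℝ) ≤ (y : ℝ) / p := by
          rw [le_div_iff₀ hp0, one_mul]
          exact_mod_cast hp.1.2
        refine (mul_le_mul_of_nonneg_left (fract_le_sum_div hK hz)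
          (Real.log_natCast_nonneg p)).trans (le_of_eq ?_)
        simp only [Finset.mul_sum, mul_ite, mul_zero]
    _ = ∑ j ∈ Finset.range K, ∑ p ∈ (Finset.Ioc 0 y).filter Nat.Prime,
        (if 1 + (j : ℝ) / K ≤ (y : ℝ) / p then Real.log p * (1 / K) else 0) :=
        Finset.sum_comm
    _ ≤ ∑ j ∈ Finset.range K, Chebyshev.theta (y / (1 + (j : ℝ) / K)) * (1 / K) := by
        refine Finset.sum_le_sum fun j _ => ?_
        rw [← Finset.sum_filter, Chebyshev.theta, Finset.sum_mul]
        refine Finset.sum_le_sum_of_subset_of_nonneg (fun p hp => ?_) fun p _ _ =>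
          mul_nonneg (Real.log_natCast_nonneg p) (by positivity)
        simp only [Finset.mem_filter, Finset.mem_Ioc] at hp ⊢
        obtain ⟨⟨⟨hp0, hpy⟩, hpp⟩, hle⟩ := hp
        have hp0' : (0 : ℝ) < p := by exact_mod_cast hp0
        refine ⟨⟨hp0, Nat.le_floor ?_⟩, hpp⟩
        rw [le_div_iff₀ hp0'] at hle
        rw [le_div_iff₀ (by positivity), mul_comm]
        exact hle
    _ ≤ ∑ j ∈ Finset.range K, Real.log 4 * (y / (1 + (j : ℝ) / K)) * (1 / K) := by
        refine Finset.sum_le_sum fun j _ => mul_le_mul_of_nonneg_right ?_ (by positivity)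
        exact Chebyshev.theta_le_log4_mul_x (by positivity)
    _ = _ := by
        rw [Finset.mul_sum, Finset.sum_mul]
        refine Finset.sum_congr rfl fun j _ => ?_
        field_simp

lemma sum_legendreDefect_le {K r y : ℕ} (hK : 0 < K) (hr : 1 ≤ r) (hry : r ≤ y) :
    ∑ p ∈ (Finset.Ioc 0 y).filter Nat.Prime, legendreDefect y p
      ≤ Real.log 4 * (∑ j ∈ Finset.range K, 1 / ((K : ℝ) + j)) * y
        + y * ((Real.log r + 2) / r) + r * (Real.log y + Real.log r) := by
  have hsplit : ∑ p ∈ (Finset.Ioc 0 y).filter Nat.Prime, legendreDefect y p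
      = ∑ p ∈ (Finset.Ioc 0 r).filter Nat.Prime, legendreDefect y p
        + ∑ p ∈ (Finset.Ioc r y).filter Nat.Prime, legendreDefect y p := by
    simp only [Finset.sum_filter]
    rw [← Finset.sum_Ioc_consecutive _ (Nat.zero_le r) hry]
  have hsmall : ∑ p ∈ (Finset.Ioc 0 r).filter Nat.Prime, legendreDefect y p
      ≤ r * (Real.log y + Real.log r) := by
    have hnn : 0 ≤ Real.log y + Real.log r :=
      add_nonneg (Real.log_natCast_nonneg y) (Real.log_natCast_nonneg r)
    calc _ ≤ ∑ p ∈ (Finset.Ioc 0 r).filter Nat.Prime, (Real.log y + Real.log r) := by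
          refine Finset.sum_le_sum fun p hp => ?_
          rw [Finset.mem_filter, Finset.mem_Ioc] at hp
          refine (legendreDefect_le_log_add_log hp.2 (by omega)).trans ?_
          gcongr
          · exact_mod_cast hp.1.1
          · exact hp.1.2
      _ ≤ _ := by
          rw [Finset.sum_const, nsmul_eq_mul]
          refine mul_le_mul_of_nonneg_right ?_ hnn
          exact_mod_cast (Finset.card_filter_le _ _).trans (by simp)
  have hlarge : ∑ p ∈ (Finset.Ioc r y).filter Nat.Prime, legendreDefect y p
      ≤ Real.log 4 * (∑ j ∈ Finset.range K, 1 / ((K : ℝ) + j)) * y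
        + y * ((Real.log r + 2) / r) := by
    calc _ ≤ ∑ p ∈ (Finset.Ioc r y).filter Nat.Prime,
          (Real.log p * Int.fract ((y : ℝ) / p) + y * (Real.log p / (p * ((p : ℝ) - 1)))) :=
          Finset.sum_le_sum fun p hp => legendreDefect_le_fract (Finset.mem_filter.1 hp).2 y
      _ ≤ _ := by
          rw [Finset.sum_add_distrib, ← Finset.mul_sum]
          refine add_le_add (le_trans ?_ (sum_log_mul_fract_le hK y))
            (mul_le_mul_of_nonneg_left (le_trans ?_ (sum_log_div_mul_sub_one_le hr hry))
              (Nat.cast_nonneg y))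
          · refine Finset.sum_le_sum_of_subset_of_nonneg
              (Finset.filter_subset_filter _ (Finset.Ioc_subset_Ioc_left (Nat.zero_le r)))
              fun p _ _ => mul_nonneg (Real.log_natCast_nonneg p) (Int.fract_nonneg _)
          · refine Finset.sum_le_sum_of_subset_of_nonneg (Finset.filter_subset _ _)
              fun p hp _ => div_nonneg (Real.log_natCast_nonneg p) ?_
            have : (1 : ℝ) ≤ p := by
              rw [Finset.mem_Ioc] at hp
              exact_mod_cast (by omega : 1 ≤ p)
            exact mul_nonneg (by linarith) (by linarith)
  linarith

lemma mul_sum_log_div_sub_one_eq (n : ℕ) :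
    n * ∑ p ∈ (Finset.Ioc 0 n).filter Nat.Prime, Real.log p / ((p : ℝ) - 1)
      = Real.log n.factorial + ∑ p ∈ (Finset.Ioc 0 n).filter Nat.Prime, legendreDefect n p := by
  have hset : (n + 1).primesBelow = (Finset.Ioc 0 n).filter Nat.Prime := by
    ext p
    simp only [Nat.mem_primesBelow, Finset.mem_filter, Finset.mem_Ioc]
    exact ⟨fun h => ⟨⟨h.2.pos, by omega⟩, h.2⟩, fun h => ⟨by omega, h.2⟩⟩
  rw [log_factorial_eq_sum, hset, ← Finset.sum_add_distrib, Finset.mul_sum]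
  refine Finset.sum_congr rfl fun p _ => ?_
  unfold legendreDefect
  ring

lemma log_add_one_sub_one_le_sum {m : ℕ} (hm : 1 ≤ m) :
    Real.log (m + 1 : ℕ) - 1
      ≤ ∑ p ∈ (Finset.Ioc 0 m).filter Nat.Prime, Real.log p / ((p : ℝ) - 1) := by
  have h0 : (0 : ℝ) < m := by exact_mod_cast hm
  refine le_of_mul_le_mul_left ?_ h0
  rw [mul_sum_log_div_sub_one_eq]
  have h1 : 0 ≤ ∑ p ∈ (Finset.Ioc 0 m).filter Nat.Prime, legendreDefect m p :=
    Finset.sum_nonneg fun p hp => legendreDefect_nonneg (Finset.mem_filter.1 hp).2 m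
  linarith [mul_log_add_one_sub_le_log_factorial m]

lemma sum_log_div_sub_one_le {K r y : ℕ} (hK : 0 < K) (hr : 1 ≤ r) (hry : r ≤ y) :
    ∑ p ∈ (Finset.Ioc 0 y).filter Nat.Prime, Real.log p / ((p : ℝ) - 1)
      ≤ Real.log y - 1 + (Real.log y + 1) / y
        + Real.log 4 * (∑ j ∈ Finset.range K, 1 / ((K : ℝ) + j))
        + (Real.log r + 2) / r + r * (Real.log y + Real.log r) / y := by
  have h0 : (0 : ℝ) < y := by exact_mod_cast (by omega : 0 < y)
  refine le_of_mul_le_mul_left ?_ h0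
  rw [mul_sum_log_div_sub_one_eq]
  have h1 := sum_legendreDefect_le hK hr hry
  have h2 := log_factorial_le (hr.trans hry)
  have e : (y : ℝ) * (Real.log y - 1 + (Real.log y + 1) / y
        + Real.log 4 * (∑ j ∈ Finset.range K, 1 / ((K : ℝ) + j))
        + (Real.log r + 2) / r + r * (Real.log y + Real.log r) / y)
      = (y * Real.log y - y + Real.log y + 1)
        + (Real.log 4 * (∑ j ∈ Finset.range K, 1 / ((K : ℝ) + j)) * y
          + y * ((Real.log r + 2) / r) + r * (Real.log y + Real.log r)) := by
    field_simp
    ring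
  rw [e]
  linarith

lemma nineteen_twelfths_mul_log_two_le : 19 / 12 * Real.log 2 ≤ Real.log 3 := by
  have h : Real.log ((2 : ℝ) ^ 19) ≤ Real.log ((3 : ℝ) ^ 12) :=
    Real.log_le_log (by norm_num) (by norm_num)
  rw [Real.log_pow, Real.log_pow] at h
  push_cast at h
  linarith

lemma log_four_mul_sum_add_le_log_three {r : ℕ} (hr : 209 ≤ r) :
    Real.log 4 * (∑ j ∈ Finset.range 20, 1 / (((20 : ℕ) : ℝ) + j))
        + (4 * Real.log (r + 1 : ℕ) + 2) / r + (4 * Real.log (r + 1 : ℕ) + 3) / (r * r)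
      ≤ Real.log 3 := by
  have hr' : (209 : ℝ) ≤ r := by exact_mod_cast hr
  have h4 : Real.log 4 = 2 * Real.log 2 := by
    rw [show (4 : ℝ) = 2 ^ 2 by norm_num, Real.log_pow]
    norm_num
  have hS : ∑ j ∈ Finset.range 20, 1 / (((20 : ℕ) : ℝ) + j) ≤ 0.70581 := by
    simp only [Finset.sum_range_succ, Finset.sum_range_zero]
    norm_num
  have hL : Real.log (r + 1 : ℕ) ≤ 8 * Real.log 2 + ((r : ℝ) + 1) / 256 - 1 := by
    have h1 := Real.log_le_sub_one_of_pos (show (0 : ℝ) < ((r : ℝ) + 1) / 2 ^ 8 by positivity)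
    rw [Real.log_div (by positivity) (by positivity), Real.log_pow] at h1
    push_cast at h1 ⊢
    linarith
  have h2 := Real.log_two_gt_d9
  have h2' := Real.log_two_lt_d9
  have h3 := nineteen_twelfths_mul_log_two_le
  have hL' : Real.log (r + 1 : ℕ) ≤ 4.5492 + (r : ℝ) / 256 := by linarith
  have hA : (4 * Real.log (r + 1 : ℕ) + 2) / r ≤ 0.1125 := by
    rw [div_le_iff₀ (by linarith)]
    linarith
  have hB : (4 * Real.log (r + 1 : ℕ) + 3) / (r * r) ≤ 0.001 := by
    rw [div_le_iff₀ (by nlinarith)]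
    nlinarith
  have hC : Real.log 4 * (∑ j ∈ Finset.range 20, 1 / (((20 : ℕ) : ℝ) + j))
      ≤ Real.log 4 * 0.70581 :=
    mul_le_mul_of_nonneg_left hS (by rw [h4]; linarith)
  linarith

lemma log_sub_log_three_mul_le_sum {x n : ℕ} (hx : 43691 ≤ x) (hn : x < n) :
    Real.log n - Real.log (3 * x)
      ≤ ∑ p ∈ Finset.range n, (if p.Prime ∧ x ≤ p then Real.log p / p else 0) := by
  obtain ⟨y, rfl⟩ : ∃ y, x = y + 1 := ⟨x - 1, by omega⟩
  obtain ⟨m, rfl⟩ : ∃ m, n = m + 1 := ⟨n - 1, by omega⟩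
  have hym : y ≤ m := by omega
  set r := Nat.sqrt y with hrdef
  have hr : 209 ≤ r := Nat.le_sqrt.2 (by omega)
  have hry : r * r ≤ y := Nat.sqrt_le y
  have hry' : y < (r + 1) * (r + 1) := Nat.lt_succ_sqrt y
  have hy0 : (0 : ℝ) < y := by exact_mod_cast (by omega : 0 < y)
  have hr0 : (0 : ℝ) < r := by exact_mod_cast (by omega : 0 < r)
  have hsum : ∑ p ∈ Finset.range (m + 1),
        (if p.Prime ∧ y + 1 ≤ p then Real.log p / p else 0)
      = ∑ p ∈ (Finset.Ioc 0 m).filter Nat.Prime, Real.log p / ((p : ℝ) - 1)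
        - ∑ p ∈ (Finset.Ioc 0 y).filter Nat.Prime, Real.log p / ((p : ℝ) - 1)
        - ∑ p ∈ (Finset.Ioc y m).filter Nat.Prime, Real.log p / (p * ((p : ℝ) - 1)) := by
    have h1 : ∑ p ∈ (Finset.Ioc 0 m).filter Nat.Prime, Real.log p / ((p : ℝ) - 1)
        = ∑ p ∈ (Finset.Ioc 0 y).filter Nat.Prime, Real.log p / ((p : ℝ) - 1)
          + ∑ p ∈ (Finset.Ioc y m).filter Nat.Prime, Real.log p / ((p : ℝ) - 1) := by
      simp only [Finset.sum_filter]
      rw [← Finset.sum_Ioc_consecutive _ (Nat.zero_le y) hym]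
    rw [h1, add_sub_cancel_left, ← Finset.sum_sub_distrib, ← Finset.sum_filter]
    have hset : (Finset.range (m + 1)).filter (fun p => p.Prime ∧ y + 1 ≤ p)
        = (Finset.Ioc y m).filter Nat.Prime := by
      ext p
      simp only [Finset.mem_filter, Finset.mem_range, Finset.mem_Ioc]
      constructor <;> rintro ⟨h1, h2⟩ <;> simp_all
    rw [hset]
    refine Finset.sum_congr rfl fun p hp => ?_
    have hp1 : (1 : ℝ) < p := by exact_mod_cast (Finset.mem_filter.1 hp).2.one_lt
    have : (p : ℝ) - 1 ≠ 0 := by linarith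
    have : (p : ℝ) ≠ 0 := by linarith
    field_simp
  have hU := log_add_one_sub_one_le_sum (m := m) (by omega)
  have hV := sum_log_div_sub_one_le (K := 20) (r := r) (y := y) (by norm_num) (by omega)
    (Nat.sqrt_le_self y)
  have hT : ∑ p ∈ (Finset.Ioc y m).filter Nat.Prime, Real.log p / (p * ((p : ℝ) - 1))
      ≤ (Real.log y + 2) / y := by
    refine le_trans (Finset.sum_le_sum_of_subset_of_nonneg (Finset.filter_subset _ _)
      fun p hp _ => div_nonneg (Real.log_natCast_nonneg p) ?_)
      (sum_log_div_mul_sub_one_le (by omega) hym)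
    have : (1 : ℝ) ≤ p := by
      rw [Finset.mem_Ioc] at hp
      exact_mod_cast (by omega : 1 ≤ p)
    exact mul_nonneg (by linarith) (by linarith)
  have hnum := log_four_mul_sum_add_le_log_three hr
  have hlogy : Real.log y ≤ 2 * Real.log (r + 1 : ℕ) := by
    rw [show (2 : ℝ) * Real.log (r + 1 : ℕ) = Real.log (((r + 1 : ℕ) : ℝ) * ((r + 1 : ℕ) : ℝ)) by
      rw [Real.log_mul (by positivity) (by positivity)]; ring]
    exact Real.log_le_log hy0 (by exact_mod_cast hry'.le)
  have hlogr : Real.log r ≤ Real.log (r + 1 : ℕ) :=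
    Real.log_le_log hr0 (by exact_mod_cast Nat.le_succ r)
  have hL0 : 0 ≤ Real.log (r + 1 : ℕ) := Real.log_natCast_nonneg _
  have hyr : (r : ℝ) * r ≤ y := by exact_mod_cast hry
  have hB1 : r * (Real.log y + Real.log r) / y ≤ 3 * Real.log (r + 1 : ℕ) / r := by
    rw [div_le_div_iff₀ hy0 hr0]
    calc r * (Real.log y + Real.log r) * r ≤ r * (3 * Real.log (r + 1 : ℕ)) * r := by
          gcongr
          linarith
      _ = 3 * Real.log (r + 1 : ℕ) * (r * r) := by ring
      _ ≤ _ := by gcongr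
  have hB2 : (Real.log y + 1) / y + (Real.log y + 2) / y
      ≤ (4 * Real.log (r + 1 : ℕ) + 3) / (r * r) := by
    rw [← add_div]
    exact div_le_div₀ (by linarith) (by linarith) (by positivity) hyr
  have hB3 : (Real.log r + 2) / r + 3 * Real.log (r + 1 : ℕ) / r
      ≤ (4 * Real.log (r + 1 : ℕ) + 2) / r := by
    rw [← add_div]
    exact div_le_div_of_nonneg_right (by linarith) hr0.le
  have hlogx : Real.log 3 + Real.log y ≤ Real.log (3 * ((y + 1 : ℕ) : ℝ)) := by
    rw [← Real.log_mul (by norm_num) hy0.ne']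
    refine Real.log_le_log (by positivity) ?_
    push_cast
    linarith
  rw [hsum]
  linarith

lemma one_le_exp_mul_mertensProd_mul_log_of_large {x : ℕ} (hx : 43691 ≤ x) :
    1 ≤ Real.exp Real.eulerMascheroniConstant * mertensProd x * Real.log (3 * x) := by
  have hx' : (43691 : ℝ) ≤ x := by exact_mod_cast hx
  refine one_le_exp_eulerMascheroni_mul_mertensProd_mul_log (by linarith)
    (log_log_sub_le_sum_of_log_sub_le (by linarith) fun n hn => ?_)
  refine log_sub_log_three_mul_le_sum hx ?_
  have : (x : ℝ) < n := by linarith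
  exact_mod_cast this

/-- The product of `a + i - k` over the `i < n * 2 ^ d` for which `a + i` is coprime to `Q`,
computed by binary splitting. -/
def coprimeProd (Q k n : ℕ) : ℕ → ℕ → ℕ
  | 0, a => Nat.rec 1 (fun i r => r * (if Nat.gcd (a + i) Q = 1 then a + i - k else 1)) n
  | d + 1, a => coprimeProd Q k n d a * coprimeProd Q k n d (a + n * 2 ^ d)

lemma coprimeProd_eq_prod (Q k n d a : ℕ) :
    coprimeProd Q k n d a
      = ∏ i ∈ Finset.range (n * 2 ^ d), (if Nat.gcd (a + i) Q = 1 then a + i - k else 1) := by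
  induction d generalizing a with
  | zero =>
    simp only [coprimeProd, pow_zero, mul_one]
    induction n with
    | zero => simp
    | succ n ih => rw [Finset.prod_range_succ, ← ih]
  | succ d ih =>
    rw [coprimeProd, ih, ih, pow_succ, mul_two, mul_add, Finset.prod_range_add]
    simp only [add_assoc]

lemma mertensProd_mul_prod_le {Q a : ℕ} (ha : 2 ≤ a)
    (hQ : ∀ p : ℕ, p.Prime → a ≤ p → Nat.gcd p Q = 1) (n : ℕ) :
    mertensProd a
        * ((∏ i ∈ Finset.range n, (if Nat.gcd (a + i) Q = 1 then a + i - 1 else 1) : ℕ) : ℝ)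
      ≤ mertensProd (a + n)
        * ((∏ i ∈ Finset.range n, (if Nat.gcd (a + i) Q = 1 then a + i - 0 else 1) : ℕ) : ℝ) := by
  induction n with
  | zero => simp
  | succ n ih =>
    rw [Finset.prod_range_succ, Finset.prod_range_succ, Nat.cast_mul, Nat.cast_mul, ← mul_assoc,
      ← add_assoc]
    set u := ((∏ i ∈ Finset.range n,
      (if Nat.gcd (a + i) Q = 1 then a + i - 1 else 1) : ℕ) : ℝ)
    set v := ((∏ i ∈ Finset.range n,
      (if Nat.gcd (a + i) Q = 1 then a + i - 0 else 1) : ℕ) : ℝ)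
    have hv : 0 ≤ v := Nat.cast_nonneg _
    have hM := (mertensProd_pos (a + n)).le
    have h0 : (0 : ℝ) < (a + n : ℕ) := by exact_mod_cast (by omega : 0 < a + n)
    by_cases hp : (a + n).Prime
    · rw [if_pos (hQ _ hp (by omega)), if_pos (hQ _ hp (by omega)), mertensProd_succ_of_prime hp,
        Nat.cast_sub (by omega), Nat.sub_zero, Nat.cast_one]
      have h1 : (0 : ℝ) ≤ (a + n : ℕ) - 1 := by
        have : (1 : ℝ) ≤ (a + n : ℕ) := by exact_mod_cast (by omega : 1 ≤ a + n)
        linarith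
      refine (mul_le_mul_of_nonneg_right ih h1).trans (le_of_eq ?_)
      field_simp
    · rw [mertensProd_succ_of_not_prime hp, ← mul_assoc]
      refine mul_le_mul ih ?_ (Nat.cast_nonneg _) (mul_nonneg hM hv)
      split_ifs
      · exact_mod_cast Nat.sub_le_sub_left (Nat.zero_le 1) _
      · exact le_rfl

lemma le_mertensProd_of_mul_coprimeProd_le {Q n d a b c c' : ℕ} (ha : 2 ≤ a)
    (hQ : ∀ p : ℕ, p.Prime → a ≤ p → Nat.gcd p Q = 1) (hb : a + n * 2 ^ d = b)
    (h : (c : ℝ) / 10 ^ 8 ≤ mertensProd a)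
    (hc : c' * coprimeProd Q 0 n d a ≤ c * coprimeProd Q 1 n d a) :
    (c' : ℝ) / 10 ^ 8 ≤ mertensProd b := by
  subst hb
  have h1 := mertensProd_mul_prod_le ha hQ (n * 2 ^ d)
  rw [← coprimeProd_eq_prod, ← coprimeProd_eq_prod] at h1
  have hpos : (0 : ℝ) < coprimeProd Q 0 n d a := by
    rw [coprimeProd_eq_prod]
    refine Nat.cast_pos.2 (Finset.prod_pos fun i _ => ?_)
    split_ifs <;> omega
  have hc' : (c' : ℝ) * coprimeProd Q 0 n d a ≤ c * coprimeProd Q 1 n d a := by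
    exact_mod_cast hc
  refine le_of_mul_le_mul_right ?_ hpos
  calc _ ≤ (c : ℝ) / 10 ^ 8 * coprimeProd Q 1 n d a := by linarith
    _ ≤ mertensProd a * coprimeProd Q 1 n d a :=
        mul_le_mul_of_nonneg_right h (Nat.cast_nonneg _)
    _ ≤ _ := h1

lemma gcd_eq_one_of_dvd_factorial {Q m p : ℕ} (hQ : Q ∣ m.factorial) (hp : p.Prime)
    (hmp : m < p) : Nat.gcd p Q = 1 := by
  refine (Nat.Prime.coprime_iff_not_dvd hp).2 fun h => ?_
  exact absurd (hp.dvd_factorial.1 (h.trans hQ)) (by omega)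

/-- The product of the primes up to `211`. -/
abbrev primorialTwoHundredEleven : ℕ :=
  1645783550795210387735581011435590727981167322669649249414629852197255934130751870910

lemma gcd_primorialTwoHundredEleven {a : ℕ} (ha : 211 < a) (p : ℕ) (hp : p.Prime) (hap : a ≤ p) :
    Nat.gcd p primorialTwoHundredEleven = 1 :=
  gcd_eq_one_of_dvd_factorial (m := 211) (by decide +kernel) hp (by omega)

lemma gcd_9699690 {a : ℕ} (ha : 19 < a) (p : ℕ) (hp : p.Prime) (hap : a ≤ p) :
    Nat.gcd p 9699690 = 1 :=
  gcd_eq_one_of_dvd_factorial (m := 19) (by decide +kernel) hp (by omega)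

lemma gcd_210 {a : ℕ} (ha : 7 < a) (p : ℕ) (hp : p.Prime) (hap : a ≤ p) : Nat.gcd p 210 = 1 :=
  gcd_eq_one_of_dvd_factorial (m := 7) (by decide +kernel) hp (by omega)

lemma exists_le_mertensProd {j : ℕ} (hj : j ≤ 12) :
    ∃ c : ℕ, 82400000 ≤ c * (j + 4) ∧ (c : ℝ) / 10 ^ 8 ≤ mertensProd (11 * 2 ^ j) := by
  have h0 : ((22857142 : ℕ) : ℝ) / 10 ^ 8 ≤ mertensProd 11 := by
    have : (11 : ℕ).primesBelow = {2, 3, 5, 7} := by decide +kernel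
    rw [mertensProd, this]
    norm_num
  have h1 : ((17102401 : ℕ) : ℝ) / 10 ^ 8 ≤ mertensProd 22 :=
    le_mertensProd_of_mul_coprimeProd_le (d := 0) (n := 11) (by norm_num)
      (gcd_210 (by norm_num)) (by norm_num) h0 (by decide +kernel)
  have h2 : ((14171938 : ℕ) : ℝ) / 10 ^ 8 ≤ mertensProd 44 :=
    le_mertensProd_of_mul_coprimeProd_le (d := 1) (n := 11) (by norm_num)
      (gcd_210 (by norm_num)) (by norm_num) h1 (by decide +kernel)
  have h3 : ((12295206 : ℕ) : ℝ) / 10 ^ 8 ≤ mertensProd 88 :=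
    le_mertensProd_of_mul_coprimeProd_le (d := 2) (n := 11) (by norm_num)
      (gcd_210 (by norm_num)) (by norm_num) h2 (by decide +kernel)
  have h4 : ((10724228 : ℕ) : ℝ) / 10 ^ 8 ≤ mertensProd 176 :=
    le_mertensProd_of_mul_coprimeProd_le (d := 3) (n := 11) (by norm_num)
      (gcd_9699690 (by norm_num)) (by norm_num) h3 (by decide +kernel)
  have h5 : ((9509070 : ℕ) : ℝ) / 10 ^ 8 ≤ mertensProd 352 :=
    le_mertensProd_of_mul_coprimeProd_le (d := 4) (n := 11) (by norm_num)
      (gcd_9699690 (by norm_num)) (by norm_num) h4 (by decide +kernel)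
  have h6 : ((8509767 : ℕ) : ℝ) / 10 ^ 8 ≤ mertensProd 704 :=
    le_mertensProd_of_mul_coprimeProd_le (d := 5) (n := 11) (by norm_num)
      (gcd_primorialTwoHundredEleven (by norm_num)) (by norm_num) h5 (by decide +kernel)
  have h7 : ((7733310 : ℕ) : ℝ) / 10 ^ 8 ≤ mertensProd 1408 :=
    le_mertensProd_of_mul_coprimeProd_le (d := 6) (n := 11) (by norm_num)
      (gcd_primorialTwoHundredEleven (by norm_num)) (by norm_num) h6 (by decide +kernel)
  have h8 : ((7047387 : ℕ) : ℝ) / 10 ^ 8 ≤ mertensProd 2816 :=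
    le_mertensProd_of_mul_coprimeProd_le (d := 7) (n := 11) (by norm_num)
      (gcd_primorialTwoHundredEleven (by norm_num)) (by norm_num) h7 (by decide +kernel)
  have h9 : ((6495266 : ℕ) : ℝ) / 10 ^ 8 ≤ mertensProd 5632 :=
    le_mertensProd_of_mul_coprimeProd_le (d := 8) (n := 11) (by norm_num)
      (gcd_primorialTwoHundredEleven (by norm_num)) (by norm_num) h8 (by decide +kernel)
  have h10 : ((6012622 : ℕ) : ℝ) / 10 ^ 8 ≤ mertensProd 11264 :=
    le_mertensProd_of_mul_coprimeProd_le (d := 9) (n := 11) (by norm_num)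
      (gcd_primorialTwoHundredEleven (by norm_num)) (by norm_num) h9 (by decide +kernel)
  have h11 : ((5598563 : ℕ) : ℝ) / 10 ^ 8 ≤ mertensProd 22528 :=
    le_mertensProd_of_mul_coprimeProd_le (d := 10) (n := 11) (by norm_num)
      (gcd_primorialTwoHundredEleven (by norm_num)) (by norm_num) h10 (by decide +kernel)
  have h12 : ((5237136 : ℕ) : ℝ) / 10 ^ 8 ≤ mertensProd 45056 :=
    le_mertensProd_of_mul_coprimeProd_le (d := 11) (n := 11) (by norm_num)
      (gcd_primorialTwoHundredEleven (by norm_num)) (by norm_num) h11 (by decide +kernel)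
  interval_cases j
  exacts [⟨_, by norm_num, h0⟩, ⟨_, by norm_num, h1⟩, ⟨_, by norm_num, h2⟩,
    ⟨_, by norm_num, h3⟩, ⟨_, by norm_num, h4⟩, ⟨_, by norm_num, h5⟩, ⟨_, by norm_num, h6⟩,
    ⟨_, by norm_num, h7⟩, ⟨_, by norm_num, h8⟩, ⟨_, by norm_num, h9⟩, ⟨_, by norm_num, h10⟩,
    ⟨_, by norm_num, h11⟩, ⟨_, by norm_num, h12⟩]

lemma exp_eulerMascheroniConstant_gt : 1.752 < Real.exp Real.eulerMascheroniConstant := by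
  have h1 := Real.eulerMascheroniSeq_lt_eulerMascheroniConstant 31
  have h2 : Real.eulerMascheroniSeq 31 = (harmonic 31 : ℝ) - 5 * Real.log 2 := by
    rw [Real.eulerMascheroniSeq, show (((31 : ℕ) : ℝ) + 1) = 2 ^ 5 by norm_num, Real.log_pow]
    norm_num
  have h3 : (4.0272 : ℚ) ≤ harmonic 31 := by
    rw [harmonic]
    simp only [Finset.sum_range_succ, Finset.sum_range_zero]
    norm_num
  have h3' : (4.0272 : ℝ) ≤ (harmonic 31 : ℝ) := by
    have := (Rat.cast_le (K := ℝ)).2 h3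
    norm_num at this ⊢
  have h4 := Real.log_two_lt_d9
  have h5 : (0.5614 : ℝ) ≤ Real.eulerMascheroniConstant := by linarith
  have h6 := Real.sum_le_exp_of_nonneg (show (0 : ℝ) ≤ 0.5614 by norm_num) 6
  have h7 := Real.exp_le_exp.2 h5
  refine lt_of_lt_of_le ?_ (h6.trans h7)
  simp only [Finset.sum_range_succ, Finset.sum_range_zero]
  norm_num [Nat.factorial]

lemma one_le_exp_mul_mertensProd_mul_log {x : ℕ} (hx3 : 3 ≤ x) :
    1 ≤ Real.exp Real.eulerMascheroniConstant * mertensProd x * Real.log (3 * x) := by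
  have hexp := exp_eulerMascheroniConstant_gt
  have hlog2 := Real.log_two_gt_d9
  have aux : ∀ {c l : ℝ}, c ≤ mertensProd x → 0 ≤ c → l ≤ Real.log (3 * x) → 0 ≤ l →
      1 ≤ 1.752 * (c * l) →
      1 ≤ Real.exp Real.eulerMascheroniConstant * mertensProd x * Real.log (3 * x) := by
    intro c l hc hc0 hl hl0 h
    rw [mul_assoc]
    exact h.trans (mul_le_mul hexp.le (mul_le_mul hc hl hl0 (mertensProd_pos x).le)
      (mul_nonneg hc0 hl0) (Real.exp_pos _).le)
  rcases le_or_gt 43691 x with hlarge | hsmall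
  · exact one_le_exp_mul_mertensProd_mul_log_of_large hlarge
  have hlog : ∀ k : ℕ, 2 ^ k ≤ 3 * x → k * Real.log 2 ≤ Real.log (3 * x) := by
    intro k hk
    rw [← Real.log_pow]
    exact Real.log_le_log (by positivity) (by exact_mod_cast hk)
  rcases le_or_gt x 5 with h5 | h5
  · have hM : (1 / 3 : ℝ) ≤ mertensProd x := by
      refine le_trans (le_of_eq ?_) (mertensProd_antitone h5)
      have : (5 : ℕ).primesBelow = {2, 3} := by decide +kernel
      rw [mertensProd, this]
      norm_num
    exact aux hM (by norm_num) (hlog 3 (by omega)) (by positivity) (by norm_num; linarith)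
  · obtain ⟨j, hj⟩ : ∃ j, Nat.log 2 (3 * x) = j + 4 := by
      have : 4 ≤ Nat.log 2 (3 * x) := Nat.le_log_of_pow_le (by norm_num) (by omega)
      exact ⟨_, (Nat.sub_add_cancel this).symm⟩
    have hlow : 2 ^ (j + 4) ≤ 3 * x := hj ▸ Nat.pow_log_le_self 2 (by omega)
    have hup : 3 * x < 2 ^ (j + 5) := by
      have := Nat.lt_pow_succ_log_self (b := 2) (by norm_num) (3 * x)
      rwa [hj] at this
    have hj12 : j ≤ 12 := by
      by_contra! h
      have : 2 ^ (13 + 4) ≤ 2 ^ (j + 4) := Nat.pow_le_pow_right (by norm_num) (by omega)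
      omega
    obtain ⟨c, hc, hcM⟩ := exists_le_mertensProd hj12
    have hxj : x ≤ 11 * 2 ^ j := by
      rw [pow_add] at hup
      omega
    refine aux (hcM.trans (mertensProd_antitone hxj)) (by positivity) (hlog _ hlow)
      (by positivity) ?_
    have hc' : (82400000 : ℝ) ≤ c * ((j + 4 : ℕ) : ℝ) := by exact_mod_cast hc
    nlinarith

lemma f_le_of_forall_finset {A : Set ℕ} {c : ℝ}
    (h : ∀ F : Finset ℕ, (∀ a ∈ F, a ∈ A) → ∑ a ∈ F, 1 / ((a : ℝ) * Real.log a) ≤ c) :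
    f A ≤ c := by
  refine Real.tsum_le_of_sum_le (fun a => ?_) fun u => ?_
  · exact div_nonneg zero_le_one (mul_nonneg (Nat.cast_nonneg _) (Real.log_natCast_nonneg _))
  · have := h (u.map (Function.Embedding.subtype _)) fun a ha => by
      obtain ⟨b, _, rfl⟩ := Finset.mem_map.1 ha
      exact b.2
    simpa only [Finset.sum_map, Function.Embedding.subtype_apply] using this

lemma mertensProd_two : mertensProd 2 = 1 := by
  have : (2 : ℕ).primesBelow = ∅ := by decide
  rw [mertensProd, this, Finset.prod_empty]

lemma not_isMertens_two : ¬ IsMertens 2 := by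
  intro h
  have h1 : Real.exp Real.eulerMascheroniConstant * mertensProd 2 ≤ 1 / Real.log (2 : ℕ) := h
  have hlog := Real.log_two_gt_d9
  rw [mertensProd_two, mul_one, le_div_iff₀ (by exact_mod_cast Real.log_pos one_lt_two)] at h1
  have h2 := exp_eulerMascheroniConstant_gt
  push_cast at h1
  nlinarith

lemma one_div_mul_log_le_of_prime {p : ℕ} (hp : p.Prime) :
    1 / ((p : ℝ) * Real.log p)
      ≤ 3 * Real.exp Real.eulerMascheroniConstant * (mertensProd p / p) := by
  have hp2 : (2 : ℝ) ≤ p := by exact_mod_cast hp.two_le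
  have hlogp : 0 < Real.log p := Real.log_pos (by linarith)
  have hM := mertensProd_pos p
  have hE := Real.exp_pos Real.eulerMascheroniConstant
  suffices h : 1 ≤ 3 * Real.exp Real.eulerMascheroniConstant * mertensProd p * Real.log p by
    rw [div_le_iff₀ (by positivity)]
    refine h.trans (le_of_eq ?_)
    field_simp
  rcases hp.two_le.eq_or_lt with rfl | h3
  · have hlog := Real.log_two_gt_d9
    have h2 := exp_eulerMascheroniConstant_gt
    rw [mertensProd_two]
    push_cast
    nlinarith
  · have hlog : Real.log (3 * p) ≤ 3 * Real.log p := by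
      have h := Real.log_le_log (show (0 : ℝ) < 3 * p by linarith)
        (show 3 * (p : ℝ) ≤ (p : ℝ) ^ 3 by nlinarith [mul_self_nonneg ((p : ℝ) - 2)])
      rw [Real.log_pow] at h
      exact_mod_cast h
    have hpos : 0 ≤ Real.exp Real.eulerMascheroniConstant * mertensProd p := by positivity
    linarith [one_le_exp_mul_mertensProd_mul_log h3, mul_le_mul_of_nonneg_left hlog hpos]

lemma summable_one_div_prime_mul_log :
    Summable fun p : {p : ℕ // p.Prime} => 1 / (((p : ℕ) : ℝ) * Real.log (p : ℕ)) := by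
  refine summable_of_sum_le (c := 3 * Real.exp Real.eulerMascheroniConstant * mertensProd 0)
    (fun a => ?_) fun u => ?_
  · exact div_nonneg zero_le_one (mul_nonneg (Nat.cast_nonneg _) (Real.log_natCast_nonneg _))
  set F := u.map (Function.Embedding.subtype _) with hF
  have hFp : ∀ p ∈ F, p.Prime := fun p hp => by
    obtain ⟨b, _, rfl⟩ := Finset.mem_map.1 hp
    exact b.2
  set N := F.sup id + 1 with hN
  have hE := Real.exp_pos Real.eulerMascheroniConstant
  calc ∑ p ∈ u, 1 / (((p : ℕ) : ℝ) * Real.log (p : ℕ))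
      = ∑ p ∈ F, 1 / ((p : ℝ) * Real.log p) := by
        simp only [hF, Finset.sum_map, Function.Embedding.subtype_apply]
    _ ≤ ∑ p ∈ F, 3 * Real.exp Real.eulerMascheroniConstant * (mertensProd p / p) :=
        Finset.sum_le_sum fun p hp => one_div_mul_log_le_of_prime (hFp p hp)
    _ ≤ ∑ p ∈ (Finset.Ico 0 N).filter Nat.Prime,
          3 * Real.exp Real.eulerMascheroniConstant * (mertensProd p / p) := by
        refine Finset.sum_le_sum_of_subset_of_nonneg (fun p hp => ?_) fun p _ _ => ?_
        · rw [Finset.mem_filter, Finset.mem_Ico]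
          exact ⟨⟨Nat.zero_le p, Nat.lt_succ_of_le (Finset.le_sup (f := id) hp)⟩, hFp p hp⟩
        · have := mertensProd_pos p
          positivity
    _ ≤ _ := by
        rw [← Finset.mul_sum, sum_mertensProd_div_prime (Nat.zero_le N)]
        exact mul_le_mul_of_nonneg_left (by linarith [mertensProd_pos N]) (by positivity)

lemma maxPrimeFac_spec {x b : ℕ} (hb : b ≠ 0) (hb1 : b ≠ 1)
    (h : ∀ p : ℕ, p.Prime → p ∣ b → x ≤ p) : x ≤ maxPrimeFac x b ∧ maxPrimeFac x b ∣ b := by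
  refine ⟨le_max_left _ _, ?_⟩
  obtain ⟨p, hp, he⟩ := Finset.exists_mem_eq_sup b.primeFactors
    ⟨b.minFac, Nat.mem_primeFactors.2 ⟨Nat.minFac_prime hb1, Nat.minFac_dvd b, hb⟩⟩ id
  have hp' := Nat.mem_primeFactors.1 hp
  rw [maxPrimeFac, he, id, max_eq_right (h p hp'.1 hp'.2.1)]
  exact hp'.2.1

lemma sum_one_div_mul_log_le_of_isMertens {q : ℕ} (hq : q.Prime) (hM : IsMertens q)
    {F : Finset ℕ} (hF : ∀ a ∈ F, 1 < a ∧ a.minFac = q)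
    (hA : ∀ a ∈ F, ∀ b ∈ F, a ∣ b → a = b) :
    ∑ a ∈ F, 1 / ((a : ℝ) * Real.log a) ≤ 1 / ((q : ℝ) * Real.log q) := by
  have hq3 : 3 ≤ q := by
    rcases hq.two_le.eq_or_lt with rfl | h
    · exact absurd hM not_isMertens_two
    · exact h
  have hqd : ∀ a ∈ F, q ∣ a := fun a ha => (hF a ha).2 ▸ Nat.minFac_dvd a
  by_cases hqF : q ∈ F
  · have : F = {q} := Finset.eq_singleton_iff_unique_mem.2
      ⟨hqF, fun a ha => (hA q hqF a ha (hqd a ha)).symm⟩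
    rw [this, Finset.sum_singleton]
  have hq0 : (0 : ℝ) < q := by exact_mod_cast hq.pos
  have hlogq : 0 < Real.log q := Real.log_pos (by exact_mod_cast hq.one_lt)
  have hE := Real.exp_pos Real.eulerMascheroniConstant
  set C := Real.exp Real.eulerMascheroniConstant / q with hC
  have hrough : ∀ a ∈ F, ∀ p : ℕ, p.Prime → p ∣ a / q → q ≤ p := fun a ha p hp hpd =>
    (hF a ha).2 ▸ Nat.minFac_le_of_dvd hp.two_le (hpd.trans (Nat.div_dvd_of_dvd (hqd a ha)))
  have hterm : ∀ a ∈ F, 1 / ((a : ℝ) * Real.log a)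
      ≤ C * (mertensProd (maxPrimeFac q (a / q)) / ((a / q : ℕ) : ℝ)) := by
    intro a ha
    obtain ⟨b, rfl⟩ := hqd a ha
    have hb0 : b ≠ 0 := by
      rintro rfl
      exact absurd (hF _ ha).1 (by simp)
    have hb1 : b ≠ 1 := by
      rintro rfl
      exact hqF (by simpa using ha)
    have hr := hrough _ ha
    rw [Nat.mul_div_cancel_left b hq.pos] at hr ⊢
    obtain ⟨hqP, hPb⟩ := maxPrimeFac_spec hb0 hb1 hr
    set P := maxPrimeFac q b
    have hPpos := mertensProd_pos P
    have hb' : (0 : ℝ) < b := by exact_mod_cast Nat.pos_of_ne_zero hb0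
    have hPle : 3 * P ≤ q * b := Nat.mul_le_mul hq3 (Nat.le_of_dvd (Nat.pos_of_ne_zero hb0) hPb)
    have hlog : Real.log (3 * P) ≤ Real.log ((q * b : ℕ) : ℝ) := by
      refine Real.log_le_log ?_ (by exact_mod_cast hPle)
      exact_mod_cast (by omega : 0 < 3 * P)
    have hlogpos : 0 < Real.log ((q * b : ℕ) : ℝ) := Real.log_pos (by exact_mod_cast (hF _ ha).1)
    have h1 := one_le_exp_mul_mertensProd_mul_log (x := P) (by omega)
    have h2 : 1 ≤ Real.exp Real.eulerMascheroniConstant * mertensProd P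
        * Real.log ((q * b : ℕ) : ℝ) :=
      h1.trans (mul_le_mul_of_nonneg_left hlog (by positivity))
    rw [div_le_iff₀ (mul_pos (by exact_mod_cast (hF _ ha).1.trans' zero_lt_one) hlogpos)]
    refine h2.trans (le_of_eq ?_)
    rw [hC]
    push_cast
    field_simp
  have hinj : ∀ a ∈ F, ∀ b ∈ F, a / q = b / q → a = b := fun a ha b hb h => by
    rw [← Nat.mul_div_cancel' (hqd a ha), h, Nat.mul_div_cancel' (hqd b hb)]
  have hG : ∑ b ∈ F.image (· / q), mertensProd (maxPrimeFac q b) / b ≤ mertensProd q := by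
    refine sum_mertensProd_maxPrimeFac_le (F.sup id + 1) q _ (fun b hb => ?_)
      fun b hb c hc hbc => ?_
    · obtain ⟨a, ha, rfl⟩ := Finset.mem_image.1 hb
      refine ⟨Nat.div_pos (Nat.le_of_dvd (by linarith [(hF a ha).1]) (hqd a ha)) hq.pos, ?_,
        hrough a ha⟩
      exact Nat.lt_succ_of_le ((Nat.div_le_self a q).trans (Finset.le_sup (f := id) ha))
    · obtain ⟨a, ha, rfl⟩ := Finset.mem_image.1 hb
      obtain ⟨d, hd, rfl⟩ := Finset.mem_image.1 hc
      have := Nat.mul_dvd_mul_left q hbc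
      rw [Nat.mul_div_cancel' (hqd a ha), Nat.mul_div_cancel' (hqd d hd)] at this
      rw [hA a ha d hd this]
  rw [Finset.sum_image hinj] at hG
  have hM' : Real.exp Real.eulerMascheroniConstant * mertensProd q ≤ 1 / Real.log q := hM
  calc _ ≤ ∑ a ∈ F, C * (mertensProd (maxPrimeFac q (a / q)) / ((a / q : ℕ) : ℝ)) :=
        Finset.sum_le_sum hterm
    _ ≤ C * mertensProd q := by
        rw [← Finset.mul_sum]
        exact mul_le_mul_of_nonneg_left hG (by positivity)
    _ = Real.exp Real.eulerMascheroniConstant * mertensProd q / q := by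
        rw [hC]
        ring
    _ ≤ 1 / Real.log q / q := div_le_div_of_nonneg_right hM' hq0.le
    _ = _ := by rw [div_div, mul_comm]

theorem mertens_primes_erdos_strong (A : Set ℕ) (hA : IsPrimitive A) :
    (∀ q : ℕ, q.Prime → IsMertens q →
      f {a ∈ A | a.minFac = q} ≤ 1 / (q * Real.log q)) ∧
    ((∀ q : ℕ, q.Prime → ¬ IsMertens q → {a ∈ A | a.minFac = q} ⊆ {q}) →
      f A ≤ ∑' p : {p : ℕ // p.Prime}, 1 / ((p : ℕ) * Real.log (p : ℕ))) := by
  have hprim : ∀ F : Finset ℕ, (∀ a ∈ F, a ∈ A) → ∀ a ∈ F, ∀ b ∈ F, a ∣ b → a = b :=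
    fun F hF a ha b hb hab => by
      by_contra hne
      exact hA.2 a (hF a ha) b (hF b hb) hne hab
  constructor
  · intro q hq hM
    refine f_le_of_forall_finset fun F hF => ?_
    exact sum_one_div_mul_log_le_of_isMertens hq hM
      (fun a ha => ⟨hA.1 a (hF a ha).1, (hF a ha).2⟩) (hprim F fun a ha => (hF a ha).1)
  · intro hnon
    refine f_le_of_forall_finset fun F hF => ?_
    have hfib : ∀ q : ℕ, q.Prime → ∑ a ∈ F.filter (fun a => a.minFac = q),
        1 / ((a : ℝ) * Real.log a) ≤ 1 / ((q : ℝ) * Real.log q) := by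
      intro q hq
      have hsub : ∀ a ∈ F.filter (fun a => a.minFac = q), a ∈ A := fun a ha =>
        hF a (Finset.mem_filter.1 ha).1
      by_cases hM : IsMertens q
      · exact sum_one_div_mul_log_le_of_isMertens hq hM
          (fun a ha => ⟨hA.1 a (hsub a ha), (Finset.mem_filter.1 ha).2⟩) (hprim _ hsub)
      · have hss : F.filter (fun a => a.minFac = q) ⊆ {q} := fun a ha =>
          Finset.mem_singleton.2 (hnon q hq hM ⟨hsub a ha, (Finset.mem_filter.1 ha).2⟩)
        refine (Finset.sum_le_sum_of_subset_of_nonneg hss fun a _ _ => ?_).trans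
          (by rw [Finset.sum_singleton])
        exact div_nonneg zero_le_one (mul_nonneg (Nat.cast_nonneg _) (Real.log_natCast_nonneg _))
    have hpr : ∀ q ∈ F.image Nat.minFac, q.Prime := fun q hq => by
      obtain ⟨a, ha, rfl⟩ := Finset.mem_image.1 hq
      exact Nat.minFac_prime (hA.1 a (hF a ha)).ne'
    calc ∑ a ∈ F, 1 / ((a : ℝ) * Real.log a)
        = ∑ q ∈ F.image Nat.minFac, ∑ a ∈ F.filter (fun a => a.minFac = q),
            1 / ((a : ℝ) * Real.log a) :=
          (Finset.sum_fiberwise_of_maps_to (fun a ha => Finset.mem_image_of_mem _ ha) _).symm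
      _ ≤ ∑ q ∈ F.image Nat.minFac, 1 / ((q : ℝ) * Real.log q) :=
          Finset.sum_le_sum fun q hq => hfib q (hpr q hq)
      _ = ∑ p ∈ (F.image Nat.minFac).subtype Nat.Prime,
            1 / (((p : ℕ) : ℝ) * Real.log (p : ℕ)) :=
          (Finset.sum_subtype_of_mem (fun p : ℕ => 1 / ((p : ℝ) * Real.log p)) hpr).symm
      _ ≤ _ := summable_one_div_prime_mul_log.sum_le_tsum _ fun p _ =>
          div_nonneg zero_le_one (mul_nonneg (Nat.cast_nonneg _) (Real.log_natCast_nonneg _))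
end

section
/- Every odd prime q not exceeding the 10^8-th prime p_{10^8} = 2038074743 is Erdős strong: for any primitive set A all of whose elements have least prime factor equal to q, f(A) ≤ 1/(q·log q). -/
open scoped BigOperators

/-- A prime `q` is *Erdős strong* if for every primitive set `A` all of whose
elements have least prime factor `q`, one has `f(A) ≤ 1/(q log q)`. -/
def ErdosStrong (q : ℕ) : Prop :=
  ∀ A : Set ℕ, IsPrimitive A → (∀ a ∈ A, a.minFac = q) →
    f A ≤ 1 / (q * Real.log q)

namespace ErdosPrimitive

/-- A divisor of `e * r` whose primes are smaller than those of `r` divides `e`. -/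
lemma dvd_of_dvd_mul_of_rough {c e r z : ℕ} (hc : ∀ p, p.Prime → p ∣ c → p < z)
    (hr : ∀ p, p.Prime → p ∣ r → z ≤ p) (h : c ∣ e * r) : c ∣ e := by
  refine Nat.Coprime.dvd_of_dvd_mul_right ?_ h
  refine Nat.coprime_of_dvd fun p hp hpc hpr => ?_
  exact absurd (hr p hp hpr) (not_le.2 (hc p hp hpc))

/-- Two splittings of a number into a part with primes at most `x` and a part with primes at
least `x` have comparable smooth parts. -/
lemma dvd_or_dvd_of_mul_eq_mul {d d' m m' x : ℕ} (hx : x.Prime) (hd0 : d ≠ 0) (hd0' : d' ≠ 0)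
    (hd : ∀ p, p.Prime → p ∣ d → p ≤ x) (hd' : ∀ p, p.Prime → p ∣ d' → p ≤ x)
    (hm : ∀ p, p.Prime → p ∣ m → x ≤ p) (hm' : ∀ p, p.Prime → p ∣ m' → x ≤ p)
    (h : d * m = d' * m') : d ∣ d' ∨ d' ∣ d := by
  obtain ⟨i, e, hxe, rfl⟩ := Nat.exists_eq_pow_mul_and_not_dvd hd0 x hx.ne_one
  obtain ⟨j, e', hxe', rfl⟩ := Nat.exists_eq_pow_mul_and_not_dvd hd0' x hx.ne_one
  have key : ∀ {i j e e' m m' : ℕ}, ¬ x ∣ e → (∀ p, p.Prime → p ∣ x ^ i * e → p ≤ x) →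
      (∀ p, p.Prime → p ∣ m' → x ≤ p) → x ^ i * e * m = x ^ j * e' * m' → e ∣ e' := by
    intro i j e e' m m' hxe hd hm' h
    have h1 : ∀ p, p.Prime → p ∣ e → p < x := fun p hp hpe =>
      lt_of_le_of_ne (hd p hp (hpe.mul_left _)) (by rintro rfl; exact hxe hpe)
    refine dvd_of_dvd_mul_of_rough (r := x ^ j * m') h1 ?_ ?_
    · intro p hp hpr
      rcases (hp.dvd_mul).1 hpr with h2 | h2
      · exact ((Nat.prime_dvd_prime_iff_eq hp hx).1 (hp.dvd_of_dvd_pow h2)).ge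
      · exact hm' p hp h2
    · rw [show e' * (x ^ j * m') = x ^ j * e' * m' by ring, ← h]
      exact (Dvd.intro_left _ rfl).mul_right m
  have h1 : e ∣ e' := key hxe hd hm' h
  have h2 : e' ∣ e := key hxe' hd' hm h.symm
  obtain rfl := Nat.dvd_antisymm h1 h2
  rcases le_total i j with hij | hij
  · exact Or.inl (mul_dvd_mul_right (pow_dvd_pow x hij) e)
  · exact Or.inr (mul_dvd_mul_right (pow_dvd_pow x hij) e)

lemma dvd_or_dvd_of_rough {a a' m m' P P' : ℕ} (hP : P.Prime) (ha0 : a ≠ 0) (ha0' : a' ≠ 0)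
    (ha : ∀ p, p.Prime → p ∣ a → p ≤ P) (ha' : ∀ p, p.Prime → p ∣ a' → p ≤ P')
    (hm : ∀ p, p.Prime → p ∣ m → P ≤ p) (hm' : ∀ p, p.Prime → p ∣ m' → P' ≤ p)
    (hP' : P'.Prime) (h : a * m = a' * m') : a ∣ a' ∨ a' ∣ a := by
  wlog hle : P ≤ P' generalizing a a' m m' P P'
  · exact (this hP' ha0' ha0 ha' ha hm' hm hP h.symm (le_of_not_ge hle)).symm
  rcases hle.eq_or_lt with rfl | hlt
  · exact dvd_or_dvd_of_mul_eq_mul hP ha0 ha0' ha ha' hm hm' h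
  · exact Or.inl (dvd_of_dvd_mul_of_rough (fun p hp hpa => (ha p hp hpa).trans_lt hlt) hm'
      (h ▸ Dvd.intro _ rfl))

/-- `d` has largest prime factor `x`, which is so small that `x ^ t ^ 2 ≤ P`. -/
structure Gap (t : ℝ) (d x P : ℕ) : Prop where
  ne_zero : d ≠ 0
  prime : P.Prime
  prime_x : x.Prime
  dvd : x ∣ d
  le : ∀ p, p.Prime → p ∣ d → p ≤ x
  gap : ((x : ℝ) ^ t) ^ t ≤ P

lemma Gap.lt_rpow {t : ℝ} (ht : 1 < t) {d x P : ℕ} (h : Gap t d x P) : (x : ℝ) < (x : ℝ) ^ t := by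
  have h1 : (1 : ℝ) < x := by exact_mod_cast h.prime_x.one_lt
  simpa using Real.rpow_lt_rpow_of_exponent_lt h1 ht

lemma Gap.rpow_lt {t : ℝ} (ht : 1 < t) {d x P : ℕ} (h : Gap t d x P) : (x : ℝ) ^ t < P := by
  have h1 : (1 : ℝ) < x := by exact_mod_cast h.prime_x.one_lt
  refine lt_of_lt_of_le ?_ h.gap
  simpa using Real.rpow_lt_rpow_of_exponent_lt (Real.one_lt_rpow h1 (by linarith)) ht

lemma Gap.lt {t : ℝ} (ht : 1 < t) {d x P : ℕ} (h : Gap t d x P) : x < P := by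
  exact_mod_cast (h.lt_rpow ht).trans (h.rpow_lt ht)

lemma Gap.not_dvd {d x P p : ℕ} {t : ℝ} (h : Gap t d x P) (hp : p.Prime) (hlt : x < p) :
    ¬ p ∣ d := fun hd => absurd (h.le p hp hd) (not_le.2 hlt)

lemma Gap.dvd_or_dvd {t : ℝ} (ht : 1 < t) {d x P d' x' P' m m' : ℕ} (hd : Gap t d x P)
    (hd' : Gap t d' x' P')
    (hm : ∀ p, p.Prime → p ∣ m → (x ≤ p ∧ (p : ℝ) < (x : ℝ) ^ t) ∨ P ≤ p)
    (hm' : ∀ p, p.Prime → p ∣ m' → (x' ≤ p ∧ (p : ℝ) < (x' : ℝ) ^ t) ∨ P' ≤ p)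
    (h : d * P * m = d' * P' * m') : d * P ∣ d' * P' ∨ d' * P' ∣ d * P := by
  wlog hle : x ≤ x' generalizing d d' m m' P P' x x'
  · exact (this hd' hd hm' hm h.symm (le_of_not_ge hle)).symm
  have hxP := hd.lt ht
  have hxP' := hd'.lt ht
  have hmono : (x : ℝ) ^ t ≤ (x' : ℝ) ^ t :=
    Real.rpow_le_rpow (by positivity) (by exact_mod_cast hle) (by linarith)
  -- once `P` lies beyond the gap of `d'`, it must occur as `P'` or later
  have hPP' : (x' : ℝ) ^ t ≤ P → P' ≤ P := by
    intro hlt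
    have hx'P : x' < P := by exact_mod_cast (hd'.lt_rpow ht).trans_le hlt
    have : P ∣ d' * P' * m' := h ▸ (Dvd.intro_left d rfl).mul_right m
    rcases (hd.prime.dvd_mul).1 this with h1 | h1
    · rcases (hd.prime.dvd_mul).1 h1 with h2 | h2
      · exact absurd h2 (hd'.not_dvd hd.prime hx'P)
      · exact ((Nat.prime_dvd_prime_iff_eq hd.prime hd'.prime).1 h2).ge
    · rcases hm' P hd.prime h1 with h2 | h2
      · exact absurd h2.2 (not_lt.2 hlt)
      · exact h2
  have hPP : P ≤ P' := by
    have hlt : x < P' := hle.trans_lt hxP'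
    have : P' ∣ d * P * m := h ▸ (Dvd.intro_left d' rfl).mul_right m'
    rcases (hd'.prime.dvd_mul).1 this with h1 | h1
    · rcases (hd'.prime.dvd_mul).1 h1 with h2 | h2
      · exact absurd h2 (hd.not_dvd hd'.prime hlt)
      · exact ((Nat.prime_dvd_prime_iff_eq hd'.prime hd.prime).1 h2).ge
    · rcases hm P' hd'.prime h1 with h2 | h2
      · exact absurd (h2.2.trans_le hmono) (not_lt.2 (hd'.rpow_lt ht).le)
      · exact h2
  have hmx : ∀ p, p.Prime → p ∣ m → x ≤ p := fun p hp hpm =>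
    (hm p hp hpm).elim (fun h => h.1) fun h => hxP.le.trans h
  have hmx' : ∀ p, p.Prime → p ∣ m' → x' ≤ p := fun p hp hpm =>
    (hm' p hp hpm).elim (fun h => h.1) fun h => hxP'.le.trans h
  have hrough' : ∀ p, p.Prime → p ∣ P' * m' → x' ≤ p := by
    intro p hp hpm
    rcases (hp.dvd_mul).1 hpm with h1 | h1
    · exact hxP'.le.trans ((Nat.prime_dvd_prime_iff_eq hp hd'.prime).1 h1).ge
    · exact hmx' p hp h1
  rcases hle.eq_or_lt with rfl | hlt
  · obtain rfl : P = P' := le_antisymm hPP (hPP' (hd.rpow_lt ht).le)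
    have h' : d * m = d' * m' := by
      have : P * (d * m) = P * (d' * m') := by linarith
      exact Nat.eq_of_mul_eq_mul_left hd.prime.pos this
    exact (dvd_or_dvd_of_mul_eq_mul hd.prime_x hd.ne_zero hd'.ne_zero hd.le hd'.le hmx hmx' h').imp
      (fun h => mul_dvd_mul_right h P) (fun h => mul_dvd_mul_right h P)
  have hN : d * P ∣ d' * (P' * m') := by rw [← mul_assoc, ← h]; exact Dvd.intro _ rfl
  have hdd' : d ∣ d' := dvd_of_dvd_mul_of_rough (fun p hp hpd => (hd.le p hp hpd).trans_lt hlt)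
    hrough' ((Dvd.intro _ rfl).trans hN)
  rcases lt_or_ge P x' with hPx' | hPx'
  · left
    refine Dvd.dvd.mul_right (dvd_of_dvd_mul_of_rough ?_ hrough' hN) _
    intro p hp hpd
    rcases (hp.dvd_mul).1 hpd with h1 | h1
    · exact (hd.le p hp h1).trans_lt hlt
    · exact ((Nat.prime_dvd_prime_iff_eq hp hd.prime).1 h1).trans_lt hPx'
  have hcop : Nat.Coprime d P :=
    ((Nat.Prime.coprime_iff_not_dvd hd.prime).2 (hd.not_dvd hd.prime hxP)).symm
  have hx'dvd : x' ∣ d * P * m := h ▸ (hd'.dvd.mul_right _).mul_right _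
  have hcase : x' = P ∨ (x' : ℝ) < (x : ℝ) ^ t := by
    rcases (hd'.prime_x.dvd_mul).1 hx'dvd with h1 | h1
    · rcases (hd'.prime_x.dvd_mul).1 h1 with h2 | h2
      · exact absurd h2 (hd.not_dvd hd'.prime_x hlt)
      · exact Or.inl ((Nat.prime_dvd_prime_iff_eq hd'.prime_x hd.prime).1 h2)
    · rcases hm x' hd'.prime_x h1 with h2 | h2
      · exact Or.inr h2.2
      · exact Or.inl (le_antisymm hPx' h2)
  rcases hcase with rfl | hcase
  · exact Or.inl ((hcop.mul_dvd_of_dvd_of_dvd hdd' hd'.dvd).mul_right _)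
  · have : (x' : ℝ) ^ t ≤ P :=
      (Real.rpow_le_rpow (by positivity) hcase.le (by linarith)).trans hd.gap
    obtain rfl : P = P' := le_antisymm hPP (hPP' this)
    exact Or.inl (mul_dvd_mul_right hdd' P)

/-- The completely multiplicative function `n ↦ 1 / n`. -/
noncomputable def invHom : ℕ →* ℝ :=
  (invMonoidWithZeroHom : ℝ →*₀ ℝ).toMonoidHom.comp (Nat.castRingHom ℝ : ℕ →* ℝ)

lemma invHom_apply (n : ℕ) : invHom n = (n : ℝ)⁻¹ := rfl

lemma hasSum_inv_factoredNumbers (s : Finset ℕ) (hs : ∀ p ∈ s, p.Prime) :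
    HasSum (fun m : Nat.factoredNumbers s => ((m : ℕ) : ℝ)⁻¹) (∏ p ∈ s, (1 - (p : ℝ)⁻¹)⁻¹) := by
  have h := (EulerProduct.summable_and_hasSum_factoredNumbers_prod_filter_prime_geometric
    (f := invHom) (fun {p} hp => by
      rw [invHom_apply, norm_inv, Real.norm_natCast]
      exact inv_lt_one_of_one_lt₀ (by exact_mod_cast hp.one_lt)) s).2
  rw [Finset.filter_true_of_mem hs] at h
  exact h

/-- Mass inequality: pairwise disjoint translates `a * ⟨S a⟩` inside `⟨T⟩`. -/
lemma sum_prod_le (A : Finset ℕ) (S : ℕ → Finset ℕ) (T : Finset ℕ)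
    (hT : ∀ p ∈ T, p.Prime) (hST : ∀ a ∈ A, S a ⊆ T) (q : ℕ) (hq : q ≠ 0)
    (hA : ∀ a ∈ A, ∃ r ∈ Nat.factoredNumbers T, a = q * r)
    (hdisj : ∀ a ∈ A, ∀ a' ∈ A, ∀ m ∈ Nat.factoredNumbers (S a),
      ∀ m' ∈ Nat.factoredNumbers (S a'), a * m = a' * m' → a = a') :
    ∑ a ∈ A, (a : ℝ)⁻¹ * ∏ p ∈ S a, (1 - (p : ℝ)⁻¹)⁻¹ ≤
      (q : ℝ)⁻¹ * ∏ p ∈ T, (1 - (p : ℝ)⁻¹)⁻¹ := by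
  choose! r hr har using hA
  have hsum := (hasSum_inv_factoredNumbers T hT).mul_left (q : ℝ)⁻¹
  have hsumS : ∀ a : A, HasSum
      (fun m : Nat.factoredNumbers (S a) => ((a : ℕ) : ℝ)⁻¹ * ((m : ℕ) : ℝ)⁻¹)
      (((a : ℕ) : ℝ)⁻¹ * ∏ p ∈ S a, (1 - (p : ℝ)⁻¹)⁻¹) := fun a =>
    (hasSum_inv_factoredNumbers (S a) fun p hp => hT p (hST a a.2 hp)).mul_left _
  let φ : (Σ a : A, Nat.factoredNumbers (S a)) → Nat.factoredNumbers T := fun x =>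
    ⟨r x.1 * x.2, Nat.mul_mem_factoredNumbers (hr _ x.1.2)
      (Nat.factoredNumbers_mono (hST _ x.1.2) x.2.2)⟩
  have hφ : Function.Injective φ := by
    rintro ⟨⟨a, ha⟩, ⟨m, hm⟩⟩ ⟨⟨a', ha'⟩, ⟨m', hm'⟩⟩ hxy
    have h1 : r a * m = r a' * m' := congrArg Subtype.val hxy
    have h2 : a * m = a' * m' := by
      rw [har a ha, har a' ha', mul_assoc, h1, mul_assoc]
    obtain rfl := hdisj a ha a' ha' m hm m' hm' h2
    have hr0 : r a ≠ 0 := Nat.ne_zero_of_mem_factoredNumbers (hr a ha)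
    obtain rfl := Nat.eq_of_mul_eq_mul_left (Nat.pos_of_ne_zero hr0) h1
    rfl
  have hval : ∀ x : Σ a : A, Nat.factoredNumbers (S a),
      (q : ℝ)⁻¹ * ((φ x : ℕ) : ℝ)⁻¹ = ((x.1 : ℕ) : ℝ)⁻¹ * ((x.2 : ℕ) : ℝ)⁻¹ := by
    rintro ⟨⟨a, ha⟩, m⟩
    have : ((a : ℕ) : ℝ) = q * r a := by exact_mod_cast har a ha
    simp only [φ, this, Nat.cast_mul, mul_inv]
    ring
  have hs := hsum.summable.comp_injective hφ
  have hs' : Summable fun x : Σ a : A, Nat.factoredNumbers (S a) =>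
      ((x.1 : ℕ) : ℝ)⁻¹ * ((x.2 : ℕ) : ℝ)⁻¹ := hs.congr hval
  rw [← Finset.sum_coe_sort A, ← hsum.tsum_eq]
  calc _ = ∑' x : Σ a : A, Nat.factoredNumbers (S a),
        ((x.1 : ℕ) : ℝ)⁻¹ * ((x.2 : ℕ) : ℝ)⁻¹ := by
        rw [hs'.tsum_sigma' fun a => (hsumS a).summable, tsum_fintype]
        exact Finset.sum_congr rfl fun a _ => (hsumS a).tsum_eq.symm
    _ = ∑' x, (q : ℝ)⁻¹ * ((φ x : ℕ) : ℝ)⁻¹ := tsum_congr fun x => (hval x).symm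
    _ ≤ _ := tsum_comp_le_tsum_of_inj hsum.summable (fun _ => by positivity) hφ

/-- The product of `1 - 1 / p` over the primes `p < n`. -/
noncomputable def mertensProd (n : ℕ) : ℝ := ∏ p ∈ n.primesBelow, (1 - (p : ℝ)⁻¹)

/-- The Mertens product normalised by the logarithm. -/
noncomputable def mertensRatio (n : ℕ) : ℝ := Real.log n * mertensProd n

lemma one_sub_inv_pos {p : ℕ} (hp : p.Prime) : (0 : ℝ) < 1 - (p : ℝ)⁻¹ :=
  sub_pos.2 (inv_lt_one_of_one_lt₀ (by exact_mod_cast hp.one_lt))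

lemma mertensProd_pos (n : ℕ) : 0 < mertensProd n :=
  Finset.prod_pos fun _ hp => one_sub_inv_pos (Nat.prime_of_mem_primesBelow hp)

lemma mertensRatio_pos {n : ℕ} (hn : 1 < n) : 0 < mertensRatio n :=
  mul_pos (Real.log_pos (by exact_mod_cast hn)) (mertensProd_pos n)

/-- The primes `p` with `a ≤ p < b`. -/
def primesIco (a b : ℕ) : Finset ℕ := b.primesBelow.filter (a ≤ ·)

lemma mem_primesIco {a b p : ℕ} : p ∈ primesIco a b ↔ p.Prime ∧ a ≤ p ∧ p < b := by
  simp only [primesIco, Finset.mem_filter, Nat.mem_primesBelow]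
  tauto

lemma mertensProd_mul_prod {a b : ℕ} (h : a ≤ b) :
    mertensProd a * ∏ p ∈ primesIco a b, (1 - (p : ℝ)⁻¹) = mertensProd b := by
  unfold mertensProd
  rw [primesIco, mul_comm, ← Finset.prod_filter_mul_prod_filter_not b.primesBelow (a ≤ ·)]
  congr 1
  refine Finset.prod_congr ?_ fun _ _ => rfl
  ext p
  simp only [Finset.mem_filter, Nat.mem_primesBelow, not_le]
  constructor
  · rintro ⟨h1, h2⟩; exact ⟨⟨h1.trans_le h, h2⟩, h1⟩
  · rintro ⟨⟨_, h2⟩, h3⟩; exact ⟨h3, h2⟩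

lemma prod_inv_primesIco {a b : ℕ} (h : a ≤ b) :
    ∏ p ∈ primesIco a b, (1 - (p : ℝ)⁻¹)⁻¹ = mertensProd a / mertensProd b := by
  rw [Finset.prod_inv_distrib, ← mertensProd_mul_prod h]
  have := (mertensProd_pos a).ne'
  field_simp

/-- The largest prime factor. -/
def maxFac (n : ℕ) : ℕ := n.primeFactors.sup id

lemma le_maxFac {n p : ℕ} (hn : n ≠ 0) (hp : p.Prime) (h : p ∣ n) : p ≤ maxFac n :=
  Finset.le_sup (f := id) (Nat.mem_primeFactors.2 ⟨hp, h, hn⟩)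

lemma maxFac_mem {n : ℕ} (hn : 1 < n) : maxFac n ∈ n.primeFactors := by
  obtain ⟨p, hp, h⟩ := Finset.exists_mem_eq_sup n.primeFactors (Nat.nonempty_primeFactors.2 hn) id
  exact (show maxFac n = p from h) ▸ hp

/-- The cofactor of the largest prime factor. -/
def cofac (n : ℕ) : ℕ := n / maxFac n

/-- `a` is a composite number with least prime factor `q`. -/
structure Composite (q a : ℕ) : Prop where
  one_lt : 1 < a
  minFac_eq : a.minFac = q
  ne : a ≠ q

namespace Composite

variable {q a : ℕ}

lemma ne_zero (h : Composite q a) : a ≠ 0 := (zero_lt_one.trans h.one_lt).ne'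

lemma prime_maxFac (h : Composite q a) : (maxFac a).Prime :=
  (Nat.mem_primeFactors.1 (maxFac_mem h.one_lt)).1

lemma maxFac_dvd (h : Composite q a) : maxFac a ∣ a :=
  (Nat.mem_primeFactors.1 (maxFac_mem h.one_lt)).2.1

lemma cofac_mul (h : Composite q a) : cofac a * maxFac a = a := Nat.div_mul_cancel h.maxFac_dvd

lemma le_of_dvd (h : Composite q a) {p : ℕ} (hp : p.Prime) (hpa : p ∣ a) : q ≤ p :=
  h.minFac_eq ▸ Nat.minFac_le_of_dvd hp.two_le hpa

lemma one_lt_cofac (h : Composite q a) : 1 < cofac a := by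
  have h0 : cofac a ≠ 0 := fun h0 => h.ne_zero (by rw [← h.cofac_mul, h0, zero_mul])
  have h1 : cofac a ≠ 1 := fun h1 => h.ne (by
    have h2 := h.cofac_mul
    rw [h1, one_mul] at h2
    rw [← h.minFac_eq, ← h2, h.prime_maxFac.minFac_eq])
  omega

lemma cofac_dvd (h : Composite q a) : cofac a ∣ a := ⟨_, h.cofac_mul.symm⟩

lemma maxFac_cofac_mem (h : Composite q a) : maxFac (cofac a) ∈ (cofac a).primeFactors :=
  maxFac_mem h.one_lt_cofac

lemma prime_maxFac_cofac (h : Composite q a) : (maxFac (cofac a)).Prime :=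
  (Nat.mem_primeFactors.1 h.maxFac_cofac_mem).1

lemma maxFac_cofac_dvd (h : Composite q a) : maxFac (cofac a) ∣ cofac a :=
  (Nat.mem_primeFactors.1 h.maxFac_cofac_mem).2.1

lemma le_maxFac_cofac (h : Composite q a) : q ≤ maxFac (cofac a) :=
  h.le_of_dvd h.prime_maxFac_cofac (h.maxFac_cofac_dvd.trans h.cofac_dvd)

lemma le_maxFac (h : Composite q a) : q ≤ maxFac a := h.le_of_dvd h.prime_maxFac h.maxFac_dvd

lemma gap (h : Composite q a) {t : ℝ} (ht : ((maxFac (cofac a) : ℝ) ^ t) ^ t ≤ maxFac a) :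
    Gap t (cofac a) (maxFac (cofac a)) (maxFac a) where
  ne_zero := (zero_lt_one.trans h.one_lt_cofac).ne'
  prime := h.prime_maxFac
  prime_x := h.prime_maxFac_cofac
  dvd := h.maxFac_cofac_dvd
  le _ hp hpd := ErdosPrimitive.le_maxFac (zero_lt_one.trans h.one_lt_cofac).ne' hp hpd
  gap := ht

lemma exists_eq_mul (h : Composite q a) {N : ℕ} (hN : a < N) :
    ∃ r ∈ Nat.factoredNumbers (primesIco q N), a = q * r := by
  obtain ⟨r, hr⟩ := h.minFac_eq ▸ a.minFac_dvd
  have ha0 := Nat.pos_of_ne_zero h.ne_zero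
  refine ⟨r, Nat.mem_factoredNumbers'.2 fun p hp hpr => ?_, hr⟩
  have hpa : p ∣ a := hr ▸ hpr.mul_left _
  exact mem_primesIco.2 ⟨hp, h.le_of_dvd hp hpa, (Nat.le_of_dvd ha0 hpa).trans_lt hN⟩

end Composite

lemma eq_of_dvd_or_dvd {A : Set ℕ} (hA : IsPrimitive A) {a b : ℕ} (ha : a ∈ A) (hb : b ∈ A)
    (h : a ∣ b ∨ b ∣ a) : a = b := by
  by_contra hne
  exact h.elim (hA.2 a ha b hb hne) (hA.2 b hb a ha (Ne.symm hne))

lemma sum_inv_mul_mertensProd_le {q : ℕ} (hq : q ≠ 0) {A : Finset ℕ} (hA : IsPrimitive (A : Set ℕ))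
    (hc : ∀ a ∈ A, Composite q a) :
    ∑ a ∈ A, (a : ℝ)⁻¹ * mertensProd (maxFac a) ≤ (q : ℝ)⁻¹ * mertensProd q := by
  set N := A.sup id + q + 1 with hN
  have haN : ∀ a ∈ A, a < N := fun a ha => by
    have := Finset.le_sup (f := id) ha
    simp only [id] at this
    omega
  have hPN : ∀ a ∈ A, maxFac a ≤ N := fun a ha =>
    (Nat.le_of_dvd (Nat.pos_of_ne_zero (hc a ha).ne_zero) (hc a ha).maxFac_dvd).trans (haN a ha).le
  have key := sum_prod_le A (fun a => primesIco (maxFac a) N) (primesIco q N)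
    (fun p hp => (mem_primesIco.1 hp).1)
    (fun a ha p hp => by
      rw [mem_primesIco] at hp ⊢
      exact ⟨hp.1, (hc a ha).le_maxFac.trans hp.2.1, hp.2.2⟩)
    q hq (fun a ha => (hc a ha).exists_eq_mul (haN a ha)) (by
      intro a ha a' ha' m hm m' hm' h
      refine eq_of_dvd_or_dvd hA ha ha' (dvd_or_dvd_of_rough (hc a ha).prime_maxFac
        (hc a ha).ne_zero (hc a' ha').ne_zero (fun p hp h => le_maxFac (hc a ha).ne_zero hp h)
        (fun p hp h => le_maxFac (hc a' ha').ne_zero hp h) ?_ ?_ (hc a' ha').prime_maxFac h)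
      · exact fun p hp hpm => (mem_primesIco.1 (Nat.mem_factoredNumbers'.1 hm p hp hpm)).2.1
      · exact fun p hp hpm => (mem_primesIco.1 (Nat.mem_factoredNumbers'.1 hm' p hp hpm)).2.1)
  have hNpos := mertensProd_pos N
  rw [prod_inv_primesIco (by omega)] at key
  rw [Finset.sum_congr rfl fun a ha => by rw [prod_inv_primesIco (hPN a ha)]] at key
  simp_rw [← mul_div_assoc] at key
  rwa [← Finset.sum_div, div_le_div_iff_of_pos_right hNpos] at key

/-- If the gap below the largest prime is long, the mass inequality gains a factor. -/
lemma sum_gap_le {q : ℕ} (hq : q ≠ 0) {A : Finset ℕ} (hA : IsPrimitive (A : Set ℕ))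
    (hc : ∀ a ∈ A, Composite q a)
    {t : ℝ} (ht : 1 < t)
    (hgap : ∀ a ∈ A, ((maxFac (cofac a) : ℝ) ^ t) ^ t ≤ maxFac a) :
    ∑ a ∈ A, (a : ℝ)⁻¹ * (mertensProd (maxFac a) * (mertensProd (maxFac (cofac a)) /
      mertensProd ⌈(maxFac (cofac a) : ℝ) ^ t⌉₊)) ≤ (q : ℝ)⁻¹ * mertensProd q := by
  set N := A.sup id + q + 1 with hN
  have haN : ∀ a ∈ A, a < N := fun a ha => by
    have := Finset.le_sup (f := id) ha
    simp only [id] at this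
    omega
  have hPN : ∀ a ∈ A, maxFac a ≤ N := fun a ha =>
    (Nat.le_of_dvd (Nat.pos_of_ne_zero (hc a ha).ne_zero) (hc a ha).maxFac_dvd).trans (haN a ha).le
  have hG : ∀ a ∈ A, Gap t (cofac a) (maxFac (cofac a)) (maxFac a) := fun a ha =>
    (hc a ha).gap (hgap a ha)
  have hyP : ∀ a ∈ A, ⌈(maxFac (cofac a) : ℝ) ^ t⌉₊ ≤ maxFac a := fun a ha =>
    Nat.ceil_le.2 ((hG a ha).rpow_lt ht).le
  have hxy : ∀ a ∈ A, maxFac (cofac a) ≤ ⌈(maxFac (cofac a) : ℝ) ^ t⌉₊ := fun a ha => by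
    exact_mod_cast ((hG a ha).lt_rpow ht).le.trans (Nat.le_ceil _)
  have hmem : ∀ a, ∀ m ∈ Nat.factoredNumbers
      (primesIco (maxFac (cofac a)) ⌈(maxFac (cofac a) : ℝ) ^ t⌉₊ ∪ primesIco (maxFac a) N),
      ∀ p, p.Prime → p ∣ m → (maxFac (cofac a) ≤ p ∧ (p : ℝ) < (maxFac (cofac a) : ℝ) ^ t) ∨
        maxFac a ≤ p := by
    intro a m hm p hp hpm
    have := Nat.mem_factoredNumbers'.1 hm p hp hpm
    simp only [Finset.mem_union, mem_primesIco, Nat.lt_ceil] at this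
    tauto
  have key := sum_prod_le A (fun a => primesIco (maxFac (cofac a))
      ⌈(maxFac (cofac a) : ℝ) ^ t⌉₊ ∪ primesIco (maxFac a) N) (primesIco q N)
    (fun p hp => (mem_primesIco.1 hp).1)
    (fun a ha p hp => by
      have h1 := hPN a ha
      have h2 := hyP a ha
      have h3 := (hc a ha).le_maxFac_cofac
      have h4 := (hc a ha).le_maxFac
      simp only [Finset.mem_union, mem_primesIco] at hp ⊢
      rcases hp with hp | hp
      · exact ⟨hp.1, by omega, by omega⟩
      · exact ⟨hp.1, by omega, by omega⟩)
    q hq (fun a ha => (hc a ha).exists_eq_mul (haN a ha)) (by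
      intro a ha a' ha' m hm m' hm' h
      have h1 := (hG a ha).dvd_or_dvd ht (hG a' ha') (hmem a m hm) (hmem a' m' hm')
        (by rwa [(hc a ha).cofac_mul, (hc a' ha').cofac_mul])
      rw [(hc a ha).cofac_mul, (hc a' ha').cofac_mul] at h1
      exact eq_of_dvd_or_dvd hA ha ha' h1)
  have hNpos := mertensProd_pos N
  rw [prod_inv_primesIco (by omega)] at key
  rw [Finset.sum_congr rfl fun a ha => by
    rw [Finset.prod_union (Finset.disjoint_left.2 fun p hp hp' => by
      have h1 := hyP a ha
      rw [mem_primesIco] at hp hp'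
      omega), prod_inv_primesIco (hPN a ha), prod_inv_primesIco (hxy a ha), mul_comm (_ / _),
      div_mul_eq_mul_div]] at key
  simp_rw [← mul_div_assoc] at key
  rw [← Finset.sum_div, div_le_div_iff_of_pos_right hNpos] at key
  simpa only [mul_div_assoc] using key

lemma inv_log_le {q : ℕ} {A : Finset ℕ} (hc : ∀ a ∈ A, Composite q a)
    {α : ℝ} (hα : ∀ P, P.Prime → q ≤ P → mertensRatio q ≤ α * mertensRatio P)
    {a : ℕ} (ha : a ∈ A) :
    (a : ℝ)⁻¹ * (Real.log (maxFac a))⁻¹ * mertensRatio q ≤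
      α * ((a : ℝ)⁻¹ * mertensProd (maxFac a)) := by
  have h1 := hα _ (hc a ha).prime_maxFac (hc a ha).le_maxFac
  have hlog : 0 < Real.log (maxFac a) := Real.log_pos (by
    exact_mod_cast (hc a ha).prime_maxFac.one_lt)
  have ha0 : (0 : ℝ) < a := by exact_mod_cast Nat.pos_of_ne_zero (hc a ha).ne_zero
  rw [mertensRatio.eq_def (maxFac a)] at h1
  calc _ ≤ (a : ℝ)⁻¹ * (Real.log (maxFac a))⁻¹ *
        (α * (Real.log (maxFac a) * mertensProd (maxFac a))) :=
        mul_le_mul_of_nonneg_left h1 (by positivity)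
    _ = _ := by field_simp

lemma sum_bound {q : ℕ} (hq : q ≠ 0) {A : Finset ℕ}
    (hc : ∀ a ∈ A, Composite q a)
    {α : ℝ} (hα : ∀ P, P.Prime → q ≤ P → mertensRatio q ≤ α * mertensRatio P)
    (hq1 : 1 < q) {B : Finset ℕ} (hBA : B ⊆ A) {g : ℕ → ℝ} {κ : ℝ} (hκ : 0 < κ)
    (hα0 : 0 < α) (hg : ∀ a ∈ B, κ ≤ g a)
    (h : ∑ a ∈ B, (a : ℝ)⁻¹ * (mertensProd (maxFac a) * g a) ≤ (q : ℝ)⁻¹ * mertensProd q) :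
    ∑ a ∈ B, (a : ℝ)⁻¹ * (Real.log (maxFac a))⁻¹ ≤ α / κ * (1 / (q * Real.log q)) := by
  have hlogq : 0 < Real.log q := Real.log_pos (by exact_mod_cast hq1)
  have hWq := mertensProd_pos q
  have hq0 : (0 : ℝ) < q := by exact_mod_cast Nat.pos_of_ne_zero hq
  refine le_of_mul_le_mul_right ?_ (mertensRatio_pos hq1)
  rw [Finset.sum_mul]
  calc _ ≤ ∑ a ∈ B, α / κ * ((a : ℝ)⁻¹ * (mertensProd (maxFac a) * g a)) := by
        refine Finset.sum_le_sum fun a ha => (inv_log_le hc hα (hBA ha)).trans ?_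
        have h1 : (0 : ℝ) ≤ (a : ℝ)⁻¹ * mertensProd (maxFac a) := by
          have := mertensProd_pos (maxFac a)
          positivity
        calc α * ((a : ℝ)⁻¹ * mertensProd (maxFac a))
            = α / κ * ((a : ℝ)⁻¹ * mertensProd (maxFac a) * κ) := by field_simp
          _ ≤ α / κ * ((a : ℝ)⁻¹ * mertensProd (maxFac a) * g a) := by
            gcongr
            exact hg a ha
          _ = _ := by ring
    _ ≤ α / κ * ((q : ℝ)⁻¹ * mertensProd q) := by
        rw [← Finset.mul_sum]
        exact mul_le_mul_of_nonneg_left h (by positivity)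
    _ = _ := by
        rw [mertensRatio]
        field_simp

lemma sum_inv_log_le {q : ℕ} (hq : q ≠ 0) {A : Finset ℕ} (hA : IsPrimitive (A : Set ℕ))
    (hc : ∀ a ∈ A, Composite q a)
    {α : ℝ} (hα : ∀ P, P.Prime → q ≤ P → mertensRatio q ≤ α * mertensRatio P)
    (hq1 : 1 < q) (hα0 : 0 < α) :
    ∑ a ∈ A, (a : ℝ)⁻¹ * (Real.log (maxFac a))⁻¹ ≤ α * (1 / (q * Real.log q)) := by
  have h := sum_bound hq hc hα hq1 subset_rfl (g := fun _ => 1) one_pos hα0 (fun _ _ => le_rfl)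
    (by simpa using sum_inv_mul_mertensProd_le hq hA hc)
  simpa using h

open Classical in
lemma sum_gap_inv_log_le {q : ℕ} (hq : q ≠ 0) {A : Finset ℕ} (hA : IsPrimitive (A : Set ℕ))
    (hc : ∀ a ∈ A, Composite q a)
    {α β : ℝ} (hα : ∀ P, P.Prime → q ≤ P → mertensRatio q ≤ α * mertensRatio P)
    (hβ : ∀ x, x.Prime → q ≤ x → ∀ n, x ≤ n → mertensRatio n ≤ β * mertensRatio x)
    (hq1 : 1 < q) (hα0 : 0 < α) (hβ0 : 0 < β) {t : ℝ} (ht : 1 < t) :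
    ∑ a ∈ A with ((maxFac (cofac a) : ℝ) ^ t) ^ t ≤ maxFac a,
      (a : ℝ)⁻¹ * (Real.log (maxFac a))⁻¹ ≤ α * β / t * (1 / (q * Real.log q)) := by
  set B := A.filter fun a => ((maxFac (cofac a) : ℝ) ^ t) ^ t ≤ maxFac a with hB
  have hBA : B ⊆ A := Finset.filter_subset _ _
  have hBA' : (B : Set ℕ) ⊆ A := by exact_mod_cast hBA
  have hBp : IsPrimitive (B : Set ℕ) :=
    ⟨fun a ha => hA.1 a (hBA' ha), fun a ha b hb => hA.2 a (hBA' ha) b (hBA' hb)⟩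
  have hgapB : ∀ a ∈ B, ((maxFac (cofac a) : ℝ) ^ t) ^ t ≤ maxFac a := fun a ha =>
    (Finset.mem_filter.1 ha).2
  have h := sum_bound (κ := t / β) hq hc hα hq1 hBA (by positivity) hα0 ?_
    (sum_gap_le hq hBp (fun a ha => hc a (hBA ha)) ht hgapB)
  · rwa [div_div_eq_mul_div] at h
  intro a ha
  have hca := hc a (hBA ha)
  have hG := hca.gap (hgapB a ha)
  set x := maxFac (cofac a)
  have hxy : (x : ℝ) ^ t ≤ ⌈(x : ℝ) ^ t⌉₊ := Nat.le_ceil _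
  have hx1 : (1 : ℝ) < x := by exact_mod_cast hG.prime_x.one_lt
  have hle : x ≤ ⌈(x : ℝ) ^ t⌉₊ := by exact_mod_cast (hG.lt_rpow ht).le.trans hxy
  have h1 := hβ x hG.prime_x hca.le_maxFac_cofac _ hle
  have hlog : t * Real.log x ≤ Real.log ⌈(x : ℝ) ^ t⌉₊ := by
    rw [← Real.log_rpow (by linarith)]
    exact Real.log_le_log (by positivity) hxy
  have hlogx : 0 < Real.log x := Real.log_pos hx1
  have hWy := mertensProd_pos ⌈(x : ℝ) ^ t⌉₊
  rw [mertensRatio, mertensRatio] at h1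
  rw [div_le_div_iff₀ hβ0 hWy]
  have h2 := (mul_le_mul_of_nonneg_right hlog hWy.le).trans h1
  refine le_of_mul_le_mul_left ?_ hlogx
  linarith

/-- Node of the step function bounding `1 / (1 + s ^ 2)`. -/
noncomputable def node (i : ℕ) : ℝ := 1 / (1 + (i / 20 : ℝ) ^ 2)

lemma node_succ_le (i : ℕ) : node (i + 1) ≤ node i := by
  unfold node
  gcongr
  simp

lemma node_nonneg (i : ℕ) : 0 ≤ node i := by unfold node; positivity

open Classical in
lemma log_ratio_le {q a : ℕ} (h : Composite q a) (n : ℕ) :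
    Real.log (maxFac a) / Real.log a ≤ node n + ∑ i ∈ Finset.range n,
      (node i - node (i + 1)) * (if ((maxFac (cofac a) : ℝ) ^ (20 / (i + 1 : ℝ))) ^
        (20 / (i + 1 : ℝ)) ≤ maxFac a then 1 else 0) := by
  have hP : (1 : ℝ) < maxFac a := by exact_mod_cast h.prime_maxFac.one_lt
  have hd : (1 : ℝ) < cofac a := by exact_mod_cast h.one_lt_cofac
  have hx : (1 : ℝ) < maxFac (cofac a) := by exact_mod_cast h.prime_maxFac_cofac.one_lt
  have hlogP := Real.log_pos hP
  have hlogd := Real.log_pos hd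
  have hloga : Real.log a = Real.log (cofac a) + Real.log (maxFac a) := by
    rw [← Real.log_mul (by linarith) (by linarith)]
    exact_mod_cast congrArg (fun n : ℕ => Real.log n) h.cofac_mul.symm
  induction n with
  | zero =>
    simp only [node, Finset.range_zero, Finset.sum_empty]
    rw [div_le_iff₀ (by linarith)]
    norm_num
    linarith
  | succ n ih =>
    rw [Finset.sum_range_succ]
    split_ifs with hgap
    · linarith
    · have hnn : 0 ≤ ∑ i ∈ Finset.range n, (node i - node (i + 1)) *
          (if ((maxFac (cofac a) : ℝ) ^ (20 / (i + 1 : ℝ))) ^ (20 / (i + 1 : ℝ)) ≤ maxFac a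
            then (1 : ℝ) else 0) :=
        Finset.sum_nonneg fun i _ => mul_nonneg (sub_nonneg.2 (node_succ_le i))
          (by split_ifs <;> norm_num)
      have h1 : Real.log (maxFac a) <
          20 / (n + 1 : ℝ) * (20 / (n + 1 : ℝ) * Real.log (cofac a)) := by
        refine (Real.log_lt_log (by linarith) (not_le.1 hgap)).trans_le ?_
        rw [Real.log_rpow (by positivity), Real.log_rpow (by linarith)]
        gcongr
        exact_mod_cast Nat.le_of_dvd (zero_lt_one.trans h.one_lt_cofac) h.maxFac_cofac_dvd
      have h2 : Real.log (maxFac a) / Real.log a ≤ node (n + 1) := by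
        have hs : (0 : ℝ) < (n + 1 : ℝ) / 20 := by positivity
        have h3 : ((n + 1 : ℝ) / 20) ^ 2 * Real.log (maxFac a) ≤ Real.log (cofac a) := by
          calc _ ≤ ((n + 1 : ℝ) / 20) ^ 2 *
                (20 / (n + 1 : ℝ) * (20 / (n + 1 : ℝ) * Real.log (cofac a))) := by gcongr
            _ = _ := by field_simp
        rw [node, div_le_div_iff₀ (by linarith) (by positivity)]
        push_cast
        linarith
      simp only [mul_zero, add_zero]
      linarith

/-- Two-sided control of the Mertens product makes a prime Erdős strong. -/
theorem erdosStrong_of_mertensRatio {q : ℕ} (hq : q.Prime) {α β : ℝ} (hα0 : 0 < α) (hβ0 : 0 < β)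
    (hα : ∀ P, P.Prime → q ≤ P → mertensRatio q ≤ α * mertensRatio P)
    (hβ : ∀ x, x.Prime → q ≤ x → ∀ n, x ≤ n → mertensRatio n ≤ β * mertensRatio x)
    (hnum : α * (node 16 + β * ∑ i ∈ Finset.range 16,
      (node i - node (i + 1)) * ((i + 1) / 20)) ≤ 1) : ErdosStrong q := by
  classical
  intro A hA hmin
  have hlogq : 0 < Real.log q := Real.log_pos (by exact_mod_cast hq.one_lt)
  have hq0 : (0 : ℝ) < q := by exact_mod_cast hq.pos
  refine Real.tsum_le_of_sum_le (fun a => by positivity) fun u => ?_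
  set B : Finset ℕ := u.map (Function.Embedding.subtype _) with hB
  have hBA : (B : Set ℕ) ⊆ A := by
    intro a ha
    obtain ⟨b, _, rfl⟩ := Finset.mem_map.1 (Finset.mem_coe.1 ha)
    exact b.2
  have hBp : IsPrimitive (B : Set ℕ) :=
    ⟨fun a ha => hA.1 a (hBA ha), fun a ha b hb => hA.2 a (hBA ha) b (hBA hb)⟩
  have hsum : ∑ x ∈ u, 1 / (((x : ℕ) : ℝ) * Real.log (x : ℕ)) =
      ∑ a ∈ B, 1 / ((a : ℝ) * Real.log a) := by
    rw [hB, Finset.sum_map]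
    rfl
  rw [hsum]
  by_cases hqB : q ∈ B
  · have : B = {q} := by
      refine Finset.eq_singleton_iff_unique_mem.2 ⟨hqB, fun a ha => ?_⟩
      exact (eq_of_dvd_or_dvd hA (hBA hqB) (hBA ha)
        (Or.inl (hmin a (hBA ha) ▸ a.minFac_dvd))).symm
    rw [this, Finset.sum_singleton]
  have hc : ∀ a ∈ B, Composite q a := fun a ha =>
    ⟨hA.1 a (hBA ha), hmin a (hBA ha), by rintro rfl; exact hqB ha⟩
  have hF := sum_inv_log_le hq.ne_zero hBp hc hα hq.one_lt hα0
  have hFi : ∀ i ∈ Finset.range 16, ∑ a ∈ B, (if ((maxFac (cofac a) : ℝ) ^ (20 / (i + 1 : ℝ))) ^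
        (20 / (i + 1 : ℝ)) ≤ maxFac a then (1 : ℝ) else 0) *
        ((a : ℝ)⁻¹ * (Real.log (maxFac a))⁻¹) ≤
        α * β * ((i + 1) / 20) * (1 / (q * Real.log q)) := by
    intro i hi
    have hi' : (i + 1 : ℝ) < 20 := by
      have := Finset.mem_range.1 hi
      exact_mod_cast (by omega : i + 1 < 20)
    have h1 : (1 : ℝ) < 20 / (i + 1 : ℝ) := by
      rw [lt_div_iff₀ (by positivity)]
      linarith
    have := sum_gap_inv_log_le hq.ne_zero hBp hc hα hβ hq.one_lt hα0 hβ0 h1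
    rw [div_div_eq_mul_div, mul_div_assoc] at this
    simpa only [ite_mul, one_mul, zero_mul, Finset.sum_filter] using this
  calc ∑ a ∈ B, 1 / ((a : ℝ) * Real.log a)
      ≤ ∑ a ∈ B, (node 16 + ∑ i ∈ Finset.range 16, (node i - node (i + 1)) *
          (if ((maxFac (cofac a) : ℝ) ^ (20 / (i + 1 : ℝ))) ^
          (20 / (i + 1 : ℝ)) ≤ maxFac a then 1 else 0)) *
          ((a : ℝ)⁻¹ * (Real.log (maxFac a))⁻¹) := by
        refine Finset.sum_le_sum fun a ha => ?_
        have hP : 0 < Real.log (maxFac a) := Real.log_pos (by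
          exact_mod_cast (hc a ha).prime_maxFac.one_lt)
        have ha1 : (1 : ℝ) < a := by exact_mod_cast (hc a ha).one_lt
        have hla := Real.log_pos ha1
        calc 1 / ((a : ℝ) * Real.log a) = Real.log (maxFac a) / Real.log a *
              ((a : ℝ)⁻¹ * (Real.log (maxFac a))⁻¹) := by field_simp
          _ ≤ _ := by
            gcongr
            exact log_ratio_le (hc a ha) 16
    _ = node 16 * ∑ a ∈ B, (a : ℝ)⁻¹ * (Real.log (maxFac a))⁻¹ +
        ∑ i ∈ Finset.range 16, (node i - node (i + 1)) *
          ∑ a ∈ B, (if ((maxFac (cofac a) : ℝ) ^ (20 / (i + 1 : ℝ))) ^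
          (20 / (i + 1 : ℝ)) ≤ maxFac a then 1 else 0) *
          ((a : ℝ)⁻¹ * (Real.log (maxFac a))⁻¹) := by
        simp_rw [add_mul, Finset.sum_add_distrib, Finset.mul_sum, Finset.sum_mul]
        rw [Finset.sum_comm]
        simp_rw [mul_assoc]
    _ ≤ node 16 * (α * (1 / (q * Real.log q))) + ∑ i ∈ Finset.range 16,
        (node i - node (i + 1)) * (α * β * ((i + 1) / 20) * (1 / (q * Real.log q))) := by
        refine add_le_add (mul_le_mul_of_nonneg_left hF (node_nonneg _))
          (Finset.sum_le_sum fun i hi => ?_)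
        exact mul_le_mul_of_nonneg_left (hFi i hi) (sub_nonneg.2 (node_succ_le i))
    _ = α * (node 16 + β * ∑ i ∈ Finset.range 16, (node i - node (i + 1)) * ((i + 1) / 20)) *
        (1 / (q * Real.log q)) := by
        simp_rw [mul_add, add_mul, Finset.mul_sum, Finset.sum_mul]
        congr 1
        · ring
        · exact Finset.sum_congr rfl fun i _ => by ring
    _ ≤ 1 * (1 / (q * Real.log q)) := by gcongr
    _ = _ := one_mul _

lemma numeric_bound : (1.157 : ℝ) * (node 16 + 1.282 * ∑ i ∈ Finset.range 16,
      (node i - node (i + 1)) * ((i + 1) / 20)) ≤ 1 := by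
  simp only [node, Finset.sum_range_succ, Finset.sum_range_zero]
  norm_num

lemma mertensProd_succ (n : ℕ) :
    mertensProd (n + 1) = if n.Prime then mertensProd n * (1 - (n : ℝ)⁻¹) else mertensProd n := by
  unfold mertensProd
  rw [Nat.primesBelow_succ]
  split_ifs
  · rw [Finset.prod_insert (by simp [Nat.mem_primesBelow]), mul_comm]
  · rfl

lemma not_prime_of_even {n : ℕ} (hn : Even n) (h : 2 < n) : ¬ n.Prime := fun hp => by
  have := hp.even_iff.1 hn
  omega

lemma mertensProd_add_two {n : ℕ} (hn : Odd n) (h3 : 3 ≤ n) :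
    mertensProd (n + 2) = if n.Prime then mertensProd n * (1 - (n : ℝ)⁻¹) else mertensProd n := by
  rw [mertensProd_succ, if_neg (not_prime_of_even hn.add_one (by omega)), mertensProd_succ]

lemma mertensRatio_le_succ {n : ℕ} (hn : Even n) (h : 2 < n) :
    mertensRatio n ≤ mertensRatio (n + 1) := by
  unfold mertensRatio
  rw [mertensProd_succ, if_neg (not_prime_of_even hn h)]
  refine mul_le_mul_of_nonneg_right (Real.log_le_log ?_ ?_) (mertensProd_pos n).le
  · exact_mod_cast (by omega : 0 < n)
  · exact_mod_cast n.le_succ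

lemma mertensProd_three : mertensProd 3 = 1 / 2 := by
  have h0 : mertensProd 2 = 1 := by
    rw [mertensProd, show Nat.primesBelow 2 = ∅ by decide, Finset.prod_empty]
  rw [mertensProd_succ, if_pos Nat.prime_two, h0]
  norm_num

lemma two_mul_inv_add_le_log_div {m : ℝ} (hm : 1 < m) :
    2 * (3 * m ^ 2 + 1) / (3 * m ^ 3) ≤ Real.log ((m + 1) / (m - 1)) := by
  have h := Real.sum_range_le_log_div (x := m⁻¹) (by positivity) (inv_lt_one_of_one_lt₀ hm) 2
  have e : (1 + m⁻¹) / (1 - m⁻¹) = (m + 1) / (m - 1) := by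
    have : m - 1 ≠ 0 := by linarith
    field_simp
  rw [e] at h
  calc _ = 2 * ∑ i ∈ Finset.range 2, m⁻¹ ^ (2 * i + 1) / (2 * (i : ℝ) + 1) := by
        simp only [Finset.sum_range_succ, Finset.sum_range_zero]
        norm_num
        field_simp
    _ ≤ _ := by linarith

lemma log_div_le_two_mul_inv_add {m : ℝ} (hm : 1 < m) :
    Real.log ((m + 1) / (m - 1)) ≤
      2 * (3 * m ^ 2 * (m ^ 2 - 1) + m ^ 2 + 2) / (3 * m ^ 3 * (m ^ 2 - 1)) := by
  have h := Real.log_div_le_sum_range_add (x := m⁻¹) (by positivity)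
    (inv_lt_one_of_one_lt₀ hm) 2
  have h1 : m - 1 ≠ 0 := by linarith
  have h2 : m ^ 2 - 1 ≠ 0 := by nlinarith
  have e : (1 + m⁻¹) / (1 - m⁻¹) = (m + 1) / (m - 1) := by field_simp
  rw [e] at h
  calc _ ≤ 2 * (∑ i ∈ Finset.range 2, m⁻¹ ^ (2 * i + 1) / (2 * (i : ℝ) + 1) +
        m⁻¹ ^ (2 * 2 + 1) / (1 - m⁻¹ ^ 2)) := by linarith
    _ = _ := by
        simp only [Finset.sum_range_succ, Finset.sum_range_zero]
        norm_num
        field_simp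
        ring

/-- Data for the interval evaluation of `mertensRatio` along the odd numbers: the position `n`,
the product `K` of the small odd numbers below `n`, fixed-point bounds `l ≤ log n ≤ u` and
`w ≤ mertensProd n ≤ v`, and a flag recording that all bounds held so far. -/
structure State where
  n : ℕ
  K : ℕ
  l : ℕ
  u : ℕ
  w : ℕ
  v : ℕ
  ok : Bool

/-- Apply `k` after evaluating its numerical argument. -/
noncomputable def force {α : Sort*} (k : ℕ → α) (n : ℕ) : α :=
  Nat.rec (k 0) (fun m _ => k (m + 1)) n

/-- Apply `k` after evaluating its Boolean argument. -/
noncomputable def forceBool {α : Sort*} (k : Bool → α) (b : Bool) : α :=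
  Bool.rec (k false) (k true) b

lemma force_eq {α : Sort*} (k : ℕ → α) (n : ℕ) : force k n = k n := by cases n <;> rfl

lemma forceBool_eq {α : Sort*} (k : Bool → α) (b : Bool) : forceBool k b = k b := by
  cases b <;> rfl

/-- The bound `mertensRatio n ≤ 0.5615` in fixed-point form. -/
def upperOk (u v : ℕ) : Bool := Nat.ble (Nat.mul u v) 711785812028150808940398849818

/-- The bound `0.5187 ≤ mertensRatio n` in fixed-point form. -/
def lowerOk (l w : ℕ) : Bool := Nat.ble 657530366338382590556339952629 (Nat.mul l w)

/-- Advance from `n` to `n + 2`. -/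
noncomputable def step (s : State) : State :=
  State.rec (fun n K l u w v ok =>
    force (fun n' => force (fun K' => force (fun m => force (fun a => force (fun b =>
      force (fun l' => force (fun u' =>
      Bool.rec
        (forceBool (fun ok' => ⟨n', K', l', u', w, v, ok'⟩) (Bool.and ok (upperOk u v)))
        (force (fun w' => force (fun v' =>
          forceBool (fun ok' => ⟨n', K', l', u', w', v', ok'⟩)
            (Bool.and (Bool.and ok (upperOk u v)) (lowerOk l w)))
          (Nat.succ (Nat.div (Nat.mul v (Nat.pred n)) n))) (Nat.div (Nat.mul w (Nat.pred n)) n))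
        (Nat.beq (Nat.gcd n K) 1))
      (Nat.succ (Nat.add u (Nat.div (Nat.mul 2251799813685248
        (Nat.add (Nat.mul (Nat.mul 3 a) (Nat.pred a)) (Nat.add a 2))) (Nat.mul b (Nat.pred a))))))
      (Nat.add l (Nat.div (Nat.mul 2251799813685248 (Nat.succ (Nat.mul 3 a))) b)))
      (Nat.mul 3 (Nat.mul a m))) (Nat.mul m m)) (Nat.succ n))
      (Bool.rec K (Nat.mul K n) (Nat.ble n 181))) (Nat.succ (Nat.succ n))) s

/-- Iterate `step` a power of two times, evaluating the intermediate states. -/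
noncomputable def run (k : ℕ) : State → State :=
  Nat.rec step (fun _ r s => State.rec (fun n K l u w v ok => r ⟨n, K, l, u, w, v, ok⟩) (r s)) k

lemma run_succ (k : ℕ) (s : State) : run (k + 1) s = run k (run k s) := rfl

/-- The state at `n = 3`. -/
def start : State := ⟨3, 1, 1236927473278311, 1236927473616082, 562949953421312, 562949953421312, true⟩

/-- All recorded bounds hold, and the final ratio lies between `0.5612` and `0.5615`. -/
noncomputable def accept (s : State) : Bool :=
  State.rec (fun _ _ l u w v ok => Bool.and (Bool.and ok (upperOk u v)) (Nat.ble 711405516848082340119949838858 (Nat.mul l w))) s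

set_option maxRecDepth 100000 in
lemma accept_run : accept (run 14 start) = true := by decide +kernel

lemma step_mk (n K l u w v : ℕ) (ok : Bool) :
    step ⟨n, K, l, u, w, v, ok⟩ =
      if n.gcd K = 1 then
        ⟨n + 2, if n ≤ 181 then K * n else K,
          l + 2251799813685248 * (3 * ((n + 1) * (n + 1)) + 1) /
            (3 * ((n + 1) * (n + 1) * (n + 1))),
          u + 2251799813685248 * (3 * ((n + 1) * (n + 1)) * ((n + 1) * (n + 1) - 1) +
            ((n + 1) * (n + 1) + 2)) /
            (3 * ((n + 1) * (n + 1) * (n + 1)) * ((n + 1) * (n + 1) - 1)) + 1,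
          w * (n - 1) / n, v * (n - 1) / n + 1, ok && upperOk u v && lowerOk l w⟩
      else
        ⟨n + 2, if n ≤ 181 then K * n else K,
          l + 2251799813685248 * (3 * ((n + 1) * (n + 1)) + 1) /
            (3 * ((n + 1) * (n + 1) * (n + 1))),
          u + 2251799813685248 * (3 * ((n + 1) * (n + 1)) * ((n + 1) * (n + 1) - 1) +
            ((n + 1) * (n + 1) + 2)) /
            (3 * ((n + 1) * (n + 1) * (n + 1)) * ((n + 1) * (n + 1) - 1)) + 1,
          w, v, ok && upperOk u v⟩ := by
  have hrec : ∀ {β : Type} (x y : β) (b : Bool),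
      (Bool.rec x y b : β) = if b = true then y else x := by
    intro β x y b
    cases b <;> rfl
  simp only [step, force_eq, forceBool_eq, hrec, Nat.beq_eq, Nat.ble_eq]
  rfl

lemma cast_div_bounds (a b : ℕ) :
    ((a / b : ℕ) : ℝ) ≤ (a : ℝ) / b ∧ (a : ℝ) / b ≤ ((a / b : ℕ) : ℝ) + 1 :=
  ⟨Nat.cast_div_le, by
    rw [← Nat.floor_div_eq_div (K := ℝ)]
    exact (Nat.lt_floor_add_one _).le⟩

/-- The bounds carried by a state are correct. -/
structure Sound (s : State) : Prop where
  odd : Odd s.n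
  three_le : 3 ≤ s.n
  K_ne : s.K ≠ 0
  dvd_K : ∀ p, p.Prime → 3 ≤ p → p < s.n → p ≤ 181 → p ∣ s.K
  lt_of_dvd : ∀ p, p.Prime → p ∣ s.K → p < s.n
  le_log : (s.l : ℝ) ≤ 2 ^ 50 * Real.log s.n
  log_le : 2 ^ 50 * Real.log s.n ≤ s.u
  le_prod : (s.w : ℝ) ≤ 2 ^ 50 * mertensProd s.n
  prod_le : 2 ^ 50 * mertensProd s.n ≤ s.v
  upper : s.ok = true → ∀ m, 3 ≤ m → m + 1 < s.n → mertensRatio m ≤ 0.5615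
  lower : s.ok = true → ∀ p, p.Prime → 3 ≤ p → p < s.n → 0.5187 ≤ mertensRatio p

namespace Sound

lemma prime_iff {s : State} (h : Sound s) (hn : s.n < 33489) :
    s.n.gcd s.K = 1 ↔ s.n.Prime := by
  have h3 := h.three_le
  constructor
  · intro hg
    by_contra hp
    have hmp := Nat.minFac_prime (n := s.n) (by omega)
    have hsq := Nat.minFac_sq_le_self (by omega) hp
    have h2 : s.n.minFac ≠ 2 := fun h2 => by
      have hodd := h.odd
      have hd := Nat.minFac_dvd s.n
      rw [h2] at hd
      exact Nat.not_even_iff_odd.2 hodd (even_iff_two_dvd.2 hd)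
    have hlt : s.n.minFac < 183 := by nlinarith
    have h182 : s.n.minFac ≠ 182 := fun h182 => by
      rw [h182] at hmp
      norm_num at hmp
    have hlt' : s.n.minFac < s.n := by nlinarith [hmp.two_le]
    have hd := h.dvd_K _ hmp (by have := hmp.two_le; omega) hlt' (by omega)
    have := Nat.dvd_gcd (Nat.minFac_dvd s.n) hd
    rw [hg] at this
    exact hmp.one_lt.ne' (Nat.dvd_one.1 this)
  · intro hp
    refine (Nat.coprime_or_dvd_of_prime hp s.K).resolve_right fun hd => ?_
    exact lt_irrefl _ (h.lt_of_dvd _ hp hd)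

lemma upperOk_spec {s : State} (h : Sound s) (hok : upperOk s.u s.v = true) :
    mertensRatio s.n ≤ 0.5615 := by
  have h1 : ((s.u * s.v : ℕ) : ℝ) ≤ 711785812028150808940398849818 := by
    exact_mod_cast Nat.le_of_ble_eq_true hok
  have hlog : 0 ≤ Real.log s.n := Real.log_natCast_nonneg _
  have h2 := mul_le_mul h.log_le h.prod_le (mul_nonneg (by positivity) (mertensProd_pos _).le)
    (by positivity)
  push_cast at h1
  rw [mertensRatio]
  nlinarith

lemma le_mul_of_ble {s : State} (h : Sound s) {b : ℕ} (hok : Nat.ble b (Nat.mul s.l s.w) = true) :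
    (b : ℝ) ≤ 2 ^ 100 * mertensRatio s.n := by
  have h1 : (b : ℝ) ≤ ((s.l * s.w : ℕ) : ℝ) := by
    exact_mod_cast Nat.le_of_ble_eq_true hok
  have hlog : 0 ≤ Real.log s.n := Real.log_natCast_nonneg _
  have h2 := mul_le_mul h.le_log h.le_prod (by positivity) (by positivity)
  push_cast at h1
  rw [mertensRatio]
  linarith

lemma lowerOk_spec {s : State} (h : Sound s) (hok : lowerOk s.l s.w = true) :
    0.5187 ≤ mertensRatio s.n := by
  have := h.le_mul_of_ble hok
  norm_num at this ⊢
  linarith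

lemma upper_step {s : State} (h : Sound s) (hok : s.ok = true) (hu : upperOk s.u s.v = true)
    {m : ℕ} (hm : 3 ≤ m) (hmn : m + 1 < s.n + 2) : mertensRatio m ≤ 0.5615 := by
  have hn := h.upperOk_spec hu
  rcases lt_or_ge (m + 1) s.n with hlt | hge
  · exact h.upper hok m hm hlt
  · rcases hge.eq_or_lt with heq | hgt
    · rw [heq] at hn
      refine (mertensRatio_le_succ ?_ (by omega)).trans hn
      have := heq ▸ h.odd
      simpa [Nat.odd_add_one, parity_simps] using this
    · rwa [show m = s.n by omega]

lemma step {s : State} (h : Sound s) (hn : s.n < 33489) :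
    Sound (step s) ∧ (ErdosPrimitive.step s).n = s.n + 2 := by
  have hprime := h.prime_iff hn
  have hup := @upper_step _ h
  have hlow := h.lowerOk_spec
  have h3 := h.three_le
  obtain ⟨n, K, l, u, w, v, ok⟩ := s
  simp only at hprime hup hn hlow h3
  have hn0 : (0 : ℝ) < n := by exact_mod_cast (by omega : 0 < n)
  have hm : (1 : ℝ) < (n : ℝ) + 1 := by linarith
  have hsplit : Real.log ((n + 2 : ℕ) : ℝ) =
      Real.log n + Real.log (((n : ℝ) + 1 + 1) / ((n : ℝ) + 1 - 1)) := by
    rw [← Real.log_mul hn0.ne' (by positivity)]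
    congr 1
    rw [add_sub_cancel_right, mul_div_cancel₀ _ hn0.ne']
    push_cast
    ring
  have hlogl := two_mul_inv_add_le_log_div hm
  have hlogu := log_div_le_two_mul_inv_add hm
  have hl : ((l + 2251799813685248 * (3 * ((n + 1) * (n + 1)) + 1) /
      (3 * ((n + 1) * (n + 1) * (n + 1))) : ℕ) : ℝ) ≤ 2 ^ 50 * Real.log ((n + 2 : ℕ) : ℝ) := by
    have h1 := (cast_div_bounds (2251799813685248 * (3 * ((n + 1) * (n + 1)) + 1))
      (3 * ((n + 1) * (n + 1) * (n + 1)))).1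
    have h2 := h.le_log
    have h4 : (((2251799813685248 * (3 * ((n + 1) * (n + 1)) + 1) : ℕ) : ℝ) /
        ((3 * ((n + 1) * (n + 1) * (n + 1)) : ℕ) : ℝ)) =
        2 ^ 50 * (2 * (3 * ((n : ℝ) + 1) ^ 2 + 1) / (3 * ((n : ℝ) + 1) ^ 3)) := by
      push_cast
      ring
    rw [h4] at h1
    rw [Nat.cast_add, hsplit]
    simp only at h2
    linarith
  have hu : 2 ^ 50 * Real.log ((n + 2 : ℕ) : ℝ) ≤
      ((u + 2251799813685248 * (3 * ((n + 1) * (n + 1)) * ((n + 1) * (n + 1) - 1) +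
            ((n + 1) * (n + 1) + 2)) /
            (3 * ((n + 1) * (n + 1) * (n + 1)) * ((n + 1) * (n + 1) - 1)) + 1 : ℕ) : ℝ) := by
    have h1 := (cast_div_bounds (2251799813685248 * (3 * ((n + 1) * (n + 1)) *
      ((n + 1) * (n + 1) - 1) + ((n + 1) * (n + 1) + 2)))
      (3 * ((n + 1) * (n + 1) * (n + 1)) * ((n + 1) * (n + 1) - 1))).2
    have h2 := h.log_le
    have h4 : (((2251799813685248 * (3 * ((n + 1) * (n + 1)) *
      ((n + 1) * (n + 1) - 1) + ((n + 1) * (n + 1) + 2)) : ℕ) : ℝ) /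
        ((3 * ((n + 1) * (n + 1) * (n + 1)) * ((n + 1) * (n + 1) - 1) : ℕ) : ℝ)) =
        2 ^ 50 * (2 * (3 * ((n : ℝ) + 1) ^ 2 * (((n : ℝ) + 1) ^ 2 - 1) + ((n : ℝ) + 1) ^ 2 + 2) /
          (3 * ((n : ℝ) + 1) ^ 3 * (((n : ℝ) + 1) ^ 2 - 1))) := by
      push_cast [Nat.cast_sub (show 1 ≤ (n + 1) * (n + 1) by nlinarith)]
      ring
    rw [h4] at h1
    rw [hsplit, Nat.cast_add, Nat.cast_add, Nat.cast_one]
    simp only at h2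
    linarith
  have hK0 : (if n ≤ 181 then K * n else K) ≠ 0 := by
    split_ifs
    · exact mul_ne_zero h.K_ne (by omega)
    · exact h.K_ne
  have hodd2 : Odd (n + 2) := h.odd.add_even even_two
  have hlt : ∀ p, p.Prime → p < n + 2 → p < n ∨ p = n := fun p hp hpn => by
    by_contra hcon
    exact not_prime_of_even (n := n + 1) h.odd.add_one (by omega)
      ((show p = n + 1 by omega) ▸ hp)
  have hdK : ∀ p, p.Prime → 3 ≤ p → p < n + 2 → p ≤ 181 →
      p ∣ (if n ≤ 181 then K * n else K) := by
    intro p hp hp3 hpn hp181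
    rcases hlt p hp hpn with h1 | h1
    · have := h.dvd_K p hp hp3 h1 hp181
      split_ifs
      · exact this.mul_right n
      · exact this
    · rw [if_pos (by omega), h1]
      exact dvd_mul_left _ _
  have hltK : ∀ p, p.Prime → p ∣ (if n ≤ 181 then K * n else K) → p < n + 2 := by
    intro p hp hpK
    split_ifs at hpK
    · rcases hp.dvd_mul.1 hpK with h1 | h1
      · exact (h.lt_of_dvd p hp h1).trans (by simp)
      · have := Nat.le_of_dvd (by omega) h1
        omega
    · exact (h.lt_of_dvd p hp hpK).trans (by simp)
  have hlw := h.le_prod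
  have hpv := h.prod_le
  simp only at hlw hpv
  have hprod := mertensProd_add_two h.odd h.three_le
  simp only at hprod
  rw [step_mk]
  by_cases hg : n.gcd K = 1
  · rw [if_pos hg]
    have hp := hprime.1 hg
    rw [if_pos hp] at hprod
    have hcast : ((n - 1 : ℕ) : ℝ) = n - 1 := by push_cast [Nat.cast_sub (show 1 ≤ n by omega)]; rfl
    have hn1 : (0 : ℝ) ≤ 1 - (n : ℝ)⁻¹ := (one_sub_inv_pos hp).le
    refine ⟨⟨hodd2, by simp only; omega, hK0, hdK, hltK, hl, hu, ?_, ?_, ?_, ?_⟩, rfl⟩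
    · have h1 := (cast_div_bounds (w * (n - 1)) n).1
      have h2 := mul_le_mul_of_nonneg_right hlw hn1
      push_cast [hcast] at h1
      simp only
      rw [hprod]
      refine h1.trans (le_trans (le_of_eq ?_) (h2.trans_eq (by ring)))
      field_simp
    · have h1 := (cast_div_bounds (v * (n - 1)) n).2
      have h2 := mul_le_mul_of_nonneg_right hpv hn1
      push_cast [hcast] at h1
      simp only
      rw [hprod]
      push_cast
      refine le_trans ((by ring : _ = _).trans_le h2) (le_trans (le_of_eq ?_) h1)
      field_simp
    · intro hok m hm3 hmn
      simp only [Bool.and_eq_true] at hok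
      exact hup hok.1.1 hok.1.2 hm3 hmn
    · intro hok p hp' hp3 hpn
      simp only [Bool.and_eq_true] at hok
      rcases hlt p hp' hpn with h1 | rfl
      · exact h.lower hok.1.1 p hp' hp3 h1
      · exact hlow hok.2
  · rw [if_neg hg]
    have hp := mt hprime.2 hg
    rw [if_neg hp] at hprod
    refine ⟨⟨hodd2, by simp only; omega, hK0, hdK, hltK, hl, hu, ?_, ?_, ?_, ?_⟩, rfl⟩
    · simp only
      rwa [hprod]
    · simp only
      rwa [hprod]
    · intro hok m hm3 hmn
      simp only [Bool.and_eq_true] at hok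
      exact hup hok.1 hok.2 hm3 hmn
    · intro hok p hp' hp3 hpn
      simp only [Bool.and_eq_true] at hok
      rcases hlt p hp' hpn with h1 | rfl
      · exact h.lower hok.1 p hp' hp3 h1
      · exact absurd hp' hp

lemma run {s : State} (h : Sound s) (k : ℕ) (hn : s.n + 2 ^ (k + 1) < 33491) :
    Sound (run k s) ∧ (ErdosPrimitive.run k s).n = s.n + 2 ^ (k + 1) := by
  induction k generalizing s with
  | zero => exact h.step (by omega)
  | succ k ih =>
    have h2 : 2 ^ (k + 1 + 1) = 2 ^ (k + 1) + 2 ^ (k + 1) := by ring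
    have hpos : 0 < 2 ^ (k + 1) := by positivity
    obtain ⟨h3, h4⟩ := ih h (by omega)
    obtain ⟨h5, h6⟩ := ih h3 (by omega)
    exact ⟨h5, by rw [run_succ, h6, h4]; omega⟩

end Sound

lemma sound_start : Sound start where
  odd := by decide
  three_le := le_rfl
  K_ne := one_ne_zero
  dvd_K p _ h3 hp := absurd hp (not_lt.2 h3)
  lt_of_dvd p hp h := absurd (Nat.dvd_one.1 h) hp.one_lt.ne'
  le_log := by
    have := Real.log_three_gt_d9
    simp only [start]
    norm_num at this ⊢
    linarith
  log_le := by
    have := Real.log_three_lt_d9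
    simp only [start]
    norm_num at this ⊢
    linarith
  le_prod := by
    simp only [start, mertensProd_three]
    norm_num
  prod_le := by
    simp only [start, mertensProd_three]
    norm_num
  upper _ m h3 hm := by simp only [start] at hm; omega
  lower _ p _ h3 hp := absurd hp (not_lt.2 h3)

lemma Sound.bounds_of_accept {s : State} (h : Sound s) (hacc : accept s = true) :
    (∀ m, 3 ≤ m → m ≤ s.n → mertensRatio m ≤ 0.5615) ∧
    (∀ p, p.Prime → 3 ≤ p → p < s.n → 0.5187 ≤ mertensRatio p) ∧
    0.5612 ≤ mertensRatio s.n := by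
  have hacc' : ((s.ok && upperOk s.u s.v) && Nat.ble 711405516848082340119949838858
    (Nat.mul s.l s.w)) = true := hacc
  simp only [Bool.and_eq_true] at hacc'
  refine ⟨fun m h3 hm => h.upper_step hacc'.1.1 hacc'.1.2 h3 (by omega),
    fun p hp h3 hlt => h.lower hacc'.1.1 p hp h3 (by omega), ?_⟩
  have := h.le_mul_of_ble hacc'.2
  norm_num at this ⊢
  linarith

/-- Numerical bounds for `mertensRatio` up to `32771`. -/
lemma mertensRatio_small :
    (∀ m, 3 ≤ m → m ≤ 32771 → mertensRatio m ≤ 0.5615) ∧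
    (∀ p, p.Prime → 3 ≤ p → p < 32771 → 0.5187 ≤ mertensRatio p) ∧
    0.5612 ≤ mertensRatio 32771 := by
  obtain ⟨hs, hn⟩ := sound_start.run 14 (by rw [show start.n = 3 from rfl]; norm_num)
  have h := hs.bounds_of_accept accept_run
  rw [hn, show start.n = 3 from rfl] at h
  norm_num at h ⊢
  exact h

open Finset
open scoped ArithmeticFunction.vonMangoldt

/-- The partial sums of `Λ n / n`. -/
noncomputable def vmSum (N : ℕ) : ℝ := ∑ n ∈ Ioc 0 N, Λ n / n

lemma vmSum_succ (N : ℕ) : vmSum (N + 1) = vmSum N + Λ (N + 1) / (N + 1 : ℕ) := by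
  rw [vmSum, Finset.sum_Ioc_succ_top (Nat.zero_le N), ← vmSum]

lemma log_factorial_eq_sum (N : ℕ) :
    Real.log N.factorial = ∑ n ∈ Ioc 0 N, Λ n * ((N / n : ℕ) : ℝ) := by
  rw [← ArithmeticFunction.sum_Ioc_mul_zeta_eq_sum, ArithmeticFunction.vonMangoldt_mul_zeta]
  induction N with
  | zero => simp
  | succ N ih =>
    rw [Finset.sum_Ioc_succ_top (Nat.zero_le N), ← ih, Nat.factorial_succ, Nat.cast_mul,
      Real.log_mul (by positivity) (by positivity), ArithmeticFunction.log_apply, add_comm]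

lemma log_factorial_ge {N : ℕ} (hN : N ≠ 0) : N * Real.log N - N ≤ Real.log N.factorial := by
  have h := Stirling.le_log_factorial_stirling hN
  have h1 : 0 ≤ Real.log N := Real.log_natCast_nonneg N
  have h2 : 0 ≤ Real.log (2 * Real.pi) := Real.log_nonneg (by linarith [Real.pi_gt_three])
  linarith

lemma one_div_succ_le_log_sub {N : ℕ} (hN : N ≠ 0) :
    1 / (N + 1 : ℝ) ≤ Real.log (N + 1) - Real.log N := by
  have hN0 : (0 : ℝ) < N := by exact_mod_cast Nat.pos_of_ne_zero hN
  rw [← Real.log_div (by positivity) hN0.ne']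
  refine le_trans (le_of_eq ?_) (Real.one_sub_inv_le_log_of_pos (by positivity))
  field_simp
  ring

lemma log_sub_le_one_div {N : ℕ} (hN : N ≠ 0) :
    Real.log (N + 1) - Real.log N ≤ 1 / (N : ℝ) := by
  have hN0 : (0 : ℝ) < N := by exact_mod_cast Nat.pos_of_ne_zero hN
  rw [← Real.log_div (by positivity) hN0.ne']
  refine (Real.log_le_sub_one_of_pos (by positivity)).trans (le_of_eq ?_)
  field_simp
  ring

lemma log_factorial_le {N : ℕ} (hN : N ≠ 0) :
    Real.log N.factorial ≤ N * Real.log N - N + Real.log N + 1 := by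
  induction N with
  | zero => exact absurd rfl hN
  | succ N ih =>
    rcases eq_or_ne N 0 with rfl | h0
    · simp
    have h1 := one_div_succ_le_log_sub h0
    rw [div_le_iff₀ (by positivity)] at h1
    rw [Nat.factorial_succ, Nat.cast_mul, Real.log_mul (by positivity) (by positivity)]
    push_cast
    linarith [ih h0]

lemma log_sub_one_le_vmSum {N : ℕ} (hN : N ≠ 0) : Real.log N - 1 ≤ vmSum N := by
  have hN0 : (0 : ℝ) < N := by exact_mod_cast Nat.pos_of_ne_zero hN
  refine le_of_mul_le_mul_left ?_ hN0
  calc N * (Real.log N - 1) = N * Real.log N - N := by ring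
    _ ≤ _ := log_factorial_ge hN
    _ ≤ _ := by
      rw [log_factorial_eq_sum, vmSum, Finset.mul_sum]
      refine Finset.sum_le_sum fun n _ => ?_
      calc Λ n * ((N / n : ℕ) : ℝ) ≤ Λ n * ((N : ℝ) / n) :=
            mul_le_mul_of_nonneg_left Nat.cast_div_le ArithmeticFunction.vonMangoldt_nonneg
        _ = _ := by ring

lemma mul_vmSum_le {N : ℕ} (hN : N ≠ 0) :
    N * vmSum N ≤ N * Real.log N - N + Real.log N + 1 +
      (Real.log 4 * N + 2 * √N * Real.log N) := by
  have hpsi := Chebyshev.psi_le (x := N) (by exact_mod_cast Nat.one_le_iff_ne_zero.2 hN)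
  have hfac := log_factorial_le hN
  have hpsi_eq : Chebyshev.psi N = ∑ n ∈ Ioc 0 N, Λ n := by
    rw [Chebyshev.psi, Nat.floor_natCast]
  calc (N : ℝ) * vmSum N ≤ ∑ n ∈ Ioc 0 N, (Λ n * ((N / n : ℕ) : ℝ) + Λ n) := by
        rw [vmSum, Finset.mul_sum]
        refine Finset.sum_le_sum fun n _ => ?_
        calc (N : ℝ) * (Λ n / n) = Λ n * ((N : ℝ) / n) := by ring
          _ ≤ Λ n * (((N / n : ℕ) : ℝ) + 1) :=
            mul_le_mul_of_nonneg_left (cast_div_bounds N n).2 ArithmeticFunction.vonMangoldt_nonneg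
          _ = _ := by ring
    _ = Real.log N.factorial + Chebyshev.psi N := by
        rw [Finset.sum_add_distrib, ← log_factorial_eq_sum, hpsi_eq]
    _ ≤ _ := by linarith

lemma log_two_pow_fifteen : Real.log 32768 = 15 * Real.log 2 := by
  rw [show (32768 : ℝ) = 2 ^ 15 by norm_num, Real.log_pow]
  norm_num

lemma vmSum_le {N : ℕ} (hN : 32768 ≤ N) : vmSum N ≤ Real.log N + 0.5016 := by
  have hNr : (32768 : ℝ) ≤ N := by exact_mod_cast hN
  have hN0 : (0 : ℝ) < N := by linarith
  have hl2 := Real.log_two_lt_d9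
  have he : Real.exp 2 ≤ 32768 := by
    have := Real.exp_one_lt_d9
    rw [show (2 : ℝ) = 1 + 1 by norm_num, Real.exp_add]
    nlinarith [Real.exp_pos 1]
  have hsq : (181.019 : ℝ) ≤ √32768 := Real.le_sqrt_of_sq_le (by norm_num)
  have hsqN : (181.019 : ℝ) ≤ √N := hsq.trans (Real.sqrt_le_sqrt hNr)
  have hratio : Real.log N / √N ≤ 0.05744 := by
    refine (Real.log_div_sqrt_antitoneOn he (he.trans hNr) hNr).trans ?_
    simp only
    rw [div_le_iff₀ (by linarith), log_two_pow_fifteen]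
    linarith
  rw [div_le_iff₀ (by linarith)] at hratio
  have hss : √(N : ℝ) * √N = N := Real.mul_self_sqrt hN0.le
  have hlog4 : Real.log 4 = 2 * Real.log 2 := by
    rw [show (4 : ℝ) = 2 ^ 2 by norm_num, Real.log_pow]
    norm_num
  have hmain := mul_vmSum_le (N := N) (by omega)
  have h1 : √(N : ℝ) * Real.log N ≤ 0.05744 * N := by nlinarith
  have h2 : 181.019 * √(N : ℝ) ≤ N := by nlinarith
  have h3 : Real.log 4 * N ≤ 1.3862944 * N := by
    rw [hlog4]
    gcongr
    linarith
  refine le_of_mul_le_mul_left (hmain.trans ?_) hN0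
  generalize Real.log (N : ℝ) = l at *
  generalize √(N : ℝ) = r at *
  generalize (N : ℝ) = x at *
  have h4 : l ≤ 0.00032 * x := by linarith
  linarith

/-- The sum of `Λ n / (n log n)` over `Q ≤ n < R`. -/
noncomputable def vmLogSum (Q R : ℕ) : ℝ := ∑ n ∈ Ico Q R, Λ n / (n * Real.log n)

lemma vmLogSum_self (Q : ℕ) : vmLogSum Q Q = 0 := by simp [vmLogSum]

lemma vmLogSum_succ {Q R : ℕ} (h : Q ≤ R) :
    vmLogSum Q (R + 1) = vmLogSum Q R + Λ R / (R * Real.log R) := by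
  rw [vmLogSum, Finset.sum_Ico_succ_top h, ← vmLogSum]

lemma vmLogSum_succ' {Q R : ℕ} (h : Q ≤ R) (hQ : 1 ≤ Q) :
    vmLogSum Q (R + 1) = vmLogSum Q R + (vmSum R - vmSum (R - 1)) / Real.log R := by
  obtain ⟨k, rfl⟩ := Nat.exists_eq_add_of_le' (hQ.trans h)
  rw [vmLogSum_succ h, vmSum_succ]
  simp only [add_tsub_cancel_right, add_sub_cancel_left]
  rw [div_div]

lemma one_sub_div_le_log_sub {a b : ℝ} (ha : 0 < a) (hb : 0 < b) :
    1 - a / b ≤ Real.log b - Real.log a := by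
  rw [← Real.log_div hb.ne' ha.ne']
  simpa using Real.one_sub_inv_le_log_of_pos (div_pos hb ha)

lemma vmLogSum_le {Q R : ℕ} (hQ : 2 ≤ Q) (hQR : Q ≤ R) {e₁ e₂ : ℝ}
    (h₁ : Real.log (Q - 1 : ℕ) + e₁ ≤ vmSum (Q - 1))
    (h₂ : ∀ N, Q - 1 ≤ N → vmSum N ≤ Real.log N + e₂) :
    vmLogSum Q R ≤ Real.log (Real.log R) - Real.log (Real.log Q) +
      (e₂ - e₁ + (Real.log Q - Real.log (Q - 1 : ℕ))) / Real.log Q := by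
  have hlog : ∀ {n : ℕ}, Q ≤ n → 0 < Real.log n := fun hn =>
    Real.log_pos (by exact_mod_cast (by omega : 1 < _))
  have key : vmLogSum Q R ≤ vmSum (R - 1) / Real.log R + Real.log (Real.log R) -
      Real.log (Real.log Q) + e₂ * (1 / Real.log Q - 1 / Real.log R) -
      vmSum (Q - 1) / Real.log Q := by
    induction R, hQR using Nat.le_induction with
    | base =>
      rw [vmLogSum_self]
      ring_nf
      rfl
    | succ R hR ih =>
      rw [vmLogSum_succ' hR (by omega), add_tsub_cancel_right]
      have ha := hlog hR
      have hb := hlog (Nat.le_succ_of_le hR)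
      have h4 := h₂ R (by omega)
      have hmono : 1 / Real.log (R + 1 : ℕ) ≤ 1 / Real.log R :=
        one_div_le_one_div_of_le ha (Real.log_le_log (by exact_mod_cast (by omega : 0 < R))
          (by exact_mod_cast R.le_succ))
      have h5 := one_sub_div_le_log_sub ha hb
      have h6 := mul_le_mul_of_nonneg_right (sub_le_iff_le_add.2 h4) (sub_nonneg.2 hmono)
      have h7 : Real.log R * (1 / Real.log R - 1 / Real.log (R + 1 : ℕ)) =
          1 - Real.log R / Real.log (R + 1 : ℕ) := by field_simp
      rw [h7] at h6
      have h8 := h6.trans h5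
      simp only [div_eq_mul_inv, one_mul] at ih h8 ⊢
      linarith
  have hlR := hlog hQR
  have hlQ := hlog le_rfl
  have h3 : vmSum (R - 1) / Real.log R ≤ 1 + e₂ / Real.log R := by
    rw [div_le_iff₀ hlR, add_mul, one_mul, div_mul_cancel₀ _ hlR.ne']
    refine (h₂ (R - 1) (by omega)).trans (add_le_add_left (Real.log_le_log ?_ ?_) _)
    · exact_mod_cast (by omega : 0 < R - 1)
    · exact_mod_cast Nat.sub_le R 1
  have h4 : (Real.log (Q - 1 : ℕ) + e₁) / Real.log Q ≤ vmSum (Q - 1) / Real.log Q := by gcongr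
  have h5 : (e₂ - e₁ + (Real.log Q - Real.log (Q - 1 : ℕ))) / Real.log Q =
      e₂ / Real.log Q + 1 - (Real.log (Q - 1 : ℕ) + e₁) / Real.log Q := by
    field_simp
    ring
  rw [h5]
  simp only [mul_sub, mul_one_div] at key
  linarith

lemma le_vmLogSum {Q R : ℕ} (hQ : 2 ≤ Q) (hQR : Q ≤ R) {e₁ e₂ : ℝ}
    (h₁ : ∀ N, Q - 1 ≤ N → Real.log N + e₁ ≤ vmSum N)
    (h₂ : vmSum (Q - 1) ≤ Real.log (Q - 1 : ℕ) + e₂) (h₁₂ : e₁ ≤ e₂) :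
    Real.log (Real.log R) - Real.log (Real.log Q) -
      (e₂ - e₁ + 1 / Q) / Real.log Q ≤ vmLogSum Q R := by
  have hlog : ∀ {n : ℕ}, Q ≤ n → 0 < Real.log n := fun hn =>
    Real.log_pos (by exact_mod_cast (by omega : 1 < _))
  have hlQ := hlog le_rfl
  have hQ0 : (0 : ℝ) < Q := by exact_mod_cast (by omega : 0 < Q)
  have hsucc : ∀ {n : ℕ}, Q ≤ n → Real.log (n + 1 : ℕ) - Real.log n ≤ 1 / Q := fun {n} hn => by
    have h := log_sub_le_one_div (N := n) (by omega)
    push_cast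
    refine h.trans (one_div_le_one_div_of_le hQ0 (by exact_mod_cast hn))
  rcases hQR.eq_or_lt with rfl | hlt
  · rw [vmLogSum_self, sub_self, zero_sub, neg_nonpos]
    exact div_nonneg (add_nonneg (sub_nonneg.2 h₁₂) (by positivity)) hlQ.le
  have key : vmSum (R - 1) / Real.log R + Real.log (Real.log R) -
      Real.log (Real.log Q) + (e₁ - 1 / Q) * (1 / Real.log Q - 1 / Real.log R) -
      vmSum (Q - 1) / Real.log Q ≤ vmLogSum Q R := by
    clear hlt
    induction R, hQR using Nat.le_induction with
    | base =>
      rw [vmLogSum_self]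
      ring_nf
      rfl
    | succ R hR ih =>
      rw [vmLogSum_succ' hR (by omega), add_tsub_cancel_right]
      have ha := hlog hR
      have hb := hlog (Nat.le_succ_of_le hR)
      have h4 := h₁ R (by omega)
      have h4' := hsucc hR
      have hmono : 1 / Real.log (R + 1 : ℕ) ≤ 1 / Real.log R :=
        one_div_le_one_div_of_le ha (Real.log_le_log (by exact_mod_cast (by omega : 0 < R))
          (by exact_mod_cast R.le_succ))
      have h5 := one_sub_div_le_log_sub hb ha
      have h6 := mul_le_mul_of_nonneg_right
        (show Real.log (R + 1 : ℕ) ≤ vmSum R - (e₁ - 1 / Q) by linarith) (sub_nonneg.2 hmono)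
      have h7 : Real.log (R + 1 : ℕ) * (1 / Real.log R - 1 / Real.log (R + 1 : ℕ)) =
          Real.log (R + 1 : ℕ) / Real.log R - 1 := by field_simp
      rw [h7] at h6
      generalize e₁ - 1 / (Q : ℝ) = e at *
      have h8 : Real.log (Real.log (R + 1 : ℕ)) - Real.log (Real.log R) ≤
        (vmSum R - e) * (1 / Real.log R - 1 / Real.log (R + 1 : ℕ)) := by linarith
      simp only [div_eq_mul_inv, one_mul] at ih h8 ⊢
      linarith
  have hlR := hlog hQR
  have h3 : 1 + (e₁ - 1 / Q) / Real.log R ≤ vmSum (R - 1) / Real.log R := by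
    rw [le_div_iff₀ hlR, add_mul, one_mul, div_mul_cancel₀ _ hlR.ne']
    have h4 := h₁ (R - 1) (by omega)
    have h5 := hsucc (n := R - 1) (by omega)
    rw [Nat.sub_add_cancel (by omega)] at h5
    linarith
  have hlog1 : Real.log (Q - 1 : ℕ) ≤ Real.log Q := Real.log_le_log
    (by exact_mod_cast (by omega : 0 < Q - 1)) (by exact_mod_cast Nat.sub_le Q 1)
  have h4 : vmSum (Q - 1) / Real.log Q ≤ (Real.log Q + e₂) / Real.log Q := by
    gcongr
    linarith
  have h5 : (e₂ - e₁ + 1 / Q) / Real.log Q =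
      (Real.log Q + e₂) / Real.log Q - 1 - (e₁ - 1 / Q) / Real.log Q := by
    field_simp
    ring
  rw [h5]
  simp only [mul_sub, mul_one_div] at key
  linarith

/-- The part of `vmLogSum` coming from proper prime powers. -/
noncomputable def powSum (Q R : ℕ) : ℝ :=
  ∑ n ∈ Ico Q R, (if n.Prime then 0 else Λ n) / (n * Real.log n)

lemma powSum_succ {Q R : ℕ} (h : Q ≤ R) :
    powSum Q (R + 1) = powSum Q R + (if R.Prime then 0 else Λ R) / (R * Real.log R) := by
  rw [powSum, Finset.sum_Ico_succ_top h, ← powSum]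

/-- The summatory function of `Λ` over non-primes. -/
noncomputable def powPsi (N : ℕ) : ℝ := ∑ n ∈ Ioc 0 N, if n.Prime then 0 else Λ n

lemma powPsi_nonneg (N : ℕ) : 0 ≤ powPsi N := Finset.sum_nonneg fun n _ => by
  split_ifs
  · rfl
  · exact ArithmeticFunction.vonMangoldt_nonneg

lemma powPsi_le {N : ℕ} (hN : 1 ≤ N) : powPsi N ≤ 2 * √N * Real.log N := by
  refine le_trans (le_of_eq ?_) (Chebyshev.psi_sub_theta_le (x := N) (by exact_mod_cast hN))
  rw [Chebyshev.psi_sub_theta_eq_sum_not_prime, Nat.floor_natCast, Finset.sum_filter, powPsi]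
  simp only [ite_not]

lemma powPsi_succ (N : ℕ) :
    powPsi (N + 1) = powPsi N + if (N + 1).Prime then 0 else Λ (N + 1) := by
  rw [powPsi, Finset.sum_Ioc_succ_top (Nat.zero_le N), ← powPsi]

lemma powPsi_le_succ (N : ℕ) : powPsi N ≤ powPsi (N + 1) := by
  rw [powPsi_succ, le_add_iff_nonneg_right]
  split_ifs
  · rfl
  · exact ArithmeticFunction.vonMangoldt_nonneg

lemma inv_mul_log_sub_le {n : ℕ} {c : ℝ} (hn : 2 ≤ n) (hc : 1 ≤ c * Real.log n) :
    1 / (n * Real.log n) - 1 / ((n + 1 : ℕ) * Real.log (n + 1 : ℕ)) ≤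
      (1 + c) / (n * (n + 1) * Real.log n) := by
  have hn0 : (0 : ℝ) < n := by exact_mod_cast (by omega : 0 < n)
  have ha : 0 < Real.log n := Real.log_pos (by exact_mod_cast (by omega : 1 < n))
  have hab : Real.log n ≤ Real.log (n + 1) := Real.log_le_log hn0 (by linarith)
  have hd := log_sub_le_one_div (N := n) (by omega)
  rw [le_div_iff₀ hn0] at hd
  push_cast
  generalize Real.log (n + 1) = b at *
  generalize Real.log n = a at *
  have hb : 0 < b := ha.trans_le hab
  have hc0 : 0 < c := pos_of_mul_pos_left (by linarith) ha.le
  have h1 : c * a ≤ c * b := by gcongr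
  calc 1 / (n * a) - 1 / ((n + 1 : ℝ) * b) = (b + (b - a) * n) / (n * (n + 1) * a * b) := by
        field_simp
        ring
    _ ≤ ((1 + c) * b) / (n * (n + 1) * a * b) := by
        gcongr
        linarith
    _ = _ := by field_simp

lemma powPsi_mul_le {n : ℕ} {c : ℝ} (hn : 2 ≤ n) (hc : 1 ≤ c * Real.log n) :
    powPsi n * (1 / (n * Real.log n) - 1 / ((n + 1 : ℕ) * Real.log (n + 1 : ℕ))) ≤
      4 * (1 + c) * (1 / √n - 1 / √(n + 1 : ℕ)) := by
  have hn0 : (0 : ℝ) < n := by exact_mod_cast (by omega : 0 < n)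
  have ha : 0 < Real.log n := Real.log_pos (by exact_mod_cast (by omega : 1 < n))
  have hc0 : 0 < c := pos_of_mul_pos_left (by linarith) ha.le
  have hs : 0 < √(n : ℝ) := Real.sqrt_pos.2 hn0
  have hss : √(n : ℝ) * √n = n := Real.mul_self_sqrt hn0.le
  have hrr : √((n + 1 : ℕ) : ℝ) * √(n + 1 : ℕ) = n + 1 := by
    rw [Real.mul_self_sqrt (by positivity)]
    push_cast
    rfl
  have hsr : √(n : ℝ) ≤ √(n + 1 : ℕ) := Real.sqrt_le_sqrt (by exact_mod_cast n.le_succ)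
  calc _ ≤ powPsi n * ((1 + c) / (n * (n + 1) * Real.log n)) :=
        mul_le_mul_of_nonneg_left (inv_mul_log_sub_le hn hc) (powPsi_nonneg n)
    _ ≤ 2 * √n * Real.log n * ((1 + c) / (n * (n + 1) * Real.log n)) :=
        mul_le_mul_of_nonneg_right (powPsi_le (by omega)) (by positivity)
    _ = (1 + c) * (2 * √n / (n * (n + 1))) := by field_simp
    _ ≤ (1 + c) * (4 * (1 / √n - 1 / √(n + 1 : ℕ))) := by
        refine mul_le_mul_of_nonneg_left ?_ (by linarith)
        rw [← hrr]
        nth_rw 2 [← hss]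
        generalize √(n : ℝ) = s at *
        generalize √((n + 1 : ℕ) : ℝ) = r at *
        have hr : 0 < r := hs.trans_le hsr
        have h1 : 1 ≤ 2 * r * (r - s) := by nlinarith
        calc 2 * s / (s * s * (r * r)) = 2 / (s * r * r) * 1 := by field_simp
          _ ≤ 2 / (s * r * r) * (2 * r * (r - s)) := by gcongr
          _ = _ := by
            field_simp
            ring
    _ = _ := by ring

lemma powSum_le {Q R : ℕ} {c : ℝ} (hQ : 2 ≤ Q) (hQR : Q ≤ R) (hc : 1 ≤ c * Real.log Q) :
    powSum Q R ≤ 4 * (1 + c) / √Q := by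
  have hlog : ∀ {n : ℕ}, Q ≤ n → 0 < Real.log n := fun hn =>
    Real.log_pos (by exact_mod_cast (by omega : 1 < _))
  have hQ0 : (0 : ℝ) < Q := by exact_mod_cast (by omega : 0 < Q)
  have hc0 : 0 < c := pos_of_mul_pos_left (by linarith) (hlog le_rfl).le
  have hcn : ∀ {n : ℕ}, Q ≤ n → 1 ≤ c * Real.log n := fun hn => hc.trans
    (mul_le_mul_of_nonneg_left (Real.log_le_log hQ0 (by exact_mod_cast hn)) hc0.le)
  have key : powSum Q R ≤ powPsi (R - 1) * (1 / (R * Real.log R)) +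
      4 * (1 + c) * (1 / √Q - 1 / √R) - powPsi (Q - 1) * (1 / (Q * Real.log Q)) := by
    induction R, hQR using Nat.le_induction with
    | base => simp [powSum]
    | succ R hR ih =>
      have h1 := powPsi_mul_le (hQ.trans hR) (hcn hR)
      have h2 : (if R.Prime then 0 else Λ R) / (R * Real.log R) =
          (powPsi R - powPsi (R - 1)) * (1 / (R * Real.log R)) := by
        obtain ⟨k, rfl⟩ := Nat.exists_eq_add_of_le' ((by omega : 1 ≤ Q).trans hR)
        rw [powPsi_succ, add_tsub_cancel_right, add_sub_cancel_left, mul_one_div]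
      rw [powSum_succ hR, h2, add_tsub_cancel_right]
      linarith
  have hR0 : (0 : ℝ) < R := hQ0.trans_le (by exact_mod_cast hQR)
  have hlR := hlog hQR
  have hs : 0 < √(R : ℝ) := Real.sqrt_pos.2 hR0
  have h1 : powPsi (R - 1) * (1 / (R * Real.log R)) ≤ 2 * (1 / √R) := by
    have h2 : powPsi (R - 1) ≤ powPsi R := by
      have := powPsi_le_succ (R - 1)
      rwa [Nat.sub_add_cancel (by omega)] at this
    calc _ ≤ 2 * √R * Real.log R * (1 / (R * Real.log R)) :=
          mul_le_mul_of_nonneg_right (h2.trans (powPsi_le (by omega))) (by positivity)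
      _ = 2 * (1 / √R) := by
          rw [← Real.sqrt_div_self']
          field_simp
  have h3 : 0 ≤ powPsi (Q - 1) * (1 / (Q * Real.log Q)) :=
    mul_nonneg (powPsi_nonneg _) (by have := hlog le_rfl; positivity)
  have h4 : 0 ≤ (2 + 4 * c) * (1 / √(R : ℝ)) := by positivity
  calc _ ≤ 4 * (1 + c) * (1 / √Q) := by linarith
    _ = _ := by ring

lemma log_mertensProd_succ {R : ℕ} (hR : R.Prime) :
    Real.log (mertensProd (R + 1)) = Real.log (mertensProd R) + Real.log (1 - (R : ℝ)⁻¹) := by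
  rw [mertensProd_succ, if_pos hR,
    Real.log_mul (mertensProd_pos R).ne' (one_sub_inv_pos hR).ne']

lemma vonMangoldt_div_eq {p : ℕ} (hp : p.Prime) : Λ p / (p * Real.log p) = 1 / p := by
  have h0 : (0 : ℝ) < p := by exact_mod_cast hp.pos
  have h1 : 0 < Real.log p := Real.log_pos (by exact_mod_cast hp.one_lt)
  rw [ArithmeticFunction.vonMangoldt_apply_prime hp]
  field_simp

lemma log_mertensProd_sub_le {Q R : ℕ} (hQ : 2 ≤ Q) (hQR : Q ≤ R) :
    Real.log (mertensProd Q) - Real.log (mertensProd R) ≤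
      vmLogSum Q R + (1 / (Q - 1 : ℝ) - 1 / (R - 1 : ℝ)) := by
  induction R, hQR using Nat.le_induction with
  | base => simp [vmLogSum_self]
  | succ R hR ih =>
    have hR1 : (0 : ℝ) < R - 1 := sub_pos.2 (by exact_mod_cast (by omega : 1 < R))
    rw [vmLogSum_succ hR]
    push_cast
    rw [add_sub_cancel_right]
    by_cases hp : R.Prime
    · rw [log_mertensProd_succ hp, vonMangoldt_div_eq hp]
      have h1 := Real.one_sub_inv_le_log_of_pos (one_sub_inv_pos hp)
      have h2 : 1 - (1 - (R : ℝ)⁻¹)⁻¹ = - (1 / (R - 1 : ℝ)) := by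
        have hR0 : (R : ℝ) ≠ 0 := by linarith
        have h3 : 1 - (R : ℝ)⁻¹ ≠ 0 := (one_sub_inv_pos hp).ne'
        field_simp
        ring
      rw [h2] at h1
      linarith
    · rw [mertensProd_succ, if_neg hp]
      have h1 : 1 / (R : ℝ) ≤ 1 / (R - 1 : ℝ) := one_div_le_one_div_of_le hR1 (by linarith)
      have h2 : 0 ≤ Λ R / (R * Real.log R) :=
        div_nonneg ArithmeticFunction.vonMangoldt_nonneg
          (mul_nonneg (Nat.cast_nonneg R) (Real.log_natCast_nonneg R))
      linarith

lemma le_log_mertensProd_sub {Q R : ℕ} (hQR : Q ≤ R) :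
    vmLogSum Q R - powSum Q R ≤ Real.log (mertensProd Q) - Real.log (mertensProd R) := by
  induction R, hQR using Nat.le_induction with
  | base => simp [vmLogSum_self, powSum]
  | succ R hR ih =>
    rw [vmLogSum_succ hR, powSum_succ hR]
    by_cases hp : R.Prime
    · rw [log_mertensProd_succ hp, vonMangoldt_div_eq hp, if_pos hp, zero_div]
      have := Real.log_le_sub_one_of_pos (one_sub_inv_pos hp)
      rw [one_div]
      linarith
    · rw [mertensProd_succ, if_neg hp, if_neg hp]
      linarith

lemma log_mertensRatio {n : ℕ} (hn : 1 < n) :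
    Real.log (mertensRatio n) = Real.log (Real.log n) + Real.log (mertensProd n) := by
  rw [mertensRatio, Real.log_mul (Real.log_pos (by exact_mod_cast hn)).ne'
    (mertensProd_pos n).ne']

lemma ten_lt_log {Q : ℕ} (hQ : 32771 ≤ Q) : 10.3972 < Real.log Q := by
  have h1 : Real.log 32768 ≤ Real.log Q :=
    Real.log_le_log (by norm_num) (by exact_mod_cast (by omega : 32768 ≤ Q))
  have := Real.log_two_gt_d9
  rw [log_two_pow_fifteen] at h1
  linarith

/-- Explicit Mertens bounds: beyond `32771` the ratio varies little. -/
lemma log_mertensRatio_sub {Q R : ℕ} (hQ : 32771 ≤ Q) (hQR : Q ≤ R) :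
    Real.log (mertensRatio Q) - Real.log (mertensRatio R) ≤ 0.1446 ∧
    Real.log (mertensRatio R) - Real.log (mertensRatio Q) ≤ 0.1687 := by
  have hlow : ∀ N, Q - 1 ≤ N → Real.log N + -1 ≤ vmSum N := fun N hN =>
    log_sub_one_le_vmSum (by omega)
  have hup : ∀ N, Q - 1 ≤ N → vmSum N ≤ Real.log N + 0.5016 := fun N hN => vmSum_le (by omega)
  have h1 := vmLogSum_le (by omega) hQR (hlow _ le_rfl) hup
  have h2 := le_vmLogSum (by omega) hQR hlow (hup _ le_rfl) (by norm_num)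
  have h3 := log_mertensProd_sub_le (by omega) hQR
  have h4 := le_log_mertensProd_sub hQR
  have hlog := ten_lt_log hQ
  have h5 := powSum_le (c := 0.0962) (by omega) hQR (by linarith)
  have hQr : (32771 : ℝ) ≤ Q := by exact_mod_cast hQ
  have hRr : (Q : ℝ) ≤ R := by exact_mod_cast hQR
  rw [log_mertensRatio (by omega), log_mertensRatio (by omega)]
  constructor
  · have h6 : Real.log Q - Real.log (Q - 1 : ℕ) ≤ 0.0001 := by
      have h := log_sub_le_one_div (N := Q - 1) (by omega)
      rw [show ((Q - 1 : ℕ) : ℝ) + 1 = Q by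
        rw [← Nat.cast_add_one, Nat.sub_add_cancel (by omega)]] at h
      refine h.trans ?_
      rw [div_le_iff₀ (by exact_mod_cast (by omega : 0 < Q - 1))]
      have : (32770 : ℝ) ≤ (Q - 1 : ℕ) := by exact_mod_cast (by omega : 32770 ≤ Q - 1)
      linarith
    have h7 : (0.5016 - -1 + (Real.log Q - Real.log (Q - 1 : ℕ))) / Real.log Q ≤ 0.1445 := by
      rw [div_le_iff₀ (by linarith)]
      linarith
    have h8 : 1 / (Q - 1 : ℝ) ≤ 0.0001 := by
      rw [div_le_iff₀ (by linarith)]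
      linarith
    have h9 : 0 ≤ 1 / (R - 1 : ℝ) := one_div_nonneg.2 (by linarith)
    linarith
  · have h7 : (0.5016 - -1 + 1 / (Q : ℝ)) / Real.log Q ≤ 0.14443 := by
      have h8 : 1 / (Q : ℝ) ≤ 0.00004 := by
        rw [div_le_iff₀ (by linarith)]
        linarith
      rw [div_le_iff₀ (by linarith)]
      linarith
    have h8 : 4 * (1 + 0.0962) / √(Q : ℝ) ≤ 0.02423 := by
      have : (181.02 : ℝ) ≤ √Q := Real.le_sqrt_of_sq_le (by norm_num; linarith)
      rw [div_le_iff₀ (by linarith)]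
      linarith
    linarith

lemma le_mul_of_log_sub_le {x y c : ℝ} (hx : 0 < x) (hy : 0 < y) (hc : 0 < c)
    (h : Real.log x - Real.log y ≤ Real.log c) : x ≤ c * y := by
  rw [← Real.log_le_log_iff hx (mul_pos hc hy), Real.log_mul hc.ne' hy.ne']
  linarith

/-- Beyond `32771` the ratio decreases at most by the factor `1.1556`. -/
lemma mertensRatio_le_mul {Q R : ℕ} (hQ : 32771 ≤ Q) (hQR : Q ≤ R) :
    mertensRatio Q ≤ 1.1556 * mertensRatio R := by
  refine le_mul_of_log_sub_le (mertensRatio_pos (by omega)) (mertensRatio_pos (by omega))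
    (by norm_num) ((log_mertensRatio_sub hQ hQR).1.trans ?_)
  have h := Real.sum_range_le_log_div (x := 0.1556 / 2.1556) (by norm_num) (by norm_num) 3
  norm_num [Finset.sum_range_succ] at h ⊢
  linarith

/-- Beyond `32771` the ratio increases at most by the factor `1.1838`. -/
lemma mertensRatio_le_mul' {Q R : ℕ} (hQ : 32771 ≤ Q) (hQR : Q ≤ R) :
    mertensRatio R ≤ 1.1838 * mertensRatio Q := by
  refine le_mul_of_log_sub_le (mertensRatio_pos (by omega)) (mertensRatio_pos (by omega))
    (by norm_num) ((log_mertensRatio_sub hQ hQR).2.trans ?_)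
  have h := Real.sum_range_le_log_div (x := 0.1838 / 2.1838) (by norm_num) (by norm_num) 3
  norm_num [Finset.sum_range_succ] at h ⊢
  linarith

lemma mertensRatio_le_alpha_mul {q P : ℕ} (hq3 : 3 ≤ q) (hP : P.Prime)
    (h : q ≤ P) : mertensRatio q ≤ 1.157 * mertensRatio P := by
  obtain ⟨h₁, h₂, h₃⟩ := mertensRatio_small
  have hpos := mertensRatio_pos hP.one_lt
  rcases le_or_gt 32771 q with hq' | hq'
  · linarith [mertensRatio_le_mul hq' h]
  have hu := h₁ q hq3 hq'.le
  rcases le_or_gt 32771 P with hP' | hP'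
  · linarith [mertensRatio_le_mul le_rfl hP']
  · linarith [h₂ P hP (hq3.trans h) hP']

lemma mertensRatio_le_beta_mul {x n : ℕ} (hx : x.Prime) (hx3 : 3 ≤ x) (h : x ≤ n) :
    mertensRatio n ≤ 1.282 * mertensRatio x := by
  obtain ⟨h₁, h₂, -⟩ := mertensRatio_small
  have hpos := mertensRatio_pos hx.one_lt
  rcases le_or_gt 32771 x with hx' | hx'
  · linarith [mertensRatio_le_mul' hx' h]
  have hl := h₂ x hx hx3 hx'
  rcases le_or_gt n 32771 with hn | hn
  · linarith [h₁ n (hx3.trans h) hn]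
  · linarith [mertensRatio_le_mul' le_rfl hn.le, h₁ 32771 (by norm_num) le_rfl]

end ErdosPrimitive

theorem odd_primes_up_to_p1e8_erdos_strong (q : ℕ) (hq : q.Prime) (hodd : Odd q)
    (hle : q ≤ 2038074743) : ErdosStrong q := by
  have hq3 : 3 ≤ q := by
    obtain ⟨k, rfl⟩ := hodd
    have := hq.two_le
    omega
  exact ErdosPrimitive.erdosStrong_of_mertensRatio hq (by norm_num) (by norm_num)
    (fun P hP h => ErdosPrimitive.mertensRatio_le_alpha_mul hq3 hP h)
    (fun x hx h n hn => ErdosPrimitive.mertensRatio_le_beta_mul hx (hq3.trans h) hn)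
    ErdosPrimitive.numeric_bound
end
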